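/- arXiv:2103.02960 — 6 statements merged into one kernel-verified Lean document; each statement's English description precedes it below -/
import Mathlib

section
/- Let S be a finite family of n axis-parallel line segments in the plane with n > 1, no two segments lying on a common line, and let F be a face of the arrangement A_S. Then |E_F| ≤ 4n − 4. -/
open Set

/-- Points of the plane. -/
abbrev Pt : Type := ℝ × ℝ

/-- `p` is an endpoint of the line segment `s`. -/
def SegEndpoint (s : Set Pt) (p : Pt) : Prop :=
  ∃ a b : Pt, a ≠ b ∧ s = segment ℝ a b ∧ (p = a ∨ p = b)

/-- The vertices of the arrangement `A_S`: endpoints of the segments together with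
intersection points of pairs of segments. -/
def ArrVertices {ι : Type*} (S : ι → Set Pt) : Set Pt :=
  {p | ∃ i, SegEndpoint (S i) p} ∪ {p | ∃ i j, i ≠ j ∧ p ∈ S i ∧ p ∈ S j}

/-- The edges of the arrangement `A_S`: closures of the connected components of
`⋃ S` minus the vertex set. -/
def ArrEdges {ι : Type*} (S : ι → Set Pt) : Set (Set Pt) :=
  {e | ∃ x ∈ (⋃ i, S i) \ ArrVertices S,
    e = closure (connectedComponentIn ((⋃ i, S i) \ ArrVertices S) x)}

/-- The faces of the arrangement `A_S`: closures of the connected components of the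
complement of `⋃ S`. -/
def ArrFaces {ι : Type*} (S : ι → Set Pt) : Set (Set Pt) :=
  {F | ∃ x ∉ ⋃ i, S i, F = closure (connectedComponentIn (⋃ i, S i)ᶜ x)}

/-- `E_F`: the set of edges of `A_S` contained in the boundary of the face `F`. -/
def FaceEdges {ι : Type*} (S : ι → Set Pt) (F : Set Pt) : Set (Set Pt) :=
  {e | e ∈ ArrEdges S ∧ e ⊆ frontier F}

/-- A finite set connected by a finite set of pairs has at most one more element than
there are pairs. -/
lemma card_le_card_add_one_of_eqvGen {α : Type*} [DecidableEq α] (K : Finset α)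
    (E : Finset (α × α)) (hE : ∀ e ∈ E, e.1 ∈ K ∧ e.2 ∈ K)
    (hconn : ∀ q ∈ K, ∀ q' ∈ K, Relation.EqvGen (fun a b => (a, b) ∈ E) q q') :
    K.card ≤ E.card + 1 := by
  classical
  rcases K.eq_empty_or_nonempty with rfl | ⟨r, hr⟩
  · simp
  let G : SimpleGraph K := SimpleGraph.fromRel (fun a b => (a.1, b.1) ∈ E)
  have key : ∀ q q', Relation.EqvGen (fun a b => (a, b) ∈ E) q q' →
      (q ∈ K ↔ q' ∈ K) ∧ ∀ (h : q ∈ K) (h' : q' ∈ K), G.Reachable ⟨q, h⟩ ⟨q', h'⟩ := by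
    intro q q' h
    induction h with
    | rel a b hab =>
      refine ⟨iff_of_true (hE _ hab).1 (hE _ hab).2, fun h h' => ?_⟩
      by_cases e : a = b
      · subst e; exact SimpleGraph.Reachable.refl _
      · refine SimpleGraph.Adj.reachable ?_
        rw [SimpleGraph.fromRel_adj]
        exact ⟨fun e' => e (congrArg Subtype.val e'), Or.inl hab⟩
    | refl a => exact ⟨Iff.rfl, fun h h' => SimpleGraph.Reachable.refl _⟩
    | symm a b _ ih => exact ⟨ih.1.symm, fun h h' => (ih.2 h' h).symm⟩
    | trans a b d _ _ ih1 ih2 =>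
      exact ⟨ih1.1.trans ih2.1, fun h h' =>
        (ih1.2 h (ih1.1.1 h)).trans (ih2.2 (ih1.1.1 h) h')⟩
  have hG : G.Connected := by
    have : Nonempty K := ⟨⟨r, hr⟩⟩
    exact SimpleGraph.Connected.mk
      fun u v => (key u.1 v.1 (hconn _ u.2 _ v.2)).2 u.2 v.2
  have h1 := hG.card_vert_le_card_edgeSet_add_one
  have h2 : Nat.card G.edgeSet ≤ E.card := by
    have hsub : Set.MapsTo (Sym2.map Subtype.val) G.edgeSet
        (E.image (fun e => s(e.1, e.2)) : Set (Sym2 α)) := by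
      intro e
      induction e with
      | _ a b =>
        intro hab
        rw [SimpleGraph.mem_edgeSet, SimpleGraph.fromRel_adj] at hab
        simp only [Finset.coe_image, Set.mem_image, Finset.mem_coe, Sym2.map_mk]
        rcases hab.2 with h | h
        · exact ⟨_, h, rfl⟩
        · exact ⟨_, h, Sym2.eq_swap⟩
    have h3 : G.edgeSet.ncard ≤ (E.image (fun e => s(e.1, e.2)) : Set (Sym2 α)).ncard :=
      Set.ncard_le_ncard_of_injOn _ hsub
        ((Sym2.map.injective Subtype.val_injective).injOn) (Finset.finite_toSet _)
    rw [Set.ncard_coe_finset] at h3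
    exact (Nat.card_coe_set_eq _).trans_le (h3.trans Finset.card_image_le)
  have h3 : Nat.card K = K.card := by simp
  omega

/-- Elementary moves between the cells `(i, j)`, `i, j ≤ m`, of a grid, where `V i j` says
that the wall between `(i, j)` and `(i + 1, j)` is blocked and `H j i` that the wall between
`(i, j)` and `(i, j + 1)` is blocked. -/
def CellStep (m : ℕ) (V H : ℕ → ℕ → Bool) (q q' : ℕ × ℕ) : Prop :=
  (q' = (q.1 + 1, q.2) ∧ q.1 < m ∧ q.2 ≤ m ∧ V q.1 q.2 = false) ∨
    (q' = (q.1, q.2 + 1) ∧ q.2 < m ∧ q.1 ≤ m ∧ H q.2 q.1 = false)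

/-- The cells labelled by `c` form a connected component of the grid with walls `V`, `H`. -/
structure IsCellComponent (m : ℕ) (c V H : ℕ → ℕ → Bool) : Prop where
  right : ∀ i < m, ∀ j ≤ m, V i j = false → c (i + 1) j = c i j
  up : ∀ j < m, ∀ i ≤ m, H j i = false → c i (j + 1) = c i j
  conn : ∀ q q' : ℕ × ℕ, q.1 ≤ m → q.2 ≤ m → q'.1 ≤ m → q'.2 ≤ m →
    c q.1 q.2 = true → c q'.1 q'.2 = true → Relation.EqvGen (CellStep m V H) q q'

/-- The grid point with index `(i, j)` is contained in no blocked wall. -/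
def pointOpen (V H : ℕ → ℕ → Bool) (i j : ℕ) : Bool :=
  !V i j && !V i (j + 1) && !H j i && !H j (i + 1)

/-- Four times the contribution of a grid point to the Euler characteristic. -/
def eulerWeight (c V H : ℕ → ℕ → Bool) (i j : ℕ) : ℤ :=
  (c i j).toInt + (c i (j + 1)).toInt + (c (i + 1) j).toInt + (c (i + 1) (j + 1)).toInt
    - 2 * ((c i j && !V i j).toInt + (c i (j + 1) && !V i (j + 1)).toInt)
    - 2 * ((c i j && !H j i).toInt + (c (i + 1) j && !H j (i + 1)).toInt)
    + 4 * (c i j && pointOpen V H i j).toInt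

lemma sum_toInt_eq_card (s t : Finset ℕ) (f : ℕ → ℕ → Bool) :
    ∑ i ∈ s, ∑ j ∈ t, (f i j).toInt = (((s ×ˢ t).filter (fun p => f p.1 p.2)).card : ℤ) := by
  rw [Finset.card_filter, ← Finset.sum_product']
  push_cast
  refine Finset.sum_congr rfl fun p _ => ?_
  cases f p.1 p.2 <;> rfl

lemma euler_char_le_one {m : ℕ} {c V H : ℕ → ℕ → Bool} (hc : IsCellComponent m c V H) :
    ∑ i ∈ Finset.range (m + 1), ∑ j ∈ Finset.range (m + 1), (c i j).toInt
      - ∑ i ∈ Finset.range m, ∑ j ∈ Finset.range (m + 1), (c i j && !V i j).toInt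
      - ∑ i ∈ Finset.range (m + 1), ∑ j ∈ Finset.range m, (c i j && !H j i).toInt
      + ∑ i ∈ Finset.range m, ∑ j ∈ Finset.range m, (c i j && pointOpen V H i j).toInt ≤ 1 := by
  classical
  let K := ((Finset.range (m + 1)) ×ˢ (Finset.range (m + 1))).filter (fun p => c p.1 p.2)
  let a : ℕ → ℕ → Bool := fun i j => c i j && !V i j
  let b : ℕ → ℕ → Bool := fun i j => c i j && !H j i
  let d : ℕ → ℕ → Bool := fun i j => c i j && pointOpen V H i j
  let b' : ℕ → ℕ → Bool := fun i j => match i with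
    | 0 => b 0 j
    | i + 1 => b (i + 1) j && !d i j
  have hdc : ∀ i < m, ∀ j < m, d i j = true →
      c i j = true ∧ c (i + 1) j = true ∧ c i (j + 1) = true ∧ c (i + 1) (j + 1) = true ∧
      V i j = false ∧ V i (j + 1) = false ∧ H j i = false ∧ H j (i + 1) = false := by
    intro i hi j hj h
    simp only [d, pointOpen, Bool.and_eq_true, Bool.not_eq_true'] at h
    obtain ⟨h0, ⟨⟨h1, h2⟩, h3⟩, h4⟩ := h
    have e1 := hc.right i hi j hj.le h1
    have e2 := hc.right i hi (j + 1) hj h2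
    have e3 := hc.up j hj i hi.le h3
    simp_all
  have hb' : ∑ i ∈ Finset.range (m + 1), ∑ j ∈ Finset.range m, (b' i j).toInt
      = ∑ i ∈ Finset.range (m + 1), ∑ j ∈ Finset.range m, (b i j).toInt
      - ∑ i ∈ Finset.range m, ∑ j ∈ Finset.range m, (d i j).toInt := by
    rw [Finset.sum_range_succ', Finset.sum_range_succ' (fun i => ∑ j ∈ Finset.range m, (b i j).toInt),
      add_sub_right_comm, ← Finset.sum_sub_distrib]
    congr 1
    refine Finset.sum_congr rfl fun i hi => ?_
    rw [← Finset.sum_sub_distrib]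
    refine Finset.sum_congr rfl fun j hj => ?_
    rw [Finset.mem_range] at hi hj
    have h := hdc i hi j hj
    change (b (i + 1) j && !d i j).toInt = _
    cases hd : d i j
    · simp
    · obtain ⟨-, h1, -, -, -, -, -, h2⟩ := h hd
      simp [b, h1, h2]
  let E1 := (((Finset.range m) ×ˢ (Finset.range (m + 1))).filter (fun p => a p.1 p.2)).image
    (fun p => (p, (p.1 + 1, p.2)))
  let E2 := (((Finset.range (m + 1)) ×ˢ (Finset.range m)).filter (fun p => b' p.1 p.2)).image
    (fun p => (p, (p.1, p.2 + 1)))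
  have hbb : ∀ i j, b' i j = true → b i j = true := by
    intro i j h
    cases i with
    | zero => exact h
    | succ i =>
      simp only [b', Bool.and_eq_true] at h
      exact h.1
  have mE1 : ∀ i j, i < m → j ≤ m → c i j = true → V i j = false →
      ((i, j), (i + 1, j)) ∈ E1 ∪ E2 := by
    intro i j hi hj h1 h2
    refine Finset.mem_union_left _ (Finset.mem_image.2 ⟨(i, j), ?_, rfl⟩)
    simp [a, h1, h2]; omega
  have hE : ∀ e ∈ E1 ∪ E2, e.1 ∈ K ∧ e.2 ∈ K := by
    intro e he
    rcases Finset.mem_union.1 he with he | he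
    · obtain ⟨⟨i, j⟩, hp, rfl⟩ := Finset.mem_image.1 he
      simp only [Finset.mem_filter, Finset.mem_product, Finset.mem_range, a, Bool.and_eq_true,
        Bool.not_eq_true'] at hp
      have := hc.right i hp.1.1 j (by omega) hp.2.2
      simp only [K, Finset.mem_filter, Finset.mem_product, Finset.mem_range]
      refine ⟨⟨⟨?_, ?_⟩, ?_⟩, ⟨?_, ?_⟩, ?_⟩ <;> first | omega | simp_all
    · obtain ⟨⟨i, j⟩, hp, rfl⟩ := Finset.mem_image.1 he
      simp only [Finset.mem_filter, Finset.mem_product, Finset.mem_range] at hp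
      have hb := hbb _ _ hp.2
      simp only [b, Bool.and_eq_true, Bool.not_eq_true'] at hb
      have := hc.up j hp.1.2 i (by omega) hb.2
      simp only [K, Finset.mem_filter, Finset.mem_product, Finset.mem_range]
      refine ⟨⟨⟨?_, ?_⟩, ?_⟩, ⟨?_, ?_⟩, ?_⟩ <;> first | omega | simp_all
  have hup : ∀ i j, i ≤ m → j < m → c i j = true → H j i = false →
      Relation.EqvGen (fun a b => (a, b) ∈ E1 ∪ E2) (i, j) (i, j + 1) := by
    intro i
    induction i with
    | zero =>
      intro j hi hj h1 h2
      refine Relation.EqvGen.rel _ _ (Finset.mem_union_right _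
        (Finset.mem_image.2 ⟨(0, j), ?_, rfl⟩))
      simp [b', b, h1, h2, hj]
    | succ i ih =>
      intro j hi hj h1 h2
      cases hd : d i j
      · refine Relation.EqvGen.rel _ _ (Finset.mem_union_right _
          (Finset.mem_image.2 ⟨(i + 1, j), ?_, rfl⟩))
        simp [b', b, h1, h2, hj, hd]; omega
      · obtain ⟨k1, k2, k3, k4, k5, k6, k7, k8⟩ := hdc i (by omega) j hj hd
        exact ((Relation.EqvGen.rel _ _ (mE1 i j (by omega) hj.le k1 k5)).symm.trans _ _ _
          (ih j (by omega) hj k1 k7)).trans _ _ _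
            (Relation.EqvGen.rel _ _ (mE1 i (j + 1) (by omega) hj k3 k6))
  have hmove : ∀ q q', Relation.EqvGen (CellStep m V H) q q' →
      (q ∈ K ↔ q' ∈ K) ∧ (q ∈ K → Relation.EqvGen (fun a b => (a, b) ∈ E1 ∪ E2) q q') := by
    intro q q' h
    induction h with
    | rel q q' h =>
      obtain ⟨i, j⟩ := q
      rcases h with ⟨rfl, h1, h2, h3⟩ | ⟨rfl, h1, h2, h3⟩
      · simp only at h1 h2 h3
        have := hc.right i h1 j h2 h3
        simp only [K, Finset.mem_filter, Finset.mem_product, Finset.mem_range, this]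
        refine ⟨⟨fun h => ⟨⟨by omega, by omega⟩, h.2⟩, fun h => ⟨⟨by omega, by omega⟩, h.2⟩⟩,
          fun h => Relation.EqvGen.rel _ _ (mE1 i j h1 h2 h.2 h3)⟩
      · simp only at h1 h2 h3
        have := hc.up j h1 i h2 h3
        simp only [K, Finset.mem_filter, Finset.mem_product, Finset.mem_range, this]
        refine ⟨⟨fun h => ⟨⟨by omega, by omega⟩, h.2⟩, fun h => ⟨⟨by omega, by omega⟩, h.2⟩⟩,
          fun h => hup i j h2 h1 h.2 h3⟩
    | refl q => exact ⟨Iff.rfl, fun _ => Relation.EqvGen.refl _⟩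
    | symm q q' _ ih => exact ⟨ih.1.symm, fun h => (ih.2 (ih.1.2 h)).symm⟩
    | trans q q' q'' _ _ ih1 ih2 =>
      exact ⟨ih1.1.trans ih2.1, fun h => (ih1.2 h).trans _ _ _ (ih2.2 (ih1.1.1 h))⟩
  have hK := card_le_card_add_one_of_eqvGen K (E1 ∪ E2) hE fun q hq q' hq' => by
    refine (hmove q q' ?_).2 hq
    simp only [K, Finset.mem_filter, Finset.mem_product, Finset.mem_range] at hq hq'
    exact hc.conn q q' (by omega) (by omega) (by omega) (by omega) hq.2 hq'.2
  have hcard := Finset.card_union_le E1 E2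
  have hc1 : E1.card ≤ _ := Finset.card_image_le
  have hc2 : E2.card ≤ _ := Finset.card_image_le
  rw [sum_toInt_eq_card, sum_toInt_eq_card _ _ (fun i j => c i j && !V i j)]
  rw [sum_toInt_eq_card] at hb'
  change (K.card : ℤ) - _ - ∑ i ∈ Finset.range (m + 1), ∑ j ∈ Finset.range m, (b i j).toInt
    + ∑ i ∈ Finset.range m, ∑ j ∈ Finset.range m, (d i j).toInt ≤ 1
  zify at hK hcard hc1 hc2
  linarith

lemma sum_range_add_succ (m : ℕ) (f : ℕ → ℤ) :
    ∑ i ∈ Finset.range m, (f i + f (i + 1))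
      = 2 * ∑ i ∈ Finset.range (m + 1), f i - f 0 - f m := by
  induction m with
  | zero => simp; ring
  | succ m ih => rw [Finset.sum_range_succ, ih, Finset.sum_range_succ _ (m + 1)]; ring

lemma sum_eulerWeight_le {m : ℕ} {c V H : ℕ → ℕ → Bool} (hc : IsCellComponent m c V H) :
    ∑ i ∈ Finset.range m, ∑ j ∈ Finset.range m, eulerWeight c V H i j ≤ 4 := by
  have h1 := euler_char_le_one hc
  let X : ℕ → ℤ := fun i => ∑ j ∈ Finset.range m,
    ((c i j).toInt + (c i (j + 1)).toInt - 2 * (c i j && !H j i).toInt)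
  let Y : ℕ → ℤ := fun i => ∑ j ∈ Finset.range m,
    ((c i j && !V i j).toInt + (c i (j + 1) && !V i (j + 1)).toInt
      - 2 * (c i j && pointOpen V H i j).toInt)
  have hX0 : ∀ i ≤ m, 0 ≤ X i := by
    intro i hi
    refine Finset.sum_nonneg fun j hj => ?_
    have := hc.up j (Finset.mem_range.1 hj) i hi
    revert this
    generalize c i j = p, c i (j + 1) = q, H j i = r
    revert p q r; decide
  have hX : ∀ i, X i = 2 * ∑ j ∈ Finset.range (m + 1), (c i j).toInt - (c i 0).toInt
      - (c i m).toInt - 2 * ∑ j ∈ Finset.range m, (c i j && !H j i).toInt := by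
    intro i
    simp only [X]
    rw [Finset.sum_sub_distrib, sum_range_add_succ m (fun j => (c i j).toInt), Finset.mul_sum]
    simp only [Finset.mul_sum]
  have hY : ∀ i, Y i = 2 * ∑ j ∈ Finset.range (m + 1), (c i j && !V i j).toInt
      - (c i 0 && !V i 0).toInt - (c i m && !V i m).toInt
      - 2 * ∑ j ∈ Finset.range m, (c i j && pointOpen V H i j).toInt := by
    intro i
    simp only [Y]
    rw [Finset.sum_sub_distrib, sum_range_add_succ m (fun j => (c i j && !V i j).toInt),
      Finset.mul_sum]
    simp only [Finset.mul_sum]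
  have hw : ∑ i ∈ Finset.range m, ∑ j ∈ Finset.range m, eulerWeight c V H i j
      = 2 * ∑ i ∈ Finset.range (m + 1), X i - X 0 - X m - 2 * ∑ i ∈ Finset.range m, Y i := by
    rw [← sum_range_add_succ, Finset.mul_sum, ← Finset.sum_sub_distrib]
    refine Finset.sum_congr rfl fun i _ => ?_
    simp only [X, Y]
    rw [Finset.mul_sum, ← Finset.sum_add_distrib, ← Finset.sum_sub_distrib]
    refine Finset.sum_congr rfl fun j _ => ?_
    unfold eulerWeight
    ring
  have hside : ∀ j, ∑ i ∈ Finset.range m, (c i j && !V i j).toInt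
      ≤ ∑ i ∈ Finset.range (m + 1), (c i j).toInt := by
    intro j
    rw [Finset.sum_range_succ]
    have : ∑ i ∈ Finset.range m, (c i j && !V i j).toInt
        ≤ ∑ i ∈ Finset.range m, (c i j).toInt :=
      Finset.sum_le_sum fun i _ => by cases c i j <;> cases V i j <;> decide
    have : 0 ≤ (c m j).toInt := by cases c m j <;> decide
    linarith
  have s0 := hside 0
  have sm := hside m
  rw [hw]
  simp only [hX, hY, Finset.sum_sub_distrib, ← Finset.mul_sum]
  have x0 := hX0 0 (Nat.zero_le _)
  have xm := hX0 m le_rfl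
  rw [hX] at x0 xm
  linarith
/-- The walls on the `i`-th grid line blocked by a segment from the grid point `l i` to the
grid point `h i`. -/
def blocked (l h : ℕ → ℕ) (i j : ℕ) : Bool := decide (l i < j ∧ j ≤ h i)

lemma blocked_eq_true {l h : ℕ → ℕ} {i j : ℕ} : blocked l h i j = true ↔ l i < j ∧ j ≤ h i := by
  simp [blocked]

/-- The grid lines carrying a segment. -/
def usedLines (m : ℕ) (l h : ℕ → ℕ) : Finset ℕ := (Finset.range m).filter (fun i => l i < h i)

/-- The grid lines carrying a segment that meets no segment of the other direction. -/
def isolatedLines (m : ℕ) (l h : ℕ → ℕ) (H : ℕ → ℕ → Bool) : Finset ℕ :=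
  (usedLines m l h).filter
    (fun i => ∀ j ∈ Finset.Icc (l i) (h i), H j i = false ∧ H j (i + 1) = false)

/-- For a grid point on a vertical segment: being a vertex of the arrangement. -/
def isVertex (V H : ℕ → ℕ → Bool) (i j : ℕ) : Bool :=
  H j i || H j (i + 1) || !(V i j && V i (j + 1))

lemma isVertex_eq_false {V H : ℕ → ℕ → Bool} {i j : ℕ} : isVertex V H i j = false ↔
    H j i = false ∧ H j (i + 1) = false ∧ V i j = true ∧ V i (j + 1) = true := by
  simp [isVertex]; tauto

/-- `(i, j₁, j₂)` describes a vertical edge separating `c` from its complement: it lies on the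
`i`-th line and joins the consecutive vertices `j₁ < j₂`. -/
structure IsSeparatingEdge (m : ℕ) (c V H : ℕ → ℕ → Bool) (i j₁ j₂ : ℕ) : Prop where
  line_lt : i < m
  lt : j₁ < j₂
  top_lt : j₂ < m
  wall : ∀ j, j₁ < j → j ≤ j₂ → V i j = true
  ne : ∀ j, j₁ < j → j ≤ j₂ → c i j ≠ c (i + 1) j
  bot : isVertex V H i j₁ = true
  top : isVertex V H i j₂ = true
  between : ∀ j, j₁ < j → j < j₂ → isVertex V H i j = false

/-- The vertical segment through the grid point `(i, j)` ends there, with `c` all around. -/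
def freeEnd (c V H : ℕ → ℕ → Bool) (i j : ℕ) : Bool :=
  !H j i && !H j (i + 1) && (V i j ^^ V i (j + 1)) && c i j

/-- The edge leaving the vertex `(i, j)` along the wall `(i, k)` has `c` on both sides. -/
def twoSided (c V H : ℕ → ℕ → Bool) (i j k : ℕ) : Bool :=
  isVertex V H i j && V i k && c i k && c (i + 1) k

/-- The edge leaving the vertex `(i, j)` along the wall `(i, k)` has `c` on one side. -/
def oneSided (c V H : ℕ → ℕ → Bool) (i j k : ℕ) : Bool :=
  isVertex V H i j && V i k && (c i k ^^ c (i + 1) k)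

lemma local_bound {m : ℕ} {c V H : ℕ → ℕ → Bool} (hc : IsCellComponent m c V H) {i j : ℕ}
    (hi : i < m) (hj : j < m) :
    (oneSided c V H i j j).toInt + (oneSided c V H i j (j + 1)).toInt
      + 2 * ((twoSided c V H i j j).toInt + (twoSided c V H i j (j + 1)).toInt)
      ≤ eulerWeight c V H i j + 2 * (H j i ^^ H j (i + 1)).toInt
        + 4 * (freeEnd c V H i j).toInt := by
  have h1 := hc.right i hi j hj.le
  have h2 := hc.right i hi (j + 1) hj
  have h3 := hc.up j hj i hi.le
  have h4 := hc.up j hj (i + 1) hi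
  unfold oneSided twoSided eulerWeight freeEnd isVertex pointOpen
  revert h1 h2 h3 h4
  generalize c i j = c1, c (i + 1) j = c2, c i (j + 1) = c3, c (i + 1) (j + 1) = c4,
    V i j = v1, V i (j + 1) = v2, H j i = k1, H j (i + 1) = k2
  revert c1 c2 c3 c4 v1 v2 k1 k2
  decide

lemma exists_last_of_lt {P : ℕ → Prop} {l h : ℕ} (hlt : l < h) (hl : P l) :
    ∃ j, l ≤ j ∧ j < h ∧ P j ∧ ∀ k, j < k → k < h → ¬ P k := by
  induction h, hlt using Nat.le_induction with
  | base => exact ⟨l, le_rfl, by omega, hl, fun k h1 h2 => by omega⟩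
  | succ h hlt ih =>
    by_cases hP : P h
    · exact ⟨h, by omega, by omega, hP, fun k h1 h2 => by omega⟩
    · obtain ⟨j, h1, h2, h3, h4⟩ := ih
      refine ⟨j, h1, by omega, h3, fun k hk1 hk2 => ?_⟩
      rcases Nat.lt_succ_iff_lt_or_eq.1 hk2 with h | rfl
      · exact h4 k hk1 h
      · exact hP

lemma exists_first_of_lt {P : ℕ → Prop} {l h : ℕ} (hlt : l < h) (hh : P h) :
    ∃ j, l < j ∧ j ≤ h ∧ P j ∧ ∀ k, l < k → k < j → ¬ P k := by
  classical
  have hex : ∃ j, l < j ∧ P j := ⟨h, hlt, hh⟩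
  exact ⟨Nat.find hex, (Nat.find_spec hex).1, Nat.find_min' hex ⟨hlt, hh⟩, (Nat.find_spec hex).2,
    fun k hk1 hk2 hP => Nat.find_min hex hk2 ⟨hk1, hP⟩⟩

lemma const_along_edge {m : ℕ} {c V H : ℕ → ℕ → Bool} (hc : IsCellComponent m c V H)
    {i a b : ℕ} (hi : i < m) (hb : b < m)
    (hn : ∀ j, a < j → j < b → isVertex V H i j = false) :
    ∀ j k, a < j → j ≤ k → k ≤ b → c i k = c i j ∧ c (i + 1) k = c (i + 1) j := by
  intro j k haj hjk
  induction k, hjk using Nat.le_induction with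
  | base => exact fun _ => ⟨rfl, rfl⟩
  | succ k hjk ih =>
    intro hkb
    obtain ⟨h1, h2⟩ := ih (by omega)
    obtain ⟨h3, h4, -, -⟩ := isVertex_eq_false.1 (hn k (by omega) (by omega))
    exact ⟨(hc.up k (by omega) i hi.le h3).trans h1, (hc.up k (by omega) (i + 1) hi h4).trans h2⟩

lemma freeEnd_cells {m : ℕ} {c V H : ℕ → ℕ → Bool} (hc : IsCellComponent m c V H) {i j : ℕ}
    (hi : i < m) (hj : j < m) (h : freeEnd c V H i j = true) :
    isVertex V H i j = true ∧ c i j = true ∧ c (i + 1) j = true ∧ c i (j + 1) = true ∧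
      c (i + 1) (j + 1) = true ∧ H j i = false ∧ H j (i + 1) = false := by
  have h1 := hc.right i hi j hj.le
  have h2 := hc.right i hi (j + 1) hj
  have h3 := hc.up j hj i hi.le
  have h4 := hc.up j hj (i + 1) hi
  simp only [freeEnd, Bool.and_eq_true, Bool.not_eq_true'] at h
  obtain ⟨⟨⟨k1, k2⟩, hv⟩, hc1⟩ := h
  cases hv1 : V i j <;> cases hv2 : V i (j + 1) <;> simp_all [isVertex]

lemma toInt_nonneg (b : Bool) : 0 ≤ b.toInt := by cases b <;> decide

lemma one_le_sum_toInt {s : Finset ℕ} {f : ℕ → Bool} {a : ℕ} (ha : a ∈ s) (h : f a = true) :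
    1 ≤ ∑ j ∈ s, (f j).toInt := by
  have := Finset.single_le_sum (f := fun j => (f j).toInt) (fun j _ => toInt_nonneg _) ha
  simpa [h] using this

lemma two_le_sum_toInt {s : Finset ℕ} {f : ℕ → Bool} {a b : ℕ} (ha : a ∈ s) (hb : b ∈ s)
    (hab : a ≠ b) (h : f a = true) (h' : f b = true) : 2 ≤ ∑ j ∈ s, (f j).toInt := by
  have := Finset.add_le_sum (f := fun j => (f j).toInt) (fun j _ => toInt_nonneg _) ha hb hab
  simpa [h, h'] using this

lemma freeEnd_bound {m : ℕ} {c H : ℕ → ℕ → Bool} {l h : ℕ → ℕ}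
    (hc : IsCellComponent m c (blocked l h) H) {i : ℕ} (hi : i < m) (hh : h i < m) :
    2 * ∑ j ∈ Finset.range m, (freeEnd c (blocked l h) H i j).toInt
      ≤ ∑ j ∈ Finset.range m, (twoSided c (blocked l h) H i j j).toInt
        + ∑ j ∈ Finset.range m, (twoSided c (blocked l h) H i j (j + 1)).toInt
        + if i ∈ isolatedLines m l h H then 2 else 0 := by
  have n1 : 0 ≤ ∑ j ∈ Finset.range m, (twoSided c (blocked l h) H i j j).toInt :=
    Finset.sum_nonneg fun _ _ => toInt_nonneg _
  have n2 : 0 ≤ ∑ j ∈ Finset.range m, (twoSided c (blocked l h) H i j (j + 1)).toInt :=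
    Finset.sum_nonneg fun _ _ => toInt_nonneg _
  have n3 : (0 : ℤ) ≤ if i ∈ isolatedLines m l h H then 2 else 0 := by split_ifs <;> norm_num
  have hends : ∀ j, freeEnd c (blocked l h) H i j = true → l i < h i ∧ (j = l i ∨ j = h i) := by
    intro j hj
    simp only [freeEnd, blocked, Bool.and_eq_true, bne_iff_ne, ne_eq, decide_eq_decide] at hj
    have := hj.1.2
    omega
  by_cases hlt : l i < h i
  swap
  · have : ∑ j ∈ Finset.range m, (freeEnd c (blocked l h) H i j).toInt = 0 := by
      refine Finset.sum_eq_zero fun j _ => ?_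
      cases hf : freeEnd c (blocked l h) H i j
      · rfl
      · exact absurd (hends j hf).1 hlt
    omega
  have hsum : ∑ j ∈ Finset.range m, (freeEnd c (blocked l h) H i j).toInt
      ≤ (freeEnd c (blocked l h) H i (l i)).toInt + (freeEnd c (blocked l h) H i (h i)).toInt := by
    rw [← Finset.sum_pair (f := fun j => (freeEnd c (blocked l h) H i j).toInt) hlt.ne]
    rw [← Finset.sum_subset (s₁ := {l i, h i}) (s₂ := Finset.range m)]
    · intro x hx
      simp only [Finset.mem_insert, Finset.mem_singleton] at hx
      rw [Finset.mem_range]; omega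
    · intro x _ hx
      cases hf : freeEnd c (blocked l h) H i x
      · rfl
      · simp only [Finset.mem_insert, Finset.mem_singleton] at hx
        exact absurd (hends x hf).2 hx
  have hvl : isVertex (blocked l h) H i (l i) = true := by simp [isVertex, blocked]
  have hvh : isVertex (blocked l h) H i (h i) = true := by simp [isVertex, blocked]
  obtain ⟨p, hp1, hp2, hp3, hp4⟩ := exists_last_of_lt
    (P := fun j => isVertex (blocked l h) H i j = true) hlt hvl
  obtain ⟨q, hq1, hq2, hq3, hq4⟩ := exists_first_of_lt
    (P := fun j => isVertex (blocked l h) H i j = true) hlt hvh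
  have bt : ∀ j, l i < j → j ≤ h i → blocked l h i j = true := fun j h1 h2 =>
    blocked_eq_true.2 ⟨h1, h2⟩
  have ml : l i ∈ Finset.range m := Finset.mem_range.2 (by omega)
  have mh : h i ∈ Finset.range m := Finset.mem_range.2 (by omega)
  have mp : p ∈ Finset.range m := Finset.mem_range.2 (by omega)
  have mq : q ∈ Finset.range m := Finset.mem_range.2 (by omega)
  have htop : freeEnd c (blocked l h) H i (h i) = true →
      twoSided c (blocked l h) H i (h i) (h i) = true ∧
      twoSided c (blocked l h) H i p (p + 1) = true ∧
      H (h i) i = false ∧ H (h i) (i + 1) = false := by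
    intro hf
    obtain ⟨-, c1, c2, -, -, k1, k2⟩ := freeEnd_cells hc hi hh hf
    have := const_along_edge (a := p) hc hi hh
      (fun j h1 h2 => by simpa using hp4 j h1 h2) (p + 1) (h i) (by omega) hp2 le_rfl
    simp only [twoSided, hvh, hp3, bt (h i) hlt le_rfl, bt (p + 1) (by omega) hp2, ← this.1,
      ← this.2, c1, c2, k1, k2]
    decide
  have hbot : freeEnd c (blocked l h) H i (l i) = true →
      twoSided c (blocked l h) H i (l i) (l i + 1) = true ∧
      twoSided c (blocked l h) H i q q = true ∧
      H (l i) i = false ∧ H (l i) (i + 1) = false := by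
    intro hf
    obtain ⟨-, -, -, c1, c2, k1, k2⟩ := freeEnd_cells hc hi (by omega) hf
    have := const_along_edge (a := l i) (b := q) hc hi (by omega)
      (fun j h1 h2 => by simpa using hq4 j h1 h2) (l i + 1) q (by omega) hq1 le_rfl
    simp only [twoSided, hvl, hq3, bt (l i + 1) (by omega) hlt, bt q hq1 hq2, this.1,
      this.2, c1, c2, k1, k2]
    decide
  cases hl : freeEnd c (blocked l h) H i (l i) <;> cases ht : freeEnd c (blocked l h) H i (h i) <;>
    simp only [hl, ht, Bool.toInt_true, Bool.toInt_false] at hsum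
  · omega
  · obtain ⟨t1, t2, -, -⟩ := htop ht
    have := one_le_sum_toInt (f := fun j => twoSided c (blocked l h) H i j j) mh t1
    have := one_le_sum_toInt (f := fun j => twoSided c (blocked l h) H i j (j + 1)) mp t2
    omega
  · obtain ⟨t1, t2, -, -⟩ := hbot hl
    have := one_le_sum_toInt (f := fun j => twoSided c (blocked l h) H i j j) mq t2
    have := one_le_sum_toInt (f := fun j => twoSided c (blocked l h) H i j (j + 1)) ml t1
    omega
  · obtain ⟨t1, t2, e1, e2⟩ := htop ht
    obtain ⟨t3, t4, e3, e4⟩ := hbot hl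
    by_cases hpl : p = l i
    · have hiso : i ∈ isolatedLines m l h H := by
        simp only [isolatedLines, usedLines, Finset.mem_filter, Finset.mem_range, Finset.mem_Icc]
        refine ⟨⟨hi, hlt⟩, fun j hj => ?_⟩
        rcases hj.1.eq_or_lt with rfl | h1
        · exact ⟨e3, e4⟩
        rcases hj.2.eq_or_lt with rfl | h2
        · exact ⟨e1, e2⟩
        have := isVertex_eq_false.1 (by simpa using hp4 j (by omega) h2)
        exact ⟨this.1, this.2.1⟩
      have := one_le_sum_toInt (f := fun j => twoSided c (blocked l h) H i j j) mh t1
      have := one_le_sum_toInt (f := fun j => twoSided c (blocked l h) H i j (j + 1)) mp t2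
      rw [if_pos hiso]
      omega
    · have hqp : q ≤ p := by
        by_contra hlt'
        exact hq4 p (by omega) (by omega) hp3
      have := two_le_sum_toInt (f := fun j => twoSided c (blocked l h) H i j j) mh mq
        (by omega) t1 t4
      have := two_le_sum_toInt (f := fun j => twoSided c (blocked l h) H i j (j + 1)) mp ml
        hpl t2 t3
      omega

lemma sum_xor_blocked_le (m : ℕ) (l h : ℕ → ℕ) (j : ℕ) :
    ∑ i ∈ Finset.range m, (blocked l h j i ^^ blocked l h j (i + 1)).toInt
      ≤ if l j < h j then 2 else 0 := by
  have hle : ∀ i ∈ Finset.range m, (blocked l h j i ^^ blocked l h j (i + 1)).toInt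
      ≤ (if i = l j then (if l j < h j then 1 else 0) else 0)
        + (if i = h j then (if l j < h j then 1 else 0) else 0) := by
    intro i _
    cases hx : (blocked l h j i ^^ blocked l h j (i + 1))
    · simp only [Bool.toInt_false]; split_ifs <;> norm_num
    · simp only [blocked, bne_iff_ne, ne_eq, decide_eq_decide] at hx
      have h1 : l j < h j := by omega
      have h2 : i = l j ∨ i = h j := by omega
      rcases h2 with rfl | rfl <;> simp only [h1, if_true, Bool.toInt_true] <;> split_ifs <;>
        norm_num
  refine (Finset.sum_le_sum hle).trans ?_
  rw [Finset.sum_add_distrib, Finset.sum_ite_eq', Finset.sum_ite_eq']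
  split_ifs <;> norm_num

/-- A component has few separating edges in one direction. -/
lemma card_separatingEdges_le {m : ℕ} {c : ℕ → ℕ → Bool} {l h l' h' : ℕ → ℕ}
    (hc : IsCellComponent m c (blocked l h) (blocked l' h')) (hm : ∀ i < m, h i < m)
    (R : Finset (ℕ × ℕ × ℕ))
    (hR : ∀ r ∈ R, IsSeparatingEdge m c (blocked l h) (blocked l' h') r.1 r.2.1 r.2.2) :
    R.card ≤ 2 + 2 * (usedLines m l' h').card
      + 2 * (isolatedLines m l h (blocked l' h')).card := by
  set V := blocked l h with hV
  set H := blocked l' h' with hH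
  have hA : (R.card : ℤ) ≤ ∑ i ∈ Finset.range m, ∑ j ∈ Finset.range m,
      (oneSided c V H i j j).toInt := by
    rw [sum_toInt_eq_card _ _ (fun i j => oneSided c V H i j j)]
    norm_cast
    refine Finset.card_le_card_of_injOn (fun r => (r.1, r.2.2)) (fun r hr => ?_) ?_
    · have := hR r hr
      have hn := this.ne r.2.2 this.lt le_rfl
      simp only [Finset.coe_filter, Finset.mem_product, Finset.mem_range, Set.mem_ofPred_eq]
      refine ⟨⟨this.line_lt, this.top_lt⟩, ?_⟩
      simp [oneSided, this.top, this.wall _ this.lt le_rfl, hn]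
    · rintro ⟨i, a, b⟩ hr ⟨i', a', b'⟩ hr' he
      simp only [Prod.mk.injEq] at he
      obtain ⟨rfl, rfl⟩ := he
      have h1 := hR _ hr
      have h2 := hR _ hr'
      have e : a = a' := by
        rcases lt_trichotomy a a' with h | h | h
        · have := h1.between a' h h2.lt
          simp [h2.bot] at this
        · exact h
        · have := h2.between a h h1.lt
          simp [h1.bot] at this
      rw [e]
  have hB : (R.card : ℤ) ≤ ∑ i ∈ Finset.range m, ∑ j ∈ Finset.range m,
      (oneSided c V H i j (j + 1)).toInt := by
    rw [sum_toInt_eq_card _ _ (fun i j => oneSided c V H i j (j + 1))]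
    norm_cast
    refine Finset.card_le_card_of_injOn (fun r => (r.1, r.2.1)) (fun r hr => ?_) ?_
    · have := hR r hr
      have hn := this.ne (r.2.1 + 1) (by omega) this.lt
      simp only [Finset.coe_filter, Finset.mem_product, Finset.mem_range, Set.mem_ofPred_eq]
      refine ⟨⟨this.line_lt, this.lt.trans this.top_lt⟩, ?_⟩
      simp [oneSided, this.bot, this.wall _ (Nat.lt_succ_self _) this.lt, hn]
    · rintro ⟨i, a, b⟩ hr ⟨i', a', b'⟩ hr' he
      simp only [Prod.mk.injEq] at he
      obtain ⟨rfl, rfl⟩ := he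
      have h1 := hR _ hr
      have h2 := hR _ hr'
      have e : b = b' := by
        rcases lt_trichotomy b b' with h | h | h
        · have := h2.between b h1.lt h
          simp [h1.top] at this
        · exact h
        · have := h1.between b' h2.lt h
          simp [h2.top] at this
      rw [e]
  have hloc := Finset.sum_le_sum fun i hi => Finset.sum_le_sum fun j hj =>
    local_bound hc (Finset.mem_range.1 hi) (Finset.mem_range.1 hj)
  have hfree := Finset.sum_le_sum fun i hi =>
    freeEnd_bound hc (Finset.mem_range.1 hi) (hm i (Finset.mem_range.1 hi))
  have hw := sum_eulerWeight_le hc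
  have hends : ∑ i ∈ Finset.range m, ∑ j ∈ Finset.range m, (H j i ^^ H j (i + 1)).toInt
      ≤ 2 * (usedLines m l' h').card := by
    rw [Finset.sum_comm]
    refine (Finset.sum_le_sum fun j _ => sum_xor_blocked_le m l' h' j).trans ?_
    rw [← Finset.sum_filter, Finset.sum_const, usedLines, nsmul_eq_mul, mul_comm]
  have hiso : ∑ i ∈ Finset.range m, (if i ∈ isolatedLines m l h H then (2 : ℤ) else 0)
      ≤ 2 * (isolatedLines m l h H).card := by
    rw [← Finset.sum_filter, Finset.sum_const, nsmul_eq_mul, mul_comm]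
    have := Finset.card_le_card (s := (Finset.range m).filter (· ∈ isolatedLines m l h H))
      (t := isolatedLines m l h H) (fun x hx => (Finset.mem_filter.1 hx).2)
    zify at this
    linarith
  simp only [Finset.sum_add_distrib, ← Finset.mul_sum] at hloc hfree
  zify
  linarith
lemma IsSeparatingEdge.crossing_of_isVertex {m : ℕ} {c V H : ℕ → ℕ → Bool}
    (hc : IsCellComponent m c V H) {i j k : ℕ} (hi : i < m) (hj : j < m)
    (hk : k = j ∨ k = j + 1) (hV : V i k = true) (hne : c i k ≠ c (i + 1) k)
    (hv : isVertex V H i j = true) : H j i = true ∨ H j (i + 1) = true := by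
  by_contra! hH
  simp only [ne_eq, Bool.not_eq_true] at hH
  have h1 := hc.right i hi j hj.le
  have h2 := hc.right i hi (j + 1) hj
  have h3 := hc.up j hj i hi.le hH.1
  have h4 := hc.up j hj (i + 1) hi hH.2
  rcases hk with rfl | rfl
  · cases hv2 : V i (k + 1) <;> simp_all [isVertex]
  · cases hv2 : V i j <;> simp_all [isVertex]

/-- A separating edge meets two segments of the other direction. -/
lemma IsSeparatingEdge.card_isolatedLines {m : ℕ} {c : ℕ → ℕ → Bool} {l h l' h' : ℕ → ℕ}
    (hc : IsCellComponent m c (blocked l h) (blocked l' h')) {i j₁ j₂ : ℕ}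
    (he : IsSeparatingEdge m c (blocked l h) (blocked l' h') i j₁ j₂) :
    (isolatedLines m l h (blocked l' h')).card + 1 ≤ (usedLines m l h).card ∧
      (isolatedLines m l' h' (blocked l h)).card + 2 ≤ (usedLines m l' h').card := by
  have hj₁ : j₁ < m := he.lt.trans he.top_lt
  have w1 := he.wall (j₁ + 1) (by omega) he.lt
  have w2 := he.wall j₂ he.lt le_rfl
  have c1 := IsSeparatingEdge.crossing_of_isVertex hc he.line_lt hj₁ (Or.inr rfl) w1
    (he.ne _ (by omega) he.lt) he.bot
  have c2 := IsSeparatingEdge.crossing_of_isVertex hc he.line_lt he.top_lt (Or.inl rfl) w2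
    (he.ne _ he.lt le_rfl) he.top
  have hlt := he.lt
  have hm := he.line_lt
  have hm2 := he.top_lt
  rw [blocked_eq_true] at w1 w2
  constructor
  · have hi : i ∈ usedLines m l h := by
      simp only [usedLines, Finset.mem_filter, Finset.mem_range]; omega
    have hi' : i ∉ isolatedLines m l h (blocked l' h') := by
      intro hi'
      have := (Finset.mem_filter.1 hi').2 j₂ (Finset.mem_Icc.2 ⟨by omega, by omega⟩)
      simp [this] at c2
    rw [← Finset.card_insert_of_notMem hi']
    refine Finset.card_le_card (Finset.insert_subset hi (Finset.filter_subset _ _))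
  · rw [blocked_eq_true, blocked_eq_true] at c1 c2
    have hu : ∀ j, (j = j₁ ∨ j = j₂) → j ∈ usedLines m l' h' ∧
        j ∉ isolatedLines m l' h' (blocked l h) := by
      intro j hj
      refine ⟨?_, fun hiso => ?_⟩
      · simp only [usedLines, Finset.mem_filter, Finset.mem_range]
        rcases hj with rfl | rfl <;> omega
      · have := (Finset.mem_filter.1 hiso).2 i
          (Finset.mem_Icc.2 (by rcases hj with rfl | rfl <;> omega))
        rcases hj with rfl | rfl
        · exact absurd (blocked_eq_true.2 w1) (by simp [this.2])
        · exact absurd (blocked_eq_true.2 w2) (by simp [this.1])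
    have h2 := hu j₂ (Or.inr rfl)
    have h1 := hu j₁ (Or.inl rfl)
    have hnot : j₁ ∉ insert j₂ (isolatedLines m l' h' (blocked l h)) := by
      rw [Finset.mem_insert, not_or]
      exact ⟨hlt.ne, h1.2⟩
    rw [show (isolatedLines m l' h' (blocked l h)).card + 2 =
        (insert j₁ (insert j₂ (isolatedLines m l' h' (blocked l h)))).card by
      rw [Finset.card_insert_of_notMem hnot, Finset.card_insert_of_notMem h2.2]]
    exact Finset.card_le_card (Finset.insert_subset h1.1
      (Finset.insert_subset h2.1 (Finset.filter_subset _ _)))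

/-- A component of a grid has at most `4 n - 4` separating edges, where `n` is the number of
segments. -/
lemma card_separatingEdges_add_le {m : ℕ} {c c' : ℕ → ℕ → Bool} {l h l' h' : ℕ → ℕ}
    (hc : IsCellComponent m c (blocked l h) (blocked l' h'))
    (hc' : IsCellComponent m c' (blocked l' h') (blocked l h))
    (hm : ∀ i < m, h i < m) (hm' : ∀ i < m, h' i < m) (R R' : Finset (ℕ × ℕ × ℕ))
    (hR : ∀ r ∈ R, IsSeparatingEdge m c (blocked l h) (blocked l' h') r.1 r.2.1 r.2.2)
    (hR' : ∀ r ∈ R', IsSeparatingEdge m c' (blocked l' h') (blocked l h) r.1 r.2.1 r.2.2) :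
    R.card + R'.card ≤ 4 * ((usedLines m l h).card + (usedLines m l' h').card) - 4 := by
  have b := card_separatingEdges_le hc hm R hR
  have b' := card_separatingEdges_le hc' hm' R' hR'
  rcases R.eq_empty_or_nonempty with rfl | ⟨r, hr⟩ <;>
    rcases R'.eq_empty_or_nonempty with rfl | ⟨r', hr'⟩
  · simp
  · have := (hR' r' hr').card_isolatedLines hc'
    simp only [Finset.card_empty]
    omega
  · have := (hR r hr).card_isolatedLines hc
    simp only [Finset.card_empty]
    omega
  · have := (hR r hr).card_isolatedLines hc
    have := (hR' r' hr').card_isolatedLines hc'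
    omega

/-- The points `x 0 < g 0 < x 1 < g 1 < ⋯ < g (m - 1) < x m`: grid coordinates `g i` and
sample coordinates `x i` in the gaps between them. -/
def IsSampledGrid (m : ℕ) (g x : ℕ → ℝ) : Prop := ∀ i < m, x i < g i ∧ g i < x (i + 1)

namespace IsSampledGrid

variable {m : ℕ} {g x : ℕ → ℝ}

lemma x_lt_g (hg : IsSampledGrid m g x) {i j : ℕ} (hij : i ≤ j) (hj : j < m) : x i < g j := by
  induction j, hij using Nat.le_induction with
  | base => exact (hg i hj).1
  | succ j hij ih => exact (ih (by omega)).trans ((hg j (by omega)).2.trans (hg _ hj).1)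

lemma g_lt_g (hg : IsSampledGrid m g x) {i j : ℕ} (hij : i < j) (hj : j < m) : g i < g j :=
  (hg i (by omega)).2.trans (hg.x_lt_g hij hj)

lemma g_lt_x (hg : IsSampledGrid m g x) {i j : ℕ} (hij : i < j) (hj : j ≤ m) : g i < x j := by
  rcases Nat.lt_or_ge j m with h | h
  · induction j, hij using Nat.le_induction with
    | base => exact (hg i (by omega)).2
    | succ j hij ih =>
      exact (ih (by omega) (by omega)).trans ((hg j (by omega)).1.trans (hg j (by omega)).2)
  · obtain rfl : j = m := by omega
    obtain ⟨k, rfl⟩ : ∃ k, j = k + 1 := ⟨j - 1, by omega⟩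
    rcases (Nat.lt_succ_iff_lt_or_eq.1 hij) with h' | rfl
    · exact (hg.g_lt_g h' (by omega)).trans (hg k (by omega)).2
    · exact (hg i (by omega)).2

lemma g_le_g (hg : IsSampledGrid m g x) {i j : ℕ} (hij : i ≤ j) (hj : j < m) : g i ≤ g j := by
  rcases hij.eq_or_lt with rfl | h
  · exact le_rfl
  · exact (hg.g_lt_g h hj).le

lemma lt_of_g_lt_g (hg : IsSampledGrid m g x) {i j : ℕ} (hi : i < m) (h : g i < g j) :
    i < j := by
  by_contra! h'
  exact absurd (hg.g_le_g h' hi) (not_le.2 h)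

lemma le_of_g_le_g (hg : IsSampledGrid m g x) {i j : ℕ} (hi : i < m) (h : g i ≤ g j) :
    i ≤ j := by
  by_contra! h'
  exact absurd (hg.g_lt_g h' hi) (not_lt.2 h)

lemma g_inj (hg : IsSampledGrid m g x) {i j : ℕ} (hi : i < m) (hj : j < m) (h : g i = g j) :
    i = j :=
  le_antisymm (hg.le_of_g_le_g hi h.le) (hg.le_of_g_le_g hj h.ge)

lemma g_ne_x (hg : IsSampledGrid m g x) {i j : ℕ} (hi : i < m) (hj : j ≤ m) : g i ≠ x j := by
  rcases Nat.lt_or_ge i j with h | h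
  · exact (hg.g_lt_x h hj).ne
  · exact (hg.x_lt_g h hi).ne'

end IsSampledGrid

/-- Every finite set of reals is contained in a sampled grid. -/
lemma exists_isSampledGrid (G : Finset ℝ) :
    ∃ (m : ℕ) (g x : ℕ → ℝ), IsSampledGrid m g x ∧ ∀ y ∈ G, ∃ i < m, g i = y := by
  suffices ∀ b : ℝ, (∀ y ∈ G, y < b) → ∃ (m : ℕ) (g x : ℕ → ℝ), IsSampledGrid m g x ∧
      (∀ y ∈ G, ∃ i < m, g i = y) ∧ x m < b by
    obtain ⟨b, hb⟩ := G.bddAbove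
    obtain ⟨m, g, x, h1, h2, -⟩ := this (b + 1) fun y hy => by linarith [hb hy]
    exact ⟨m, g, x, h1, h2⟩
  induction G using Finset.induction_on_max with
  | empty => exact fun b _ => ⟨0, fun _ => 0, fun _ => b - 1, fun i hi => by omega, by simp, by simp⟩
  | insert a s hs ih =>
    intro b hb
    obtain ⟨m, g, x, h1, h2, h3⟩ := ih a hs
    have hab : a < b := hb a (Finset.mem_insert_self _ _)
    refine ⟨m + 1, Function.update g m a, Function.update x (m + 1) ((a + b) / 2), ?_, ?_, ?_⟩
    · intro i hi
      rcases Nat.lt_succ_iff_lt_or_eq.1 hi with h | rfl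
      · rw [Function.update_of_ne h.ne, Function.update_of_ne (by omega),
          Function.update_of_ne (by omega)]
        exact h1 i h
      · rw [Function.update_self, Function.update_self, Function.update_of_ne (by omega)]
        exact ⟨h3, by linarith⟩
    · intro y hy
      rcases Finset.mem_insert.1 hy with rfl | hy
      · exact ⟨m, by omega, Function.update_self _ _ _⟩
      · obtain ⟨i, hi, rfl⟩ := h2 y hy
        exact ⟨i, by omega, Function.update_of_ne hi.ne _ _⟩
    · rw [Function.update_self]; linarith

open Classical in
/-- The index of the gap of the grid containing `y`, where gaps are closed above. -/
noncomputable def gapIndex (m : ℕ) (g : ℕ → ℝ) (y : ℝ) : ℕ :=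
  Nat.find (p := fun k => k = m ∨ y ≤ g k) ⟨m, Or.inl rfl⟩

section gapIndex

variable {m : ℕ} {g x : ℕ → ℝ}

lemma gapIndex_le (y : ℝ) : gapIndex m g y ≤ m := by
  classical
  exact Nat.find_min' _ (Or.inl rfl)

lemma g_lt_of_lt_gapIndex {y : ℝ} {i : ℕ} (h : i < gapIndex m g y) : g i < y := by
  classical
  have := Nat.find_min _ h
  push Not at this
  exact this.2

lemma le_g_gapIndex {y : ℝ} (h : gapIndex m g y < m) : y ≤ g (gapIndex m g y) := by
  classical
  have : gapIndex m g y = m ∨ y ≤ g (gapIndex m g y) :=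
    Nat.find_spec (p := fun k => k = m ∨ y ≤ g k) ⟨m, Or.inl rfl⟩
  exact this.resolve_left h.ne

lemma gapIndex_eq {y : ℝ} {k : ℕ} (hk : k ≤ m) (h1 : ∀ i < k, g i < y) (h2 : k = m ∨ y ≤ g k) :
    gapIndex m g y = k := by
  classical
  refine (Nat.find_eq_iff _).2 ⟨h2, fun i hi => ?_⟩
  push Not
  exact ⟨by omega, h1 i hi⟩

lemma le_g_of_gapIndex_le (hg : IsSampledGrid m g x) {y : ℝ} {i : ℕ}
    (h : gapIndex m g y ≤ i) (hi : i < m) : y ≤ g i :=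
  (le_g_gapIndex (h.trans_lt hi)).trans (hg.g_le_g h hi)

lemma gapIndex_g (hg : IsSampledGrid m g x) {i : ℕ} (hi : i < m) : gapIndex m g (g i) = i :=
  gapIndex_eq hi.le (fun _ h => hg.g_lt_g h hi) (Or.inr le_rfl)

lemma gapIndex_x (hg : IsSampledGrid m g x) {i : ℕ} (hi : i ≤ m) : gapIndex m g (x i) = i :=
  gapIndex_eq hi (fun _ h => hg.g_lt_x h hi)
    (hi.eq_or_lt.imp_right fun h => (hg.x_lt_g le_rfl h).le)

lemma eventually_gapIndex (hg : IsSampledGrid m g x) (y : ℝ) :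
    ∀ᶠ y' in nhds y, gapIndex m g y' = gapIndex m g y ∨
      (gapIndex m g y < m ∧ y = g (gapIndex m g y) ∧ gapIndex m g y' = gapIndex m g y + 1) := by
  have h : ∀ᶠ y' in nhds y, ∀ k ∈ Finset.range m, (g k < y → g k < y') ∧ (y < g k → y' < g k) := by
    rw [Filter.eventually_all_finset]
    intro k _
    refine Filter.Eventually.and ?_ ?_
    · by_cases h : g k < y
      · filter_upwards [lt_mem_nhds h] with y' hy' _ using hy'
      · exact Filter.Eventually.of_forall fun _ h' => absurd h' h
    · by_cases h : y < g k
      · filter_upwards [gt_mem_nhds h] with y' hy' _ using hy'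
      · exact Filter.Eventually.of_forall fun _ h' => absurd h' h
  filter_upwards [h] with y' hy'
  simp only [Finset.mem_range] at hy'
  have hk := gapIndex_le (m := m) (g := g) y
  have hlow : ∀ i < gapIndex m g y, g i < y' := fun i hi =>
    (hy' i (by omega)).1 (g_lt_of_lt_gapIndex hi)
  rcases hk.eq_or_lt with hk | hk
  · exact Or.inl (gapIndex_eq hk.le hlow (Or.inl hk))
  rcases le_or_gt y' (g (gapIndex m g y)) with hle | hgt
  · exact Or.inl (gapIndex_eq hk.le hlow (Or.inr hle))
  rcases (le_g_gapIndex hk).lt_or_eq with hlt | heq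
  · exact absurd ((hy' _ hk).2 hlt) (not_lt.2 hgt.le)
  refine Or.inr ⟨hk, heq, gapIndex_eq hk (fun i hi => ?_) ?_⟩
  · rcases Nat.lt_succ_iff_lt_or_eq.1 hi with h | rfl
    · exact hlow i h
    · exact hgt
  · rcases (Nat.succ_le_of_lt hk).eq_or_lt with h | h
    · exact Or.inl h
    · refine Or.inr ((hy' _ h).2 ?_).le
      nth_rw 1 [heq]
      exact hg.g_lt_g (Nat.lt_succ_self _) h

end gapIndex

/-- `p` lies on a vertical segment of the grid: the `i`-th line carries the segment from the
`l i`-th to the `h i`-th grid value, if `l i < h i`. -/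
def lineSeg (m : ℕ) (g : ℕ → ℝ) (l h : ℕ → ℕ) (p : Pt) : Prop :=
  ∃ i < m, l i < h i ∧ p.1 = g i ∧ g (l i) ≤ p.2 ∧ p.2 ≤ g (h i)

/-- `p` is an end of a vertical segment of the grid. -/
def lineEnd (m : ℕ) (g : ℕ → ℝ) (l h : ℕ → ℕ) (p : Pt) : Prop :=
  ∃ i < m, l i < h i ∧ p.1 = g i ∧ (p.2 = g (l i) ∨ p.2 = g (h i))

/-- The union of the vertical segments given by `l`, `h` and the horizontal ones given by
`l'`, `h'`. -/
def gridUnion (m : ℕ) (g : ℕ → ℝ) (l h l' h' : ℕ → ℕ) : Set Pt :=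
  {p | lineSeg m g l h p ∨ lineSeg m g l' h' p.swap}

/-- The ends of the grid segments and the crossings of vertical and horizontal ones. -/
def gridVertices (m : ℕ) (g : ℕ → ℝ) (l h l' h' : ℕ → ℕ) : Set Pt :=
  {p | lineEnd m g l h p ∨ lineEnd m g l' h' p.swap ∨ (lineSeg m g l h p ∧ lineSeg m g l' h' p.swap)}

/-- `C` is a connected component of the complement of `U`, or empty. -/
structure IsComplComponent (U C : Set Pt) : Prop where
  isPreconnected : IsPreconnected C
  notMem : ∀ p ∈ C, p ∉ U
  absorb : ∀ T : Set Pt, IsPreconnected T → (∀ p ∈ T, p ∉ U) → (∃ p ∈ T, p ∈ C) → T ⊆ C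

lemma IsComplComponent.mem_iff {U C T : Set Pt} (hC : IsComplComponent U C)
    (hT : IsPreconnected T) (hU : ∀ p ∈ T, p ∉ U) {p q : Pt} (hp : p ∈ T) (hq : q ∈ T) :
    p ∈ C ↔ q ∈ C :=
  ⟨fun h => hC.absorb T hT hU ⟨p, hp, h⟩ hq, fun h => hC.absorb T hT hU ⟨q, hq, h⟩ hp⟩

lemma IsComplComponent.swap {U C : Set Pt} (hC : IsComplComponent U C) :
    IsComplComponent (Prod.swap ⁻¹' U) (Prod.swap ⁻¹' C) where
  isPreconnected := (Homeomorph.isPreconnected_preimage (Homeomorph.prodComm ℝ ℝ)).2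
    hC.isPreconnected
  notMem p hp := hC.notMem _ hp
  absorb T hT hU := by
    rintro ⟨p, hp, hpC⟩ q hq
    exact hC.absorb (Prod.swap ⁻¹' T)
      ((Homeomorph.isPreconnected_preimage (Homeomorph.prodComm ℝ ℝ)).2 hT)
      (fun r hr hrU => hU _ hr (by simpa using hrU)) ⟨p.swap, by simpa using hp, hpC⟩
      (by simpa using hq)

lemma preimage_swap_gridUnion (m : ℕ) (g : ℕ → ℝ) (l h l' h' : ℕ → ℕ) :
    Prod.swap ⁻¹' gridUnion m g l h l' h' = gridUnion m g l' h' l h := by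
  ext p
  simp [gridUnion, or_comm]

lemma preimage_swap_gridVertices (m : ℕ) (g : ℕ → ℝ) (l h l' h' : ℕ → ℕ) :
    Prod.swap ⁻¹' gridVertices m g l h l' h' = gridVertices m g l' h' l h := by
  ext p
  simp only [gridVertices, mem_preimage, mem_ofPred_eq, Prod.swap_swap]
  tauto

open Classical in
/-- Whether the sample point of a cell lies in `C`. -/
noncomputable def cellLabel (x : ℕ → ℝ) (C : Set Pt) (i j : ℕ) : Bool := decide ((x i, x j) ∈ C)

lemma cellLabel_eq_iff {x : ℕ → ℝ} {C : Set Pt} {i j i' j' : ℕ} :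
    cellLabel x C i j = cellLabel x C i' j' ↔ ((x i, x j) ∈ C ↔ (x i', x j') ∈ C) := by
  simp [cellLabel]

section grid

variable {m : ℕ} {g x : ℕ → ℝ} {l h l' h' : ℕ → ℕ}

lemma lineSeg_of_lineEnd (hg : IsSampledGrid m g x) (hm : ∀ i < m, h i < m) {p : Pt}
    (hp : lineEnd m g l h p) : lineSeg m g l h p := by
  obtain ⟨i, hi, hlt, h1, h2⟩ := hp
  have := hg.g_lt_g hlt (hm i hi)
  refine ⟨i, hi, hlt, h1, ?_⟩
  rcases h2 with h2 | h2 <;> rw [h2]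
  exacts [⟨le_rfl, this.le⟩, ⟨this.le, le_rfl⟩]

lemma not_lineSeg {p : Pt} (hp : ∀ k < m, p.1 ≠ g k) : ¬ lineSeg m g l h p := by
  rintro ⟨i, hi, -, h1, -⟩
  exact hp i hi h1

lemma notMem_gridUnion {p : Pt} (h1 : ∀ k < m, p.1 ≠ g k) (h2 : ∀ k < m, p.2 ≠ g k) :
    p ∉ gridUnion m g l h l' h' := by
  rintro (hp | hp)
  exacts [not_lineSeg h1 hp, not_lineSeg h2 hp]

lemma exists_blocked_of_lineSeg (hg : IsSampledGrid m g x) (hm : ∀ i < m, h i < m) {p : Pt}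
    (h2 : ∀ k < m, p.2 ≠ g k) (hp : lineSeg m g l h p) :
    ∃ i < m, p.1 = g i ∧ blocked l h i (gapIndex m g p.2) = true := by
  obtain ⟨i, hi, hlt, h1, hl, hh⟩ := hp
  have hhi := hm i hi
  refine ⟨i, hi, h1, blocked_eq_true.2 ⟨?_, ?_⟩⟩
  · by_contra! hle
    have := le_g_of_gapIndex_le hg hle (by omega)
    exact h2 (l i) (by omega) (le_antisymm this hl)
  · by_contra! hgt
    exact absurd (g_lt_of_lt_gapIndex hgt) (not_lt.2 hh)

lemma lineSeg_of_blocked (hg : IsSampledGrid m g x) (hm : ∀ i < m, h i < m) {p : Pt} {i : ℕ}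
    (hi : i < m) (h1 : p.1 = g i) (hb : blocked l h i (gapIndex m g p.2) = true) :
    lineSeg m g l h p := by
  obtain ⟨b1, b2⟩ := blocked_eq_true.1 hb
  exact ⟨i, hi, b1.trans_le b2, h1, (g_lt_of_lt_gapIndex b1).le,
    le_g_of_gapIndex_le hg b2 (hm i hi)⟩

lemma lineSeg_of_blocked_succ (hg : IsSampledGrid m g x) (hm : ∀ i < m, h i < m) {p : Pt}
    {i j : ℕ} (hi : i < m) (h1 : p.1 = g i) (h2 : p.2 = g j)
    (hb : blocked l h i (j + 1) = true) : lineSeg m g l h p := by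
  obtain ⟨b1, b2⟩ := blocked_eq_true.1 hb
  have := hm i hi
  refine ⟨i, hi, b1.trans_le b2, h1, ?_, ?_⟩ <;> rw [h2]
  exacts [hg.g_le_g (by omega) (by omega), hg.g_le_g (by omega) (by omega)]

lemma convex_comb_ne (hg : IsSampledGrid m g x) {y a b : ℝ} (ha : 0 ≤ a) (hb : 0 < b)
    (hab : a + b = 1) : ∀ k < m, a * y + b * x (gapIndex m g y) ≠ g k := by
  intro k hk
  obtain rfl : a = 1 - b := by linarith
  rcases Nat.lt_or_ge k (gapIndex m g y) with h | h
  · have h1 := g_lt_of_lt_gapIndex h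
    have h2 := hg.g_lt_x h (gapIndex_le y)
    nlinarith
  · have h1 := le_g_of_gapIndex_le hg h hk
    have h2 := hg.x_lt_g h hk
    nlinarith

lemma mem_iff_sample (hg : IsSampledGrid m g x) {C : Set Pt}
    (hC : IsComplComponent (gridUnion m g l h l' h') C) {p : Pt}
    (hp : p ∉ gridUnion m g l h l' h') :
    p ∈ C ↔ (x (gapIndex m g p.1), x (gapIndex m g p.2)) ∈ C := by
  refine hC.mem_iff (convex_segment p (x (gapIndex m g p.1), x (gapIndex m g p.2))).isPreconnected
    ?_ (left_mem_segment ℝ _ _) (right_mem_segment ℝ _ _)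
  rintro r ⟨a, b, ha, hb, hab, rfl⟩
  rcases hb.eq_or_lt with rfl | hb
  · obtain rfl : a = 1 := by linarith
    simpa using hp
  · refine notMem_gridUnion ?_ ?_
    · simpa using convex_comb_ne hg (y := p.1) ha hb hab
    · simpa using convex_comb_ne hg (y := p.2) ha hb hab

lemma sample_right (hg : IsSampledGrid m g x) (hm : ∀ i < m, h i < m) {C : Set Pt}
    (hC : IsComplComponent (gridUnion m g l h l' h') C) {i j : ℕ} (hi : i < m) (hj : j ≤ m)
    (hb : blocked l h i j = false) : (x (i + 1), x j) ∈ C ↔ (x i, x j) ∈ C := by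
  have hlt : x i ≤ x (i + 1) := ((hg i hi).1.trans (hg i hi).2).le
  refine hC.mem_iff (T := Icc (x i) (x (i + 1)) ×ˢ {x j})
    (isPreconnected_Icc.prod isPreconnected_singleton) ?_ (by simpa) (by simpa)
  rintro ⟨r1, r2⟩ ⟨⟨h1, h2⟩, h3⟩
  obtain rfl : r2 = x j := h3
  dsimp only at h1 h2
  have hne : ∀ k < m, x j ≠ g k := fun k hk => (hg.g_ne_x hk hj).symm
  rintro (hp | hp)
  · obtain ⟨k, hk, hk1, hk2⟩ := exists_blocked_of_lineSeg hg hm hne hp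
    dsimp only at hk1 hk2
    rw [gapIndex_x hg hj] at hk2
    obtain rfl : k = i := by
      by_contra hki
      rcases Nat.lt_or_gt_of_ne hki with hki | hki
      · linarith [hg.g_lt_x hki hi.le]
      · linarith [hg.x_lt_g hki hk]
    simp [hb] at hk2
  · exact not_lineSeg hne hp

lemma isCellComponent_cellLabel (hg : IsSampledGrid m g x) (hm : ∀ i < m, h i < m)
    (hm' : ∀ i < m, h' i < m) {C : Set Pt}
    (hC : IsComplComponent (gridUnion m g l h l' h') C) :
    IsCellComponent m (cellLabel x C) (blocked l h) (blocked l' h') where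
  right i hi j hj hb := cellLabel_eq_iff.2 (sample_right hg hm hC hi hj hb)
  up j hj i hi hb := by
    have hC' := hC.swap
    rw [preimage_swap_gridUnion] at hC'
    exact cellLabel_eq_iff.2 (sample_right hg hm' hC' hj hi hb)
  conn := by
    rintro ⟨i, j⟩ ⟨i', j'⟩ hi hj hi' hj' hc hc'
    have key : ∀ p ∈ C, ∀ q ∈ C, Relation.EqvGen (CellStep m (blocked l h) (blocked l' h'))
        (gapIndex m g p.1, gapIndex m g p.2) (gapIndex m g q.1, gapIndex m g q.2) := by
      intro p hp q hq
      refine hC.isPreconnected.induction₂ (fun p q : Pt =>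
        Relation.EqvGen (CellStep m (blocked l h) (blocked l' h'))
          (gapIndex m g p.1, gapIndex m g p.2) (gapIndex m g q.1, gapIndex m g q.2)) ?_
        (fun _ _ _ _ _ _ => Relation.EqvGen.trans _ _ _)
        (fun _ _ _ _ => Relation.EqvGen.symm _ _) hp hq
      intro p hp
      refine mem_nhdsWithin_of_mem_nhds ?_
      filter_upwards [continuous_fst.continuousAt.eventually (eventually_gapIndex hg p.1),
        continuous_snd.continuousAt.eventually (eventually_gapIndex hg p.2)] with q h1 h2
      have hpU := hC.notMem p hp
      have s1 : Relation.EqvGen (CellStep m (blocked l h) (blocked l' h'))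
          (gapIndex m g p.1, gapIndex m g p.2) (gapIndex m g q.1, gapIndex m g p.2) := by
        rcases h1 with h1 | ⟨hlt, h1, h1'⟩
        · rw [h1]; exact Relation.EqvGen.refl _
        · rw [h1']
          refine Relation.EqvGen.rel _ _ (Or.inl ⟨rfl, hlt, gapIndex_le _, ?_⟩)
          exact Bool.eq_false_iff.2 fun hb => hpU (Or.inl (lineSeg_of_blocked hg hm hlt h1 hb))
      refine s1.trans _ _ _ ?_
      rcases h2 with h2 | ⟨hlt, h2, h2'⟩
      · rw [h2]; exact Relation.EqvGen.refl _
      · rw [h2']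
        refine Relation.EqvGen.rel _ _ (Or.inr ⟨rfl, hlt, gapIndex_le _, ?_⟩)
        refine Bool.eq_false_iff.2 fun hb => hpU (Or.inr ?_)
        rcases h1 with h1 | ⟨-, h1, h1'⟩
        · exact lineSeg_of_blocked hg hm' hlt h2 (by simpa only [h1, Prod.snd_swap] using hb)
        · exact lineSeg_of_blocked_succ hg hm' hlt h2 h1 (by simpa only [h1'] using hb)
    simp only [cellLabel, decide_eq_true_eq] at hc hc'
    have := key _ hc _ hc'
    simp only at hi hj hi' hj'
    simpa only [gapIndex_x hg hi, gapIndex_x hg hj, gapIndex_x hg hi', gapIndex_x hg hj'] using this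

lemma dense_compl_gridUnion : Dense (gridUnion m g l h l' h')ᶜ := by
  have hd : Dense (univ \ (g '' Iio m)) := dense_univ.sdiff_finite ((finite_Iio m).image g)
  refine (hd.prod hd).mono ?_
  rintro p ⟨h1, h2⟩
  exact notMem_gridUnion (fun k hk e => h1.2 ⟨k, hk, e.symm⟩) (fun k hk e => h2.2 ⟨k, hk, e.symm⟩)

lemma notMem_frontier_closure {U C : Set Pt} (hU : Dense Uᶜ) (hC : ∀ p ∈ C, p ∉ U) {z : Pt}
    {P : Prop} (h : ∀ᶠ q in nhds z, q ∉ U → (q ∈ C ↔ P)) : z ∉ frontier (closure C) := by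
  by_cases hP : P
  · obtain ⟨O, hO, hOo, hz⟩ := eventually_nhds_iff.1 h
    intro hf
    refine hf.2 (mem_interior.2 ⟨O, ?_, hOo, hz⟩)
    refine (hU.open_subset_closure_inter hOo).trans (closure_mono ?_)
    exact fun q hq => (hO q hq.1 hq.2).2 hP
  · intro hf
    have hz : z ∈ closure C := by simpa using frontier_subset_closure hf
    rw [mem_closure_iff_frequently] at hz
    exact hz (h.mono fun q hq hqC => hP ((hq (hC q hqC)).1 hqC))

/-- A point in the relative interior of a vertical edge that lies on the boundary of the face
belongs to a separating edge. -/
lemma exists_isSeparatingEdge (hg : IsSampledGrid m g x) (hm : ∀ i < m, h i < m)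
    (hm' : ∀ i < m, h' i < m) {C : Set Pt}
    (hC : IsComplComponent (gridUnion m g l h l' h') C) {z : Pt} (hz : lineSeg m g l h z)
    (hv : z ∉ gridVertices m g l h l' h') (hf : z ∈ frontier (closure C)) :
    ∃ i j₁ j₂, IsSeparatingEdge m (cellLabel x C) (blocked l h) (blocked l' h') i j₁ j₂ ∧
      z.1 = g i ∧ g j₁ < z.2 ∧ z.2 < g j₂ := by
  have hc := isCellComponent_cellLabel hg hm hm' hC
  obtain ⟨i, hi, hlt, h1, hl, hh⟩ := id hz
  have hhi := hm i hi
  have hl' : g (l i) < z.2 := hl.lt_of_ne fun e =>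
    hv (Or.inl ⟨i, hi, hlt, h1, Or.inl e.symm⟩)
  have hh' : z.2 < g (h i) := hh.lt_of_ne fun e => hv (Or.inl ⟨i, hi, hlt, h1, Or.inr e⟩)
  have hns : ¬ lineSeg m g l' h' z.swap := fun e => hv (Or.inr (Or.inr ⟨hz, e⟩))
  obtain ⟨j₀, hj₀⟩ : ∃ j, gapIndex m g z.2 = j := ⟨_, rfl⟩
  have hlj : l i < j₀ := by
    by_contra! hle
    exact absurd (le_g_of_gapIndex_le hg (hj₀.trans_le hle) (by omega)) (not_le.2 hl')
  have hjh : j₀ ≤ h i := by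
    by_contra! hgt
    exact absurd (g_lt_of_lt_gapIndex (hgt.trans_eq hj₀.symm)) (not_lt.2 hh)
  have hgi : gapIndex m g z.1 = i := by rw [h1, gapIndex_g hg hi]
  have hzj : z.2 ≤ g j₀ := le_g_of_gapIndex_le hg hj₀.le (by omega)
  -- at a grid point no horizontal wall meets the edge
  have hopen : z.2 = g j₀ → isVertex (blocked l h) (blocked l' h') i j₀ = false := by
    intro he
    have hjlt : j₀ < h i := by
      refine hjh.lt_of_ne fun e => ?_
      rw [← e, ← he] at hh'
      exact lt_irrefl _ hh'
    refine isVertex_eq_false.2 ⟨?_, ?_, blocked_eq_true.2 ⟨hlj, hjh⟩,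
      blocked_eq_true.2 ⟨by omega, hjlt⟩⟩
    · refine Bool.eq_false_iff.2 fun hb => hns ?_
      exact lineSeg_of_blocked hg hm' (by omega) he (by simpa [hgi] using hb)
    · refine Bool.eq_false_iff.2 fun hb => hns ?_
      exact lineSeg_of_blocked_succ hg hm' (by omega) he h1 hb
  have hne : cellLabel x C i j₀ ≠ cellLabel x C (i + 1) j₀ := by
    intro heq
    refine notMem_frontier_closure (P := cellLabel x C i j₀ = true) dense_compl_gridUnion
      hC.notMem ?_ hf
    filter_upwards [continuous_fst.continuousAt.eventually (eventually_gapIndex hg z.1),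
      continuous_snd.continuousAt.eventually (eventually_gapIndex hg z.2)] with q q1 q2 hqU
    rw [hgi] at q1
    rw [hj₀] at q2
    have hlab : cellLabel x C (gapIndex m g q.1) (gapIndex m g q.2) = cellLabel x C i j₀ := by
      rcases q2 with q2 | ⟨hlt, q2, q2'⟩
      · rw [q2]
        rcases q1 with q1 | ⟨-, -, q1⟩ <;> rw [q1]
        exact heq.symm
      · obtain ⟨o1, o2, -, -⟩ := isVertex_eq_false.1 (hopen q2)
        rw [q2']
        rcases q1 with q1 | ⟨-, -, q1⟩ <;> rw [q1]
        · exact hc.up j₀ hlt i hi.le o1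
        · exact (hc.up j₀ hlt (i + 1) hi o2).trans heq.symm
    rw [mem_iff_sample hg hC hqU, ← hlab]
    simp [cellLabel]
  have hvl : isVertex (blocked l h) (blocked l' h') i (l i) = true := by
    by_contra hb
    have := (isVertex_eq_false.1 (Bool.eq_false_iff.2 hb)).2.2.1
    exact lt_irrefl _ (blocked_eq_true.1 this).1
  have hvh : isVertex (blocked l h) (blocked l' h') i (h i) = true := by
    by_contra hb
    have := (isVertex_eq_false.1 (Bool.eq_false_iff.2 hb)).2.2.2
    exact absurd (blocked_eq_true.1 this).2 (by omega)
  obtain ⟨j₁, a1, a2, a3, a4⟩ := exists_last_of_lt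
    (P := fun j => isVertex (blocked l h) (blocked l' h') i j = true) hlj hvl
  obtain ⟨j₂, b1, b2, b3, b4⟩ := exists_first_of_lt
    (P := fun j => isVertex (blocked l h) (blocked l' h') i j = true)
    (show j₀ - 1 < h i by omega) hvh
  have hbetween : ∀ j, j₁ < j → j < j₂ → isVertex (blocked l h) (blocked l' h') i j = false := by
    intro j hj1 hj2
    rcases Nat.lt_or_ge j j₀ with hj | hj
    · exact Bool.eq_false_iff.2 (a4 j hj1 hj)
    · exact Bool.eq_false_iff.2 (b4 j (by omega) hj2)
  have hconst := const_along_edge hc (a := j₁) (b := j₂) hi (by omega) hbetween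
  refine ⟨i, j₁, j₂, ⟨hi, by omega, by omega, fun j hj1 hj2 => blocked_eq_true.2
    ⟨by omega, by omega⟩, fun j hj1 hj2 => ?_, a3, b3, hbetween⟩, h1, ?_, ?_⟩
  · rcases Nat.le_total j j₀ with hj | hj
    · obtain ⟨e1, e2⟩ := hconst j j₀ hj1 hj (by omega)
      rwa [← e1, ← e2]
    · obtain ⟨e1, e2⟩ := hconst j₀ j a2 hj (by omega)
      rwa [e1, e2]
  · exact g_lt_of_lt_gapIndex (a2.trans_eq hj₀.symm)
  · rcases hzj.lt_or_eq with hlt | heq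
    · exact hlt.trans_le (hg.g_le_g (by omega) (by omega))
    · have : j₀ ≠ j₂ := by
        rintro rfl
        simp [hopen heq] at b3
      rw [heq]
      exact hg.g_lt_g (by omega) (by omega)

lemma IsSeparatingEdge.subset (hg : IsSampledGrid m g x) (hm : ∀ i < m, h i < m)
    (hm' : ∀ i < m, h' i < m) {c : ℕ → ℕ → Bool} {i j₁ j₂ : ℕ}
    (he : IsSeparatingEdge m c (blocked l h) (blocked l' h') i j₁ j₂) :
    ({g i} ×ˢ Ioo (g j₁) (g j₂) : Set Pt) ⊆
      gridUnion m g l h l' h' \ gridVertices m g l h l' h' := by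
  rintro ⟨p1, y⟩ ⟨h1, h2, h3⟩
  obtain rfl : p1 = g i := h1
  dsimp only at h2 h3
  have hi := he.line_lt
  have htop := he.top_lt
  have hlt := he.lt
  have hseg : lineSeg m g l h (g i, y) := by
    refine lineSeg_of_blocked hg hm hi rfl (he.wall _ ?_ ?_)
    · by_contra! hle
      exact absurd (le_g_of_gapIndex_le hg hle (by omega)) (not_le.2 h2)
    · by_contra! hgt
      exact absurd (g_lt_of_lt_gapIndex hgt) (not_lt.2 h3.le)
  have hns : ¬ lineSeg m g l' h' (y, g i) := by
    rintro ⟨k, hk, hlk, e1, e2, e3⟩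
    dsimp only at e1 e2 e3
    subst e1
    have k1 := hg.lt_of_g_lt_g (by omega) h2
    have k2 := hg.lt_of_g_lt_g hk h3
    have hhk := hm' k hk
    have k3 := hg.le_of_g_le_g (by omega) e2
    have k4 := hg.le_of_g_le_g hi e3
    obtain ⟨b1, b2, -, -⟩ := isVertex_eq_false.1 (he.between k k1 k2)
    rw [blocked, decide_eq_false_iff_not] at b1 b2
    omega
  refine ⟨Or.inl hseg, ?_⟩
  rintro (hv | hv | hv)
  · obtain ⟨k, hk, hlk, e1, e2⟩ := hv
    obtain rfl := hg.g_inj hi hk e1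
    have hhk := hm i hk
    dsimp only at e2
    rcases e2 with rfl | rfl
    · have k1 := hg.lt_of_g_lt_g (by omega) h2
      have k2 := hg.lt_of_g_lt_g (by omega) h3
      have := (blocked_eq_true.1 (he.wall _ k1 k2.le)).1
      omega
    · have k1 := hg.lt_of_g_lt_g (by omega) h2
      have k2 := hg.lt_of_g_lt_g (by omega) h3
      have := (blocked_eq_true.1 (he.wall (h i + 1) (by omega) k2)).2
      omega
  · exact hns (lineSeg_of_lineEnd hg hm' hv)
  · exact hns hv.2

lemma connectedComponentIn_eq_of_isPreconnected {X T : Set Pt} (hT : IsPreconnected T)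
    (hX : T ⊆ X) {p q : Pt} (hp : p ∈ T) (hq : q ∈ T) :
    connectedComponentIn X p = connectedComponentIn X q :=
  connectedComponentIn_eq (hT.subset_connectedComponentIn hp hX hq)

lemma IsSeparatingEdge.sample_mem (hg : IsSampledGrid m g x) {c V H : ℕ → ℕ → Bool}
    {i j₁ j₂ : ℕ} (he : IsSeparatingEdge m c V H i j₁ j₂) :
    x (j₁ + 1) ∈ Ioo (g j₁) (g j₂) :=
  ⟨(hg j₁ (he.lt.trans he.top_lt)).2, hg.x_lt_g he.lt he.top_lt⟩

theorem ncard_edges_le (hg : IsSampledGrid m g x) (hm : ∀ i < m, h i < m)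
    (hm' : ∀ i < m, h' i < m) {C X : Set Pt}
    (hC : IsComplComponent (gridUnion m g l h l' h') C)
    (hX : X = gridUnion m g l h l' h' \ gridVertices m g l h l' h') :
    {e | (∃ z ∈ X, e = closure (connectedComponentIn X z)) ∧ e ⊆ frontier (closure C)}.ncard ≤
      4 * ((usedLines m l h).card + (usedLines m l' h').card) - 4 := by
  classical
  have hC' := hC.swap
  rw [preimage_swap_gridUnion] at hC'
  let box := Finset.range m ×ˢ Finset.range m ×ˢ Finset.range m
  let R := box.filter fun r =>
    IsSeparatingEdge m (cellLabel x C) (blocked l h) (blocked l' h') r.1 r.2.1 r.2.2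
  let R' := box.filter fun r => IsSeparatingEdge m (cellLabel x (Prod.swap ⁻¹' C))
    (blocked l' h') (blocked l h) r.1 r.2.1 r.2.2
  let f : ℕ × ℕ × ℕ → Set Pt := fun r =>
    closure (connectedComponentIn X (g r.1, x (r.2.1 + 1)))
  let f' : ℕ × ℕ × ℕ → Set Pt := fun r =>
    closure (connectedComponentIn X (x (r.2.1 + 1), g r.1))
  refine le_trans ?_ (card_separatingEdges_add_le (isCellComponent_cellLabel hg hm hm' hC)
    (isCellComponent_cellLabel hg hm' hm hC') hm hm' R R'
    (fun r hr => (Finset.mem_filter.1 hr).2) (fun r hr => (Finset.mem_filter.1 hr).2))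
  calc _ ≤ (↑(R.image f ∪ R'.image f') : Set (Set Pt)).ncard := by
        refine ncard_le_ncard ?_ (Finset.finite_toSet _)
        rintro e ⟨⟨z, hz, rfl⟩, hsub⟩
        have hzf := hsub (subset_closure (mem_connectedComponentIn hz))
        obtain ⟨hzU, hzV⟩ := hX ▸ hz
        rw [Finset.mem_coe, Finset.mem_union, Finset.mem_image, Finset.mem_image]
        rcases hzU with hzU | hzU
        · left
          obtain ⟨i, j₁, j₂, he, h1, h2, h3⟩ :=
            exists_isSeparatingEdge hg hm hm' hC hzU hzV hzf
          refine ⟨(i, j₁, j₂), ?_, ?_⟩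
          · have := he.lt
            have := he.top_lt
            simp only [R, box, Finset.mem_filter, Finset.mem_product, Finset.mem_range]
            exact ⟨⟨he.line_lt, by omega, by omega⟩, he⟩
          · exact congrArg closure (connectedComponentIn_eq_of_isPreconnected
              (isPreconnected_singleton.prod isPreconnected_Ioo)
              (hX ▸ he.subset hg hm hm') ⟨rfl, he.sample_mem hg⟩ ⟨h1, h2, h3⟩)
        · right
          obtain ⟨i, j₁, j₂, he, h1, h2, h3⟩ :=
            exists_isSeparatingEdge (z := z.swap) hg hm' hm hC' hzU
              (by rw [← preimage_swap_gridVertices]; simpa using hzV)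
              (by
                have e1 := (Homeomorph.prodComm ℝ ℝ).preimage_closure C
                have e2 := (Homeomorph.prodComm ℝ ℝ).preimage_frontier (closure C)
                rw [e1] at e2
                change _ ∈ frontier (closure (Homeomorph.prodComm ℝ ℝ ⁻¹' C))
                rw [← e2]
                exact hzf)
          refine ⟨(i, j₁, j₂), ?_, ?_⟩
          · have := he.lt
            have := he.top_lt
            simp only [R', box, Finset.mem_filter, Finset.mem_product, Finset.mem_range]
            exact ⟨⟨he.line_lt, by omega, by omega⟩, he⟩
          · refine congrArg closure (connectedComponentIn_eq_of_isPreconnected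
              (T := Ioo (g j₁) (g j₂) ×ˢ {g i})
              (isPreconnected_Ioo.prod isPreconnected_singleton)
              ?_ ⟨he.sample_mem hg, rfl⟩ ⟨⟨h2, h3⟩, h1⟩)
            rintro p ⟨p1, p2⟩
            have := he.subset hg hm' hm (show p.swap ∈ _ from ⟨p2, p1⟩)
            rw [← preimage_swap_gridUnion, ← preimage_swap_gridVertices] at this
            rw [hX]
            simpa using this
    _ ≤ R.card + R'.card := by
        rw [ncard_coe_finset]
        exact (Finset.card_union_le _ _).trans
          (add_le_add Finset.card_image_le Finset.card_image_le)

end grid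

/-- The vertical segment over `pos` from height `lo` to height `hi`. -/
def vertSeg (pos lo hi : ℝ) : Set Pt := {p | p.1 = pos ∧ lo ≤ p.2 ∧ p.2 ≤ hi}

lemma segment_eq_vertSeg {a b : Pt} (hab : a.1 = b.1) :
    segment ℝ a b = vertSeg a.1 (min a.2 b.2) (max a.2 b.2) := by
  obtain ⟨a1, a2⟩ := a
  obtain ⟨b1, b2⟩ := b
  obtain rfl : a1 = b1 := hab
  rw [← Prod.image_mk_segment_right, segment_eq_uIcc, uIcc]
  ext ⟨p1, p2⟩
  simp only [mem_image, mem_Icc, Prod.mk.injEq, vertSeg, mem_ofPred_eq]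
  constructor
  · rintro ⟨y, hy, rfl, rfl⟩; exact ⟨rfl, hy⟩
  · rintro ⟨rfl, hy⟩; exact ⟨p2, hy, rfl, rfl⟩

lemma preimage_swap_segment (a b : Pt) :
    Prod.swap ⁻¹' segment ℝ a b = segment ℝ a.swap b.swap := by
  rw [← image_swap_eq_preimage_swap]
  exact image_segment ℝ (LinearEquiv.prodComm ℝ ℝ ℝ).toLinearMap.toAffineMap a b

lemma segEndpoint_preimage_swap {s : Set Pt} {p : Pt} :
    SegEndpoint (Prod.swap ⁻¹' s) p ↔ SegEndpoint s p.swap := by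
  suffices ∀ (s : Set Pt) (p : Pt), SegEndpoint s p → SegEndpoint (Prod.swap ⁻¹' s) p.swap by
    refine ⟨fun h => ?_, fun h => by simpa using this _ _ h⟩
    simpa [← preimage_comp] using this _ _ h
  rintro s p ⟨a, b, hab, rfl, hp⟩
  exact ⟨a.swap, b.swap, Prod.swap_injective.ne hab, preimage_swap_segment a b,
    hp.imp (congrArg _) (congrArg _)⟩

lemma segEndpoint_vertSeg {pos lo hi : ℝ} (h : lo < hi) {p : Pt} :
    SegEndpoint (vertSeg pos lo hi) p ↔ p.1 = pos ∧ (p.2 = lo ∨ p.2 = hi) := by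
  constructor
  · rintro ⟨a, b, hab, hs, hp⟩
    have ha : a ∈ vertSeg pos lo hi := hs ▸ left_mem_segment ℝ a b
    have hb : b ∈ vertSeg pos lo hi := hs ▸ right_mem_segment ℝ a b
    rw [segment_eq_vertSeg (ha.1.trans hb.1.symm)] at hs
    have h1 : (pos, lo) ∈ vertSeg a.1 (min a.2 b.2) (max a.2 b.2) := hs ▸ ⟨rfl, le_rfl, h.le⟩
    have h2 : (pos, hi) ∈ vertSeg a.1 (min a.2 b.2) (max a.2 b.2) := hs ▸ ⟨rfl, h.le, le_rfl⟩
    have h1' := h1.2.1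
    have h2' := h2.2.2
    obtain ⟨ha1, ha2, ha3⟩ := ha
    obtain ⟨hb1, hb2, hb3⟩ := hb
    dsimp only at h1' h2'
    rcases le_total a.2 b.2 with hle | hle
    · rw [min_eq_left hle] at h1'
      rw [max_eq_right hle] at h2'
      rcases hp with rfl | rfl
      exacts [⟨ha1, Or.inl (by linarith)⟩, ⟨hb1, Or.inr (by linarith)⟩]
    · rw [min_eq_right hle] at h1'
      rw [max_eq_left hle] at h2'
      rcases hp with rfl | rfl
      exacts [⟨ha1, Or.inr (by linarith)⟩, ⟨hb1, Or.inl (by linarith)⟩]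
  · rintro ⟨h1, h2⟩
    refine ⟨(pos, lo), (pos, hi), by simp [h.ne], ?_,
      h2.imp (fun e => Prod.ext h1 e) (fun e => Prod.ext h1 e)⟩
    rw [segment_eq_vertSeg (a := (pos, lo)) (b := (pos, hi)) rfl, min_eq_left h.le,
      max_eq_right h.le]

lemma collinear_of_subset_fst {s : Set Pt} {c : ℝ} (hs : ∀ p ∈ s, p.1 = c) : Collinear ℝ s := by
  refine (collinear_iff_exists_forall_eq_smul_vadd s).2 ⟨(c, 0), (0, 1), fun p hp => ⟨p.2, ?_⟩⟩
  ext <;> simp [hs p hp]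

lemma collinear_of_subset_snd {s : Set Pt} {c : ℝ} (hs : ∀ p ∈ s, p.2 = c) : Collinear ℝ s := by
  refine (collinear_iff_exists_forall_eq_smul_vadd s).2 ⟨(0, c), (1, 0), fun p hp => ⟨p.1, ?_⟩⟩
  ext <;> simp [hs p hp]

lemma exists_vertSeg {s : Set Pt}
    (hs : ∃ a b : Pt, (a.1 = b.1 ∨ a.2 = b.2) ∧ a ≠ b ∧ s = segment ℝ a b) :
    ∃ pos lo hi : ℝ, lo < hi ∧
      (s = vertSeg pos lo hi ∨ s = Prod.swap ⁻¹' vertSeg pos lo hi) := by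
  obtain ⟨a, b, h | h, hab, rfl⟩ := hs
  · exact ⟨_, _, _, min_lt_max.2 fun e => hab (Prod.ext h e), Or.inl (segment_eq_vertSeg h)⟩
  · refine ⟨a.2, min a.1 b.1, max a.1 b.1, min_lt_max.2 fun e => hab (Prod.ext e h), Or.inr ?_⟩
    have := segment_eq_vertSeg (a := a.swap) (b := b.swap) h
    simp only [Prod.fst_swap, Prod.snd_swap] at this
    rw [← this, preimage_swap_segment, Prod.swap_swap, Prod.swap_swap]

/-- Vertical segments with distinct positions, given by indices of grid values, are described by
functions of the index of the line. -/
lemma exists_lines {ι : Type*} {m : ℕ} (g : ℕ → ℝ) (K : Finset ι) {ip il ih : ι → ℕ}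
    (hinj : ∀ s ∈ K, ∀ t ∈ K, ip s = ip t → s = t) (hip : ∀ t ∈ K, ip t < m)
    (hih : ∀ t ∈ K, ih t < m) (hlt : ∀ t ∈ K, il t < ih t) :
    ∃ l h : ℕ → ℕ, (∀ i < m, h i < m) ∧
      (∀ p, lineSeg m g l h p ↔ ∃ t ∈ K, p ∈ vertSeg (g (ip t)) (g (il t)) (g (ih t))) ∧
      (∀ p, lineEnd m g l h p ↔
        ∃ t ∈ K, p.1 = g (ip t) ∧ (p.2 = g (il t) ∨ p.2 = g (ih t))) ∧
      (usedLines m l h).card ≤ K.card := by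
  classical
  have : ∀ i, ∃ q : ℕ × ℕ, (∀ t ∈ K, ip t = i → q = (il t, ih t)) ∧
      ((∀ t ∈ K, ip t ≠ i) → q = (0, 0)) := by
    intro i
    by_cases hi : ∃ t ∈ K, ip t = i
    · obtain ⟨t, ht, rfl⟩ := hi
      refine ⟨(il t, ih t), fun s hs e => ?_, fun hn => absurd rfl (hn t ht)⟩
      rw [hinj s hs t ht e]
    · push Not at hi
      exact ⟨(0, 0), fun t ht e => absurd e (hi t ht), fun _ => rfl⟩
  choose q hq hq0 using this
  have hused : ∀ i, (q i).1 < (q i).2 → ∃ t ∈ K, ip t = i := by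
    intro i hi
    by_contra! hn
    simp [hq0 i hn] at hi
  refine ⟨fun i => (q i).1, fun i => (q i).2, ?_, ?_, ?_, ?_⟩
  · intro i hi
    by_cases hn : ∃ t ∈ K, ip t = i
    · obtain ⟨t, ht, e⟩ := hn
      simpa [hq i t ht e] using hih t ht
    · push Not at hn
      simp only [hq0 i hn]
      omega
  · intro p
    constructor
    · rintro ⟨i, hi, h1, h2, h3⟩
      obtain ⟨t, ht, rfl⟩ := hused i h1
      simp only [hq _ t ht rfl] at h3
      exact ⟨t, ht, h2, h3⟩
    · rintro ⟨t, ht, h2, h3⟩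
      refine ⟨ip t, hip t ht, ?_, h2, ?_⟩ <;> simp only [hq _ t ht rfl]
      exacts [hlt t ht, h3]
  · intro p
    constructor
    · rintro ⟨i, hi, h1, h2, h3⟩
      obtain ⟨t, ht, rfl⟩ := hused i h1
      simp only [hq _ t ht rfl] at h3
      exact ⟨t, ht, h2, h3⟩
    · rintro ⟨t, ht, h2, h3⟩
      refine ⟨ip t, hip t ht, ?_, h2, ?_⟩ <;> simp only [hq _ t ht rfl]
      exacts [hlt t ht, h3]
  · refine le_trans (Finset.card_le_card fun i hi => ?_) (Finset.card_image_le (f := ip))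
    obtain ⟨t, ht, e⟩ := hused i (Finset.mem_filter.1 hi).2
    exact Finset.mem_image.2 ⟨t, ht, e⟩

lemma isComplComponent_connectedComponentIn (U : Set Pt) (p : Pt) :
    IsComplComponent U (connectedComponentIn Uᶜ p) where
  isPreconnected := isPreconnected_connectedComponentIn
  notMem _ hq := connectedComponentIn_subset _ _ hq
  absorb T hT hU := by
    rintro ⟨q, hq, hqC⟩
    rw [connectedComponentIn_eq hqC]
    exact hT.subset_connectedComponentIn hq hU

/-- A family of axis-parallel segments, no two of them on a common line, is described by a
sampled grid. -/
lemma exists_grid {n : ℕ} (S : Fin n → Set Pt)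
    (hseg : ∀ i : Fin n, ∃ a b : Pt, (a.1 = b.1 ∨ a.2 = b.2) ∧ a ≠ b ∧ S i = segment ℝ a b)
    (hline : ∀ i j : Fin n, i ≠ j → ¬ Collinear ℝ (S i ∪ S j)) :
    ∃ (m : ℕ) (g x : ℕ → ℝ) (l h l' h' : ℕ → ℕ), IsSampledGrid m g x ∧
      (∀ i < m, h i < m) ∧ (∀ i < m, h' i < m) ∧ (⋃ i, S i) = gridUnion m g l h l' h' ∧
      ArrVertices S = gridVertices m g l h l' h' ∧
      (usedLines m l h).card + (usedLines m l' h').card ≤ n := by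
  classical
  choose pos lo hi hlt hS using fun i => exists_vertSeg (hseg i)
  let K : Finset (Fin n) := Finset.univ.filter fun t => S t = vertSeg (pos t) (lo t) (hi t)
  have hK : ∀ t ∈ K, S t = vertSeg (pos t) (lo t) (hi t) := fun t ht => (Finset.mem_filter.1 ht).2
  have hK' : ∀ t ∈ Kᶜ, S t = Prod.swap ⁻¹' vertSeg (pos t) (lo t) (hi t) := fun t ht =>
    (hS t).resolve_left fun e =>
      Finset.mem_compl.1 ht (Finset.mem_filter.2 ⟨Finset.mem_univ t, e⟩)
  obtain ⟨m, g, x, hg, hG⟩ := exists_isSampledGrid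
    (Finset.univ.image pos ∪ (Finset.univ.image lo ∪ Finset.univ.image hi))
  choose ip hip hpos using fun t => hG (pos t) (by simp)
  choose il hil hlo using fun t => hG (lo t) (by simp)
  choose ih hih hhi using fun t => hG (hi t) (by simp)
  have hlt' : ∀ t, il t < ih t := fun t =>
    hg.lt_of_g_lt_g (hil t) (by rw [hlo, hhi]; exact hlt t)
  have hinj : ∀ s ∈ K, ∀ t ∈ K, pos s = pos t → s = t := by
    intro s hs t ht e
    by_contra hne
    refine hline s t hne (collinear_of_subset_fst (c := pos t) ?_)
    rw [hK s hs, hK t ht, ← e]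
    rintro p (hp | hp) <;> exact hp.1
  have hinj' : ∀ s ∈ Kᶜ, ∀ t ∈ Kᶜ, pos s = pos t → s = t := by
    intro s hs t ht e
    by_contra hne
    refine hline s t hne (collinear_of_subset_snd (c := pos t) ?_)
    rw [hK' s hs, hK' t ht, ← e]
    rintro p (hp | hp) <;> exact hp.1
  obtain ⟨l, h, hm, hl1, hl2, hl3⟩ := exists_lines g K (ip := ip) (il := il) (ih := ih)
    (fun s hs t ht e => hinj s hs t ht (by rw [← hpos, ← hpos, e]))
    (fun t _ => hip t) (fun t _ => hih t) (fun t _ => hlt' t)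
  obtain ⟨l', h', hm', hl1', hl2', hl3'⟩ := exists_lines g Kᶜ (ip := ip) (il := il) (ih := ih)
    (fun s hs t ht e => hinj' s hs t ht (by rw [← hpos, ← hpos, e]))
    (fun t _ => hip t) (fun t _ => hih t) (fun t _ => hlt' t)
  simp only [hpos, hlo, hhi] at hl1 hl2 hl1' hl2'
  have hseg1 : ∀ p, lineSeg m g l h p ↔ ∃ t ∈ K, p ∈ S t := fun p => by
    rw [hl1]
    exact exists_congr fun t => and_congr_right fun ht => by rw [hK t ht]
  have hseg2 : ∀ p : Pt, lineSeg m g l' h' p.swap ↔ ∃ t ∈ Kᶜ, p ∈ S t := fun p => by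
    rw [hl1']
    exact exists_congr fun t => and_congr_right fun ht => by rw [hK' t ht]; rfl
  have hend1 : ∀ p, lineEnd m g l h p ↔ ∃ t ∈ K, SegEndpoint (S t) p := fun p => by
    rw [hl2]
    exact exists_congr fun t => and_congr_right fun ht => by
      rw [hK t ht, segEndpoint_vertSeg (hlt t)]
  have hend2 : ∀ p : Pt, lineEnd m g l' h' p.swap ↔ ∃ t ∈ Kᶜ, SegEndpoint (S t) p := fun p => by
    rw [hl2']
    exact exists_congr fun t => and_congr_right fun ht => by
      rw [hK' t ht, segEndpoint_preimage_swap, segEndpoint_vertSeg (hlt t)]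
  have hmem : ∀ t, t ∈ K ∨ t ∈ Kᶜ := fun t => by
    rw [Finset.mem_compl]
    exact em _
  refine ⟨m, g, x, l, h, l', h', hg, hm, hm', ?_, ?_, ?_⟩
  · ext p
    rw [mem_iUnion]
    refine Iff.trans ?_ (or_congr (hseg1 p) (hseg2 p)).symm
    constructor
    · rintro ⟨t, ht⟩
      exact (hmem t).imp (fun hk => ⟨t, hk, ht⟩) (fun hk => ⟨t, hk, ht⟩)
    · rintro (⟨t, -, ht⟩ | ⟨t, -, ht⟩) <;> exact ⟨t, ht⟩
  · ext p
    refine Iff.trans ?_ (or_congr (hend1 p) (or_congr (hend2 p)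
      (and_congr (hseg1 p) (hseg2 p)))).symm
    constructor
    · rintro (⟨t, ht⟩ | ⟨s, t, hne, hs, ht⟩)
      · rcases hmem t with hk | hk
        exacts [Or.inl ⟨t, hk, ht⟩, Or.inr (Or.inl ⟨t, hk, ht⟩)]
      · rcases hmem s with hks | hks <;> rcases hmem t with hkt | hkt
        · rw [hK s hks] at hs
          rw [hK t hkt] at ht
          exact absurd (hinj s hks t hkt (hs.1.symm.trans ht.1)) hne
        · exact Or.inr (Or.inr ⟨⟨s, hks, hs⟩, ⟨t, hkt, ht⟩⟩)
        · exact Or.inr (Or.inr ⟨⟨t, hkt, ht⟩, ⟨s, hks, hs⟩⟩)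
        · rw [hK' s hks] at hs
          rw [hK' t hkt] at ht
          exact absurd (hinj' s hks t hkt (hs.1.symm.trans ht.1)) hne
    · rintro (⟨t, -, ht⟩ | ⟨t, -, ht⟩ | ⟨⟨s, hks, hs⟩, ⟨t, hkt, ht⟩⟩)
      · exact Or.inl ⟨t, ht⟩
      · exact Or.inl ⟨t, ht⟩
      · refine Or.inr ⟨s, t, ?_, hs, ht⟩
        rintro rfl
        exact Finset.mem_compl.1 hkt hks
  · have := Finset.card_add_card_compl K
    rw [Fintype.card_fin] at this
    omega

theorem stmt4 (n : ℕ) (hn : 1 < n) (S : Fin n → Set Pt)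
    -- the members of `S` are nondegenerate axis-parallel line segments
    (hseg : ∀ i : Fin n, ∃ a b : Pt, (a.1 = b.1 ∨ a.2 = b.2) ∧ a ≠ b ∧ S i = segment ℝ a b)
    -- no two of the segments lie on a common line
    (hline : ∀ i j : Fin n, i ≠ j → ¬ Collinear ℝ (S i ∪ S j))
    (F : Set Pt) (hF : F ∈ ArrFaces S) :
    (FaceEdges S F).ncard ≤ 4 * n - 4 := by
  obtain ⟨x₀, -, rfl⟩ := hF
  obtain ⟨m, g, x, l, h, l', h', hg, hm, hm', hU, hV, hcard⟩ := exists_grid S hseg hline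
  have hC := isComplComponent_connectedComponentIn (⋃ i, S i) x₀
  generalize connectedComponentIn (⋃ i, S i)ᶜ x₀ = C at hC ⊢
  rw [hU] at hC
  have hle := ncard_edges_le (X := (⋃ i, S i) \ ArrVertices S) hg hm hm' hC (by rw [hU, hV])
  exact hle.trans (by omega)
end

section
/- There is an absolute constant A > 0 with the following property. For every n ≥ 2 and every grounded family L of n L-shapes in the plane, the L-shapes of L can be colored with at most A·(log n)² colors such that for every ℓ ∈ L whose set of intersecting L-shapes is nonempty, among the L-shapes of L intersecting ℓ there is one whose color differs from the colors of all other L-shapes intersecting ℓ. -/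
open Set

/-- The L-shape with corner `(x, y)`, horizontal segment of length `w` going right and
vertical segment of height `h` going up from the corner. -/
def LShape (x y w h : ℝ) : Set Pt :=
  segment ℝ (x, y) (x + w, y) ∪ segment ℝ (x, y) (x, y + h)

/-- A graph with few edges has a large independent set. -/
theorem exists_independent_subset {V : Type*} [DecidableEq V] (U : Finset V)
    (E : Finset (V × V)) (C : ℕ) (hE : E.card ≤ C * U.card) :
    ∃ I ⊆ U, U.card ≤ (8 * C + 2) * I.card ∧
      ∀ p ∈ E, p.1 ≠ p.2 → p.1 ∈ I → p.2 ∉ I := by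
  let inc : V → Finset (V × V) := fun v => E.filter fun p => p.1 = v ∨ p.2 = v
  let low := U.filter fun v => (inc v).card ≤ 4 * C
  have hsum : ∑ v ∈ U, (inc v).card ≤ 2 * E.card := by
    have h1 : ∀ v, (inc v).card ≤
        (E.filter fun p => p.1 = v).card + (E.filter fun p => p.2 = v).card := fun v => by
      simp only [inc, Finset.filter_or]
      exact Finset.card_union_le _ _
    have h2 : ∀ f : V × V → V, ∑ v ∈ U, (E.filter fun p => f p = v).card ≤ E.card := by
      intro f
      rw [← Finset.card_biUnion]
      · exact Finset.card_le_card (Finset.biUnion_subset.2 fun v _ => Finset.filter_subset _ _)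
      · intro a _ b _ hab
        rw [Function.onFun, Finset.disjoint_left]
        intro p hp hq
        exact hab ((Finset.mem_filter.1 hp).2.symm.trans (Finset.mem_filter.1 hq).2)
    calc ∑ v ∈ U, (inc v).card
        ≤ ∑ v ∈ U, ((E.filter fun p => p.1 = v).card + (E.filter fun p => p.2 = v).card) :=
          Finset.sum_le_sum fun v _ => h1 v
      _ ≤ 2 * E.card := by
          rw [Finset.sum_add_distrib]
          have := h2 Prod.fst
          have := h2 Prod.snd
          omega
  have hlow : U.card ≤ 2 * low.card := by
    have h1 : (4 * C + 1) * (U.filter fun v => ¬ (inc v).card ≤ 4 * C).card ≤ 2 * E.card := by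
      refine le_trans ?_ hsum
      refine le_trans ?_ (Finset.sum_le_sum_of_subset (Finset.filter_subset
        (fun v => ¬ (inc v).card ≤ 4 * C) U))
      rw [mul_comm, ← smul_eq_mul]
      refine Finset.card_nsmul_le_sum _ _ _ fun v hv => ?_
      have := (Finset.mem_filter.1 hv).2
      omega
    have h2 := Finset.card_filter_add_card_filter_not (s := U) (fun v => (inc v).card ≤ 4 * C)
    change low.card + _ = _ at h2
    by_contra! hlt
    have h3 : U.card < 2 * (U.filter fun v => ¬ (inc v).card ≤ 4 * C).card := by omega
    nlinarith
  let fam := low.powerset.filter fun I => ∀ p ∈ E, p.1 ≠ p.2 → p.1 ∈ I → p.2 ∉ I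
  obtain ⟨I, hI, hmax⟩ := Finset.exists_max_image fam Finset.card ⟨∅, by simp [fam]⟩
  obtain ⟨hIlow, hind⟩ := Finset.mem_filter.1 hI
  rw [Finset.mem_powerset] at hIlow
  refine ⟨I, hIlow.trans (Finset.filter_subset _ _), ?_, hind⟩
  have hcov : low ⊆ I.biUnion fun v =>
      insert v ((inc v).image fun p => if p.1 = v then p.2 else p.1) := by
    intro u hu
    by_cases huI : u ∈ I
    · exact Finset.mem_biUnion.2 ⟨u, huI, Finset.mem_insert_self _ _⟩
    have hnot : insert u I ∉ fam := fun hmem => by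
      have := hmax _ hmem
      rw [Finset.card_insert_of_notMem huI] at this
      omega
    simp only [fam, Finset.mem_filter, Finset.mem_powerset, not_and] at hnot
    have := hnot (Finset.insert_subset hu hIlow)
    push Not at this
    obtain ⟨p, hp, hne, h1, h2⟩ := this
    rw [Finset.mem_insert] at h1 h2
    rcases h1 with h1 | h1 <;> rcases h2 with h2 | h2
    · exact absurd (h1.trans h2.symm) hne
    · refine Finset.mem_biUnion.2 ⟨p.2, h2, Finset.mem_insert_of_mem (Finset.mem_image.2
        ⟨p, by simp [inc, hp], by rw [if_neg hne, h1]⟩)⟩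
    · refine Finset.mem_biUnion.2 ⟨p.1, h1, Finset.mem_insert_of_mem (Finset.mem_image.2
        ⟨p, by simp [inc, hp], by simp [h2]⟩)⟩
    · exact absurd h2 (hind p hp hne h1)
  have hcard : low.card ≤ I.card * (4 * C + 1) := by
    refine (Finset.card_le_card hcov).trans (Finset.card_biUnion_le_card_mul _ _ _ fun v hv => ?_)
    refine (Finset.card_insert_le _ _).trans ?_
    have h1 := (Finset.mem_filter.1 (hIlow hv)).2
    have h2 := Finset.card_image_le (s := inc v) (f := fun p => if p.1 = v then p.2 else p.1)
    omega
  nlinarith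

/-- If every subset `U` of `Λ` carries a sparse graph having an edge inside the trace on `U` of
each hyperedge with at least two vertices in `U`, then `Λ` has a conflict-free coloring with
logarithmically many colors. -/
theorem exists_conflictFree_coloring {V ι : Type*} [DecidableEq V] (N : ι → V → Prop) (C : ℕ)
    (Λ : Finset V)
    (h : ∀ U ⊆ Λ, ∃ E : Finset (V × V), E.card ≤ C * U.card ∧
      ∀ i, ∀ u ∈ U, ∀ v ∈ U, u ≠ v → N i u → N i v →
        ∃ p ∈ E, p.1 ≠ p.2 ∧ p.1 ∈ U ∧ p.2 ∈ U ∧ N i p.1 ∧ N i p.2) :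
    ∃ col : V → ℕ, (∀ v ∈ Λ, (col v : ℝ) ≤ (8 * C + 2) * Real.log Λ.card) ∧
      ∀ i, (∃ v ∈ Λ, N i v) →
        ∃ v ∈ Λ, N i v ∧ ∀ v' ∈ Λ, N i v' → v' ≠ v → col v' ≠ col v := by
  induction Λ using Finset.strongInduction with
  | H Λ ih =>
  rcases Λ.eq_empty_or_nonempty with rfl | hne
  · exact ⟨fun _ => 0, by simp, by simp⟩
  obtain ⟨E, hE, hEN⟩ := h Λ subset_rfl
  obtain ⟨I, hIU, hIcard, hI⟩ := exists_independent_subset Λ E C hE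
  have hpos : 0 < Λ.card := hne.card_pos
  have hIpos : 0 < I.card := by
    rcases Nat.eq_zero_or_pos I.card with h0 | h0
    · rw [h0] at hIcard; omega
    · exact h0
  have hss : Λ \ I ⊂ Λ := Finset.sdiff_ssubset hIU (Finset.card_pos.1 hIpos)
  obtain ⟨col, hcol, hcf⟩ := ih (Λ \ I) hss fun U hU => h U (hU.trans hss.subset)
  have hsd : (Λ \ I).card + I.card = Λ.card := Finset.card_sdiff_add_card_eq_card hIU
  refine ⟨fun v => if v ∈ I then 0 else col v + 1, ?_, ?_⟩
  · intro v hv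
    by_cases hvI : v ∈ I
    · simp only [hvI, if_true, Nat.cast_zero]
      exact mul_nonneg (by positivity) (Real.log_natCast_nonneg _)
    simp only [hvI, if_false, Nat.cast_add, Nat.cast_one]
    have hvm : v ∈ Λ \ I := Finset.mem_sdiff.2 ⟨hv, hvI⟩
    have h0 : 0 < (Λ \ I).card := Finset.card_pos.2 ⟨v, hvm⟩
    have h1 := hcol v hvm
    have hΛ : (0 : ℝ) < Λ.card := by exact_mod_cast hpos
    have hS : (0 : ℝ) < (Λ \ I).card := by exact_mod_cast h0
    have h2 := Real.log_le_sub_one_of_pos (div_pos hS hΛ)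
    rw [Real.log_div hS.ne' hΛ.ne'] at h2
    have hc : (0 : ℝ) < 8 * C + 2 := by positivity
    have h3 : ((Λ \ I).card : ℝ) / Λ.card - 1 ≤ -(1 / (8 * C + 2)) := by
      have e : ((Λ \ I).card : ℝ) = Λ.card - I.card := by
        rw [← hsd]; push_cast; ring
      have e2 : (Λ.card : ℝ) ≤ (8 * C + 2) * I.card := by exact_mod_cast hIcard
      rw [e, sub_div, div_self hΛ.ne']
      have : 1 / (8 * (C : ℝ) + 2) ≤ (I.card : ℝ) / Λ.card := by
        rw [div_le_div_iff₀ hc hΛ]; linarith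
      linarith
    have h4 : (8 * (C : ℝ) + 2) * (Real.log (Λ \ I).card - Real.log Λ.card) ≤ -1 := by
      calc _ ≤ (8 * (C : ℝ) + 2) * (-(1 / (8 * C + 2))) :=
            mul_le_mul_of_nonneg_left (h2.trans h3) hc.le
        _ = -1 := by field_simp
    linarith
  · rintro i ⟨w, hw, hNw⟩
    by_cases hrest : ∃ v ∈ Λ \ I, N i v
    · obtain ⟨v, hv, hNv, huniq⟩ := hcf i hrest
      obtain ⟨hvΛ, hvI⟩ := Finset.mem_sdiff.1 hv
      refine ⟨v, hvΛ, hNv, fun v' hv' hN' hne' => ?_⟩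
      by_cases hI' : v' ∈ I
      · simp [hI', hvI]
      · simpa [hI', hvI] using huniq v' (Finset.mem_sdiff.2 ⟨hv', hI'⟩) hN' hne'
    · push Not at hrest
      have hmem : ∀ v ∈ Λ, N i v → v ∈ I := fun v hv hN => by
        by_contra hvI
        exact hrest v (Finset.mem_sdiff.2 ⟨hv, hvI⟩) hN
      refine ⟨w, hw, hNw, fun v' hv' hN' hne' _ => ?_⟩
      obtain ⟨p, hp, hpne, h1, h2, hN1, hN2⟩ := hEN i v' hv' w hw hne' hN' hNw
      exact hI p hp hpne (hmem _ h1 hN1) (hmem _ h2 hN2)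

/-- Combinatorial data of a grounded family of L-shapes: positions, reaches and depths, together
with a level function such that members of the same level either share a key or are separated
by a point all of whose covering members have a larger level. -/
structure GroundedSystem (V D : Type*) [LinearOrder D] where
  pos : V → ℕ
  reach : V → ℕ
  depth : V → D
  lev : V → ℕ
  key : V → ℕ
  pos_injective : Function.Injective pos
  depth_injective : Function.Injective depth
  pos_le_key : ∀ i, pos i ≤ key i
  key_le_reach : ∀ i, key i ≤ reach i
  lev_mono : ∀ i j, pos j ≤ pos i → reach i ≤ reach j → lev i ≤ lev j
  separation : ∀ i j, lev i = lev j → key i < key j →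
    ∃ s, key i ≤ s ∧ s ≤ key j ∧ ∀ v, pos v ≤ s → s ≤ reach v → lev i < lev v

namespace GroundedSystem

variable {V D : Type*} [LinearOrder D] (S : GroundedSystem V D)

/-- The horizontal segment of `i` meets the vertical segment of `j`. -/
def Hits (i j : V) : Prop :=
  S.pos i < S.pos j ∧ S.pos j ≤ S.reach i ∧ S.depth i < S.depth j

/-- The pair `l`, `j` is the trace on `U` of the neighborhood of `i`, with `l` to the left of `i`
and `j` to its right. -/
structure IsLink (U : Finset V) (l i j : V) : Prop where
  left : S.Hits l i
  right : S.Hits i j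
  left_unique : ∀ u ∈ U, S.Hits u i → u = l
  right_unique : ∀ u ∈ U, S.Hits i u → u = j

variable {S}

theorem IsLink.depth_le_of_right {U : Finset V} {l i j u : V} (h : S.IsLink U l i j) (hu : u ∈ U)
    (hne : u ≠ j) (h1 : S.pos i < S.pos u) (h2 : S.pos u ≤ S.reach i) :
    S.depth u ≤ S.depth i :=
  not_lt.1 fun h3 => hne (h.right_unique u hu ⟨h1, h2, h3⟩)

theorem IsLink.depth_le_of_left {U : Finset V} {l i j u : V} (h : S.IsLink U l i j) (hu : u ∈ U)
    (hne : u ≠ l) (h1 : S.pos u < S.pos i) (h2 : S.pos i ≤ S.reach u) :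
    S.depth i ≤ S.depth u :=
  not_lt.1 fun h3 => hne (h.left_unique u hu ⟨h1, h2, h3⟩)

open Classical in
/-- The pairs of elements of `U` in the relation `R`. -/
noncomputable def pairs (U : Finset V) (R : V → V → Prop) : Finset (V × V) :=
  (U ×ˢ U).filter fun p => R p.1 p.2

theorem mem_pairs {U : Finset V} {R : V → V → Prop} {p : V × V} :
    p ∈ pairs U R ↔ (p.1 ∈ U ∧ p.2 ∈ U) ∧ R p.1 p.2 := by
  classical
  simp [pairs]

theorem card_pairs_le_of_left {U : Finset V} {R : V → V → Prop}
    (h : ∀ l ∈ U, ∀ j ∈ U, ∀ j' ∈ U, R l j → R l j' → j = j') : (pairs U R).card ≤ U.card := by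
  refine Finset.card_le_card_of_injOn Prod.fst (fun p hp => (mem_pairs.1 hp).1.1) ?_
  rintro ⟨l, j⟩ hp ⟨l', j'⟩ hq (rfl : l = l')
  have hp := mem_pairs.1 hp
  have hq := mem_pairs.1 hq
  exact Prod.ext rfl (h l hp.1.1 j hp.1.2 j' hq.1.2 hp.2 hq.2)

theorem card_pairs_le_of_right {U : Finset V} {R : V → V → Prop}
    (h : ∀ l ∈ U, ∀ l' ∈ U, ∀ j ∈ U, R l j → R l' j → l = l') : (pairs U R).card ≤ U.card := by
  refine Finset.card_le_card_of_injOn Prod.snd (fun p hp => (mem_pairs.1 hp).1.2) ?_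
  rintro ⟨l, j⟩ hp ⟨l', j'⟩ hq (rfl : j = j')
  have hp := mem_pairs.1 hp
  have hq := mem_pairs.1 hq
  exact Prod.ext (h l hp.1.1 l' hq.1.1 j hp.1.2 hp.2 hq.2) rfl

theorem card_pairs_le_add {U : Finset V} {R R₁ R₂ : V → V → Prop}
    (h : ∀ l ∈ U, ∀ j ∈ U, R l j → R₁ l j ∨ R₂ l j) :
    (pairs U R).card ≤ (pairs U R₁).card + (pairs U R₂).card := by
  classical
  refine (Finset.card_le_card fun p hp => ?_).trans (Finset.card_union_le _ _)
  have hp := mem_pairs.1 hp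
  rw [Finset.mem_union, mem_pairs, mem_pairs]
  rcases h _ hp.1.1 _ hp.1.2 hp.2 with h | h
  · exact Or.inl ⟨hp.1, h⟩
  · exact Or.inr ⟨hp.1, h⟩

/-- For every `l` there is one pair with rightmost second element; the others are counted
separately. -/
theorem card_pairs_le_of_not_last (S : GroundedSystem V D) (U : Finset V) (R : V → V → Prop) :
    (pairs U R).card ≤ U.card +
      (pairs U fun l j => R l j ∧ ∃ j' ∈ U, R l j' ∧ S.pos j < S.pos j').card := by
  refine (card_pairs_le_add (R₁ := fun l j => R l j ∧ ∀ j' ∈ U, R l j' → S.pos j' ≤ S.pos j)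
    (R₂ := fun l j => R l j ∧ ∃ j' ∈ U, R l j' ∧ S.pos j < S.pos j') ?_).trans
    (Nat.add_le_add_right (card_pairs_le_of_left ?_) _)
  · intro l _ j _ hR
    by_cases h : ∃ j' ∈ U, R l j' ∧ S.pos j < S.pos j'
    · exact Or.inr ⟨hR, h⟩
    · push Not at h
      exact Or.inl ⟨hR, h⟩
  · intro l _ j hj j' hj' h h'
    exact S.pos_injective (le_antisymm (h'.2 j hj h.1) (h.2 j' hj' h'.1))

theorem card_pairs_le_two_mul (S : GroundedSystem V D) {U : Finset V} {R : V → V → Prop}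
    (h : ∀ l ∈ U, ∀ l' ∈ U, ∀ j ∈ U, ∀ k ∈ U, ∀ k' ∈ U, S.pos l < S.pos l' →
      S.pos j < S.pos k → S.pos j < S.pos k' → R l j → R l k → R l' j → R l' k' → False) :
    (pairs U R).card ≤ 2 * U.card := by
  have := card_pairs_le_of_not_last S U R
  have : (pairs U fun l j => R l j ∧ ∃ j' ∈ U, R l j' ∧ S.pos j < S.pos j').card ≤ U.card := by
    refine card_pairs_le_of_right ?_
    rintro l hl l' hl' j hj ⟨h1, k, hk, h2, h3⟩ ⟨h1', k', hk', h2', h3'⟩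
    by_contra hne
    rcases lt_or_gt_of_ne (fun e => hne (S.pos_injective e)) with hlt | hlt
    · exact h l hl l' hl' j hj k hk k' hk' hlt h3 h3' h1 h2 h1' h2'
    · exact h l' hl' l hl j hj k' hk' k hk hlt h3' h3 h1' h2' h1 h2
  omega

/-- Pairs of members of `U` that are consecutive along some horizontal segment. -/
theorem card_horizontal_pairs_le (S : GroundedSystem V D) (U : Finset V) :
    (pairs U fun j k => S.pos j < S.pos k ∧ ∃ i, S.depth i < S.depth j ∧ S.depth i < S.depth k ∧
      ∀ u ∈ U, S.pos j < S.pos u → S.pos u < S.pos k → S.depth u ≤ S.depth i).card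
      ≤ 2 * U.card := by
  set R : V → V → Prop := fun j k => S.pos j < S.pos k ∧ ∃ i, S.depth i < S.depth j ∧
      S.depth i < S.depth k ∧
      ∀ u ∈ U, S.pos j < S.pos u → S.pos u < S.pos k → S.depth u ≤ S.depth i with hR
  have h0 := card_pairs_le_add (U := U) (R := R)
    (R₁ := fun j k => R j k ∧ S.depth j ≤ S.depth k)
    (R₂ := fun j k => R j k ∧ S.depth k ≤ S.depth j)
    fun j _ k _ h => (le_total (S.depth j) (S.depth k)).imp (⟨h, ·⟩) (⟨h, ·⟩)
  have h1 : (pairs U fun j k => R j k ∧ S.depth j ≤ S.depth k).card ≤ U.card := by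
    have key : ∀ j, ∀ k ∈ U, ∀ k', R j k → S.depth j ≤ S.depth k → R j k' →
        ¬ S.pos k < S.pos k' := by
      rintro j k hk k' ⟨h1, -⟩ h2 ⟨-, i, h3, -, h4⟩ hlt
      exact absurd ((h4 k hk h1 hlt).trans_lt (h3.trans_le h2)) (lt_irrefl _)
    refine card_pairs_le_of_left fun j _ k hk k' hk' h h' => S.pos_injective (le_antisymm ?_ ?_)
    · exact not_lt.1 (key j k' hk' k h'.1 h'.2 h.1)
    · exact not_lt.1 (key j k hk k' h.1 h.2 h'.1)
  have h2 : (pairs U fun j k => R j k ∧ S.depth k ≤ S.depth j).card ≤ U.card := by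
    have key : ∀ j ∈ U, ∀ j', ∀ k, R j k → S.depth k ≤ S.depth j → R j' k →
        ¬ S.pos j' < S.pos j := by
      rintro j hj j' k ⟨h1, -⟩ h2 ⟨-, i, -, h3, h4⟩ hlt
      exact absurd ((h4 j hj hlt h1).trans_lt (h3.trans_le h2)) (lt_irrefl _)
    refine card_pairs_le_of_right fun j hj j' hj' k _ h h' => S.pos_injective (le_antisymm ?_ ?_)
    · exact not_lt.1 (key j hj j' k h.1 h.2 h'.1)
    · exact not_lt.1 (key j' hj' j k h'.1 h'.2 h.1)
  omega

/-- Pairs of members of `U` that are the two topmost ones above some corner. -/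
theorem card_vertical_pairs_le (S : GroundedSystem V D) (U : Finset V) :
    (pairs U fun l k => S.depth l < S.depth k ∧ ∃ i, S.Hits l i ∧ S.Hits k i ∧
      ∀ u ∈ U, S.Hits u i → u ≠ l → S.depth k ≤ S.depth u).card ≤ 2 * U.card + 1 := by
  classical
  let R : V → V → V → Prop := fun l k i => S.depth l < S.depth k ∧ S.Hits l i ∧ S.Hits k i ∧
      ∀ u ∈ U, S.Hits u i → u ≠ l → S.depth k ≤ S.depth u
  let A : V → Finset V := fun i => U.filter fun u => S.pos u < S.pos i
  let B : V → Finset V := fun i => U.filter fun u => S.reach u < S.pos i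
  have hR : ∀ l ∈ U, ∀ k ∈ U, ∀ l' ∈ U, ∀ k' ∈ U, ∀ i i', A i = A i' →
      B i = B i' → R l k i → R l' k' i' → l = l' ∧ k = k' := by
    intro l hl k hk l' hl' k' hk' i i' hA hB ⟨h1, h2, h3, h4⟩ ⟨h1', h2', h3', h4'⟩
    have hcov : ∀ u ∈ U, (S.pos u < S.pos i ∧ S.pos i ≤ S.reach u) ↔
        (S.pos u < S.pos i' ∧ S.pos i' ≤ S.reach u) := by
      intro u hu
      have ha := Finset.ext_iff.1 hA u
      have hb := Finset.ext_iff.1 hB u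
      simp only [A, B, Finset.mem_filter, hu, true_and] at ha hb
      rw [ha, ← not_lt, hb, not_lt]
    have top : ∀ {l k i u}, R l k i → u ∈ U → S.pos u < S.pos i → S.pos i ≤ S.reach u → u ≠ l →
        S.depth k ≤ S.depth u := by
      rintro l k i u ⟨-, -, hki, h⟩ hu ha hb hne
      by_contra! hlt
      exact absurd (h u hu ⟨ha, hb, hlt.trans hki.2.2⟩ hne) (not_le.2 hlt)
    have r : R l k i := ⟨h1, h2, h3, h4⟩
    have r' : R l' k' i' := ⟨h1', h2', h3', h4'⟩
    have cl := (hcov l hl).1 ⟨h2.1, h2.2.1⟩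
    have ck := (hcov k hk).1 ⟨h3.1, h3.2.1⟩
    have cl' := (hcov l' hl').2 ⟨h2'.1, h2'.2.1⟩
    have ck' := (hcov k' hk').2 ⟨h3'.1, h3'.2.1⟩
    have hll : l = l' := by
      by_contra hne
      have e1 := top r hl' cl'.1 cl'.2 (Ne.symm hne)
      have e2 := top r' hl cl.1 cl.2 hne
      exact absurd ((h1.trans_le e1).trans (h1'.trans_le e2)) (lt_irrefl _)
    subst hll
    refine ⟨rfl, S.depth_injective (le_antisymm ?_ ?_)⟩
    · exact top r hk' ck'.1 ck'.2 fun e => h1'.ne (by rw [e])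
    · exact top r' hk ck.1 ck.2 fun e => h1.ne (by rw [e])
  set P := pairs U fun l k => S.depth l < S.depth k ∧ ∃ i, S.Hits l i ∧ S.Hits k i ∧
      ∀ u ∈ U, S.Hits u i → u ≠ l → S.depth k ≤ S.depth u
  have hP : ∀ p : P, ∃ i, R p.1.1 p.1.2 i := fun p => by
    obtain ⟨-, h1, i, h2⟩ := mem_pairs.1 p.2
    exact ⟨i, h1, h2⟩
  choose w hw using hP
  have hmono : ∀ i i', S.pos i ≤ S.pos i' → A i ⊆ A i' ∧ B i ⊆ B i' := fun i i' h =>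
    ⟨Finset.monotone_filter_right _ fun u _ hu => lt_of_lt_of_le hu h,
      Finset.monotone_filter_right _ fun u _ hu => lt_of_lt_of_le hu h⟩
  have hinj : ∀ p q : P, S.pos (w p) ≤ S.pos (w q) →
      (A (w p)).card + (B (w p)).card = (A (w q)).card + (B (w q)).card → p = q := by
    intro p q hle hcard
    obtain ⟨hA, hB⟩ := hmono _ _ hle
    have := Finset.card_le_card hA
    have := Finset.card_le_card hB
    have eA := Finset.eq_of_subset_of_card_le hA (by omega)
    have eB := Finset.eq_of_subset_of_card_le hB (by omega)
    have hp := (mem_pairs.1 p.2).1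
    have hq := (mem_pairs.1 q.2).1
    have := hR _ hp.1 _ hp.2 _ hq.1 _ hq.2 _ _ eA eB (hw p) (hw q)
    exact Subtype.ext (Prod.ext this.1 this.2)
  have := Finset.card_le_card_of_injOn (s := P.attach) (t := Finset.range (2 * U.card + 1))
    (fun p => (A (w p)).card + (B (w p)).card) (fun p _ => by
      have := Finset.card_filter_le U fun u => S.pos u < S.pos (w p)
      have := Finset.card_filter_le U fun u => S.reach u < S.pos (w p)
      simp only [Finset.coe_range, Set.mem_Iio, A, B]
      omega) (fun p _ q _ h => by
      rcases le_total (S.pos (w p)) (S.pos (w q)) with hle | hle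
      · exact hinj p q hle h
      · exact (hinj q p hle h.symm).symm)
  simpa using this

/-- Links whose middle member has level at most `k`. -/
theorem card_low_links_le {U : Finset V} {k : ℕ} (hU : ∀ u ∈ U, S.lev u = k) :
    (pairs U fun l j => ∃ i, S.IsLink U l i j ∧ S.lev i ≤ k).card ≤ 3 * U.card := by
  set R : V → V → Prop := fun l j => ∃ i, S.IsLink U l i j ∧ S.lev i ≤ k
  have hkey : ∀ l ∈ U, ∀ j ∈ U, R l j → S.key l = S.key j := by
    rintro l hl j hj ⟨i, h, hi⟩
    have hl' := hU l hl
    have hj' := hU j hj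
    have := S.pos_le_key j
    have := S.pos_le_key l
    have := S.key_le_reach j
    have := S.key_le_reach l
    have := h.left.1
    have := h.left.2.1
    have := h.right.1
    have := h.right.2.1
    rcases lt_trichotomy (S.key l) (S.key j) with hlt | heq | hlt
    · obtain ⟨s, h1, h2, h3⟩ := S.separation l j (hl'.trans hj'.symm) hlt
      by_cases c1 : s ≤ S.reach l
      · have := h3 l (by omega) c1
        omega
      by_cases c2 : s ≤ S.reach i
      · have := h3 i (by omega) c2
        omega
      · have := h3 j (by omega) (by omega)
        omega
    · exact heq
    · obtain ⟨s, h1, h2, h3⟩ := S.separation j l (hj'.trans hl'.symm) hlt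
      have := h3 l (by omega) (by omega)
      omega
  let R₁ : V → V → Prop := fun l j => R l j ∧ ∃ m ∈ U, S.pos j < S.pos m ∧
    ∃ i, S.IsLink U l i m ∧ S.lev i ≤ k ∧ S.pos j ≤ S.pos i
  let R₂ : V → V → Prop := fun l j => R l j ∧ ∃ m ∈ U, S.pos j < S.pos m ∧
    ∃ i, S.IsLink U l i m ∧ S.lev i ≤ k ∧ S.pos i < S.pos j
  have h0 := card_pairs_le_of_not_last S U R
  have h12 := card_pairs_le_add (U := U)
    (R := fun l j => R l j ∧ ∃ j' ∈ U, R l j' ∧ S.pos j < S.pos j') (R₁ := R₁) (R₂ := R₂) (by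
      rintro l _ j _ ⟨h, m, hm, ⟨i, hi, hk⟩, hlt⟩
      rcases le_or_gt (S.pos j) (S.pos i) with hc | hc
      · exact Or.inl ⟨h, m, hm, hlt, i, hi, hk, hc⟩
      · exact Or.inr ⟨h, m, hm, hlt, i, hi, hk, hc⟩)
  have h1 : (pairs U R₁).card ≤ U.card := by
    have aux : ∀ l ∈ U, ∀ l' ∈ U, ∀ j ∈ U, R₁ l j → R₁ l' j → ¬ S.pos l < S.pos l' := by
      rintro l hl l' hl' j hj ⟨hR, m, hm, hjm, i, hi, hik, hji⟩ ⟨⟨i', hi', hik'⟩, -⟩ hlt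
      have k1 := hkey l hl j hj hR
      have k2 := hkey l' hl' j hj ⟨i', hi', hik'⟩
      have k3 := hkey l hl m hm ⟨i, hi, hik⟩
      have := S.pos_le_key j
      have := S.pos_le_key m
      have := S.key_le_reach l
      have := S.key_le_reach l'
      have := hi'.left.1
      have := hi'.right.1
      have := hi.right.1
      have hne : l ≠ l' := fun e => hlt.ne (by rw [e])
      have d1 := hi'.depth_le_of_left hl hne (by omega) (by omega)
      have d2 := hi.depth_le_of_left hl' hne.symm (by omega) (by omega)
      exact absurd (hi'.left.2.2.trans_le (d1.trans (hi.left.2.2.le.trans d2))) (lt_irrefl _)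
    exact card_pairs_le_of_right fun l hl l' hl' j hj h h' => S.pos_injective
      (le_antisymm (not_lt.1 (aux l' hl' l hl j hj h' h)) (not_lt.1 (aux l hl l' hl' j hj h h')))
  have h2 : (pairs U R₂).card ≤ U.card := by
    have aux : ∀ l ∈ U, ∀ l' ∈ U, ∀ j ∈ U, R₂ l j → R₂ l' j → ¬ S.pos l < S.pos l' := by
      rintro l hl l' hl' j hj ⟨⟨i, hi, hik⟩, -⟩ ⟨-, m, hm, hjm, i', hi', hik', hij'⟩ hlt
      have k1 := hkey l hl j hj ⟨i, hi, hik⟩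
      have := S.pos_le_key j
      have := S.key_le_reach l
      have := hi'.left.1
      have := hi'.right.2.1
      have d1 := hi'.depth_le_of_left hl (fun e => hlt.ne (by rw [e])) (by omega) (by omega)
      have d2 := hi'.depth_le_of_right hj (fun e => hjm.ne (by rw [e])) hij' (by omega)
      exact absurd ((hi.left.2.2.trans hi.right.2.2).trans_le (d2.trans d1)) (lt_irrefl _)
    exact card_pairs_le_of_right fun l hl l' hl' j hj h h' => S.pos_injective
      (le_antisymm (not_lt.1 (aux l' hl' l hl j hj h' h)) (not_lt.1 (aux l hl l' hl' j hj h h')))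
  omega

/-- Links whose middle member has level larger than `k` and hits no member of such a level. -/
theorem card_high_links_le {U : Finset V} {k : ℕ} (hU : ∀ u ∈ U, S.lev u = k) :
    (pairs U fun l j => ∃ i, S.IsLink U l i j ∧ k < S.lev i ∧
      ∀ v, S.Hits i v → S.lev v ≤ k).card ≤ 4 * U.card := by
  set G : V → V → V → Prop := fun l i j => S.IsLink U l i j ∧ k < S.lev i ∧
      ∀ v, S.Hits i v → S.lev v ≤ k
  have indep : ∀ {l i j l' i' j'}, G l i j → G l' i' j' → S.pos i < S.pos i' →
      S.pos i' ≤ S.reach i → S.depth i' ≤ S.depth i := by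
    intro l i j l' i' j' h h' h1 h2
    by_contra! h3
    exact absurd (h.2.2 i' ⟨h1, h2, h3⟩) (not_le.2 h'.2.1)
  have exits : ∀ {l i j u}, u ∈ U → G l i j → S.pos u < S.pos i → S.reach u < S.reach i := by
    intro l i j u hu h h1
    by_contra! h2
    have := S.lev_mono i u h1.le h2
    rw [hU u hu] at this
    exact absurd this (not_le.2 h.2.1)
  have cross : ∀ {l i j l' i' j'}, l ∈ U → l ≠ l' → G l i j → G l' i' j' → S.pos l < S.pos i' →
      S.pos i' < S.pos i → False := by
    intro l i j l' i' j' hl hne h h' h1 h2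
    have h3 := h.1.left.2.1
    have d := indep h' h h2 (h3.trans (exits hl h' h1).le)
    have d2 := h'.1.depth_le_of_left hl hne h1 (by omega)
    exact absurd (h.1.left.2.2.trans_le (d.trans d2)) (lt_irrefl _)
  have h0 := card_pairs_le_add (U := U) (R := fun l j => ∃ i, G l i j)
    (R₁ := fun l j => (∃ i, G l i j) ∧ S.pos j ≤ S.reach l)
    (R₂ := fun l j => (∃ i, G l i j) ∧ S.reach l < S.pos j)
    fun l _ j _ h => (le_or_gt (S.pos j) (S.reach l)).imp (⟨h, ·⟩) (⟨h, ·⟩)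
  have h1 : (pairs U fun l j => (∃ i, G l i j) ∧ S.pos j ≤ S.reach l).card ≤ 2 * U.card := by
    refine card_pairs_le_two_mul S ?_
    rintro l hl l' hl' j hj m hm m' hm' hll hjm hjm' ⟨⟨i, h⟩, -⟩ ⟨⟨i₁, h₁⟩, hml⟩ ⟨⟨i', h'⟩, -⟩ -
    have e := exits hl h h.1.left.1
    have := h.1.right.1
    have := h'.1.right.1
    have := h'.1.left.1
    have := h₁.1.left.2.1
    have := h₁.1.right.2.1
    have d := h.1.depth_le_of_right hm (fun e => hjm.ne (by rw [e])) (by omega) (by omega)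
    rcases le_or_gt (S.pos j) (S.pos i₁) with hc | hc
    · exact cross hl (fun e => hll.ne (by rw [e])) h₁ h' (by omega) (by omega)
    · have d2 := h₁.1.depth_le_of_right hj (fun e => hjm.ne (by rw [e])) hc (by omega)
      exact absurd ((h.1.right.2.2.trans_le d2).trans (h₁.1.right.2.2.trans_le d)) (lt_irrefl _)
  have h2 : (pairs U fun l j => (∃ i, G l i j) ∧ S.reach l < S.pos j).card ≤ 2 * U.card := by
    refine card_pairs_le_two_mul S ?_
    rintro l hl l' hl' j hj m hm m' hm' hll hjm hjm' ⟨⟨i, h⟩, -⟩ - ⟨-, hlj⟩ ⟨⟨i', h'⟩, -⟩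
    have := h'.1.left.1
    have := h'.1.left.2.1
    have := h'.1.right.2.1
    have := h.1.right.2.1
    have hne : l ≠ l' := fun e => hll.ne (by rw [e])
    rcases lt_trichotomy (S.pos i) (S.pos i') with hc | hc | hc
    · have d := indep h h' hc (by omega)
      have d2 := h'.1.depth_le_of_right hj (fun e => hjm'.ne (by rw [e])) (by omega) (by omega)
      exact absurd (h.1.right.2.2.trans_le (d2.trans d)) (lt_irrefl _)
    · obtain rfl := S.pos_injective hc
      exact hne (h'.1.left_unique l hl h.1.left)
    · exact cross hl hne h h' (by omega) hc
  exact h0.trans (by omega)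

variable (S) in
/-- Level `k` serves `i` if it is the largest level met by `i` to its right, or `i` meets
nothing to its right and meets a member of level `k` to its left. -/
def Serves (k : ℕ) (i : V) : Prop :=
  (∀ v, S.Hits i v → S.lev v ≤ k) ∧ ((∃ v, S.Hits i v) → ∃ v, S.Hits i v ∧ S.lev v = k) ∧
    ∃ v, (S.Hits i v ∨ S.Hits v i) ∧ S.lev v = k

theorem exists_serves [Finite V] (i : V) (h : ∃ v, S.Hits i v ∨ S.Hits v i) :
    ∃ k, S.Serves k i := by
  classical
  by_cases hr : ∃ v, S.Hits i v
  · obtain ⟨v, hv, hmax⟩ := Set.exists_max_image {v | S.Hits i v} S.lev (Set.toFinite _) hr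
    exact ⟨S.lev v, hmax, fun _ => ⟨v, hv, rfl⟩, v, Or.inl hv, rfl⟩
  · obtain ⟨v, hv⟩ := h
    push Not at hr
    exact ⟨S.lev v, fun u hu => absurd hu (hr u), fun ⟨u, hu⟩ => absurd hu (hr u), v, hv, rfl⟩

theorem exists_sparse_pairs {U : Finset V} {k : ℕ} (hU : ∀ u ∈ U, S.lev u = k) :
    ∃ E : Finset (V × V), E.card ≤ 12 * U.card ∧
      ∀ i, S.Serves k i → ∀ u ∈ U, ∀ v ∈ U, u ≠ v →
        (S.Hits i u ∨ S.Hits u i) → (S.Hits i v ∨ S.Hits v i) →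
        ∃ p ∈ E, p.1 ≠ p.2 ∧ p.1 ∈ U ∧ p.2 ∈ U ∧
          (S.Hits i p.1 ∨ S.Hits p.1 i) ∧ (S.Hits i p.2 ∨ S.Hits p.2 i) := by
  classical
  rcases U.eq_empty_or_nonempty with rfl | hne
  · exact ⟨∅, by simp, by simp⟩
  let R₁ : V → V → Prop := fun j m => S.pos j < S.pos m ∧ ∃ i, S.depth i < S.depth j ∧
    S.depth i < S.depth m ∧
    ∀ w ∈ U, S.pos j < S.pos w → S.pos w < S.pos m → S.depth w ≤ S.depth i
  let R₂ : V → V → Prop := fun l m => S.depth l < S.depth m ∧ ∃ i, S.Hits l i ∧ S.Hits m i ∧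
    ∀ w ∈ U, S.Hits w i → w ≠ l → S.depth m ≤ S.depth w
  let R₃ : V → V → Prop := fun l j => ∃ i, S.IsLink U l i j ∧ S.lev i ≤ k
  let R₄ : V → V → Prop := fun l j => ∃ i, S.IsLink U l i j ∧ k < S.lev i ∧
    ∀ v, S.Hits i v → S.lev v ≤ k
  let E₁ := pairs U R₁
  let E₂ := pairs U R₂
  let E₃ := pairs U R₃
  let E₄ := pairs U R₄
  have c1 : E₁.card ≤ _ := card_horizontal_pairs_le S U
  have c2 : E₂.card ≤ _ := card_vertical_pairs_le S U
  have c3 : E₃.card ≤ _ := card_low_links_le hU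
  have c4 : E₄.card ≤ _ := card_high_links_le hU
  have := hne.card_pos
  refine ⟨E₁ ∪ E₂ ∪ (E₃ ∪ E₄), ?_, ?_⟩
  · have := Finset.card_union_le E₁ E₂
    have := Finset.card_union_le E₃ E₄
    have := Finset.card_union_le (E₁ ∪ E₂) (E₃ ∪ E₄)
    omega
  intro i hi u hu v hv huv hiu hiv
  let P := U.filter fun w => S.Hits i w
  let Q := U.filter fun w => S.Hits w i
  rcases le_or_gt P.card 1 with hP | hP
  · rcases le_or_gt Q.card 1 with hQ | hQ
    · rw [Finset.card_le_one] at hP hQ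
      have link : ∀ {l j}, l ∈ U → j ∈ U → S.Hits l i → S.Hits i j →
          ∃ p ∈ E₁ ∪ E₂ ∪ (E₃ ∪ E₄), p.1 ≠ p.2 ∧ p.1 ∈ U ∧ p.2 ∈ U ∧
          (S.Hits i p.1 ∨ S.Hits p.1 i) ∧ (S.Hits i p.2 ∨ S.Hits p.2 i) := by
        intro l j hl hj hli hij
        have hL : S.IsLink U l i j := ⟨hli, hij,
          fun w hw hwi => hQ w (Finset.mem_filter.2 ⟨hw, hwi⟩) l (Finset.mem_filter.2 ⟨hl, hli⟩),
          fun w hw hwi => hP w (Finset.mem_filter.2 ⟨hw, hwi⟩) j (Finset.mem_filter.2 ⟨hj, hij⟩)⟩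
        refine ⟨(l, j), ?_, ?_, hl, hj, Or.inr hli, Or.inl hij⟩
        · refine Finset.mem_union_right _ ?_
          rcases le_or_gt (S.lev i) k with hk | hk
          · exact Finset.mem_union_left _ (mem_pairs.2 ⟨⟨hl, hj⟩, i, hL, hk⟩)
          · exact Finset.mem_union_right _ (mem_pairs.2 ⟨⟨hl, hj⟩, i, hL, hk, hi.1⟩)
        · rintro (rfl : l = j)
          exact lt_asymm hli.1 hij.1
      rcases hiu with hiu | hiu <;> rcases hiv with hiv | hiv
      · exact absurd (hP u (Finset.mem_filter.2 ⟨hu, hiu⟩) v (Finset.mem_filter.2 ⟨hv, hiv⟩)) huv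
      · exact link hv hu hiv hiu
      · exact link hu hv hiu hiv
      · exact absurd (hQ u (Finset.mem_filter.2 ⟨hu, hiu⟩) v (Finset.mem_filter.2 ⟨hv, hiv⟩)) huv
    · obtain ⟨l, hl, hlmin⟩ := Finset.exists_min_image Q S.depth
        (Finset.card_pos.1 (by omega))
      obtain ⟨m, hm, hmmin⟩ := Finset.exists_min_image (Q.erase l) S.depth
        (Finset.card_pos.1 (by rw [Finset.card_erase_of_mem hl]; omega))
      obtain ⟨hml, hm⟩ := Finset.mem_erase.1 hm
      have hlt : S.depth l < S.depth m :=
        lt_of_le_of_ne (hlmin m hm) fun e => hml (S.depth_injective e.symm)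
      obtain ⟨hlU, hli⟩ := Finset.mem_filter.1 hl
      obtain ⟨hmU, hmi⟩ := Finset.mem_filter.1 hm
      refine ⟨(l, m), ?_, Ne.symm hml, hlU, hmU, Or.inr hli, Or.inr hmi⟩
      refine Finset.mem_union_left _ (Finset.mem_union_right _ (mem_pairs.2
        ⟨⟨hlU, hmU⟩, hlt, i, hli, hmi, fun w hw hwi hwl => hmmin w ?_⟩))
      exact Finset.mem_erase.2 ⟨hwl, Finset.mem_filter.2 ⟨hw, hwi⟩⟩
  · obtain ⟨j, hj, hjmin⟩ := Finset.exists_min_image P S.pos (Finset.card_pos.1 (by omega))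
    obtain ⟨m, hm, hmmin⟩ := Finset.exists_min_image (P.erase j) S.pos
      (Finset.card_pos.1 (by rw [Finset.card_erase_of_mem hj]; omega))
    obtain ⟨hmj, hm⟩ := Finset.mem_erase.1 hm
    have hlt : S.pos j < S.pos m :=
      lt_of_le_of_ne (hjmin m hm) fun e => hmj (S.pos_injective e.symm)
    obtain ⟨hjU, hij⟩ := Finset.mem_filter.1 hj
    obtain ⟨hmU, him⟩ := Finset.mem_filter.1 hm
    refine ⟨(j, m), ?_, Ne.symm hmj, hjU, hmU, Or.inl hij, Or.inl him⟩
    refine Finset.mem_union_left _ (Finset.mem_union_left _ (mem_pairs.2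
      ⟨⟨hjU, hmU⟩, hlt, i, hij.2.2, him.2.2, fun w hw h1 h2 => ?_⟩))
    by_contra! h3
    refine absurd (hmmin w (Finset.mem_erase.2 ⟨fun e => h1.ne (by rw [e]), Finset.mem_filter.2
      ⟨hw, hij.1.trans h1, h2.le.trans him.2.1, h3⟩⟩)) (not_le.2 h2)

end GroundedSystem

/-- Conflict-free coloring of a grounded system with boundedly many levels. -/
theorem GroundedSystem.exists_coloring {V D : Type*} [Fintype V] [LinearOrder D]
    (S : GroundedSystem V D) (K : ℕ) (hK : ∀ i, S.lev i ≤ K) :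
    ∃ col : V → ℕ,
      ((Finset.univ.image col).card : ℝ) ≤ (K + 1) * (98 * Real.log (Fintype.card V) + 1) ∧
      ∀ i, (∃ j, S.Hits i j ∨ S.Hits j i) → ∃ j, (S.Hits i j ∨ S.Hits j i) ∧
        ∀ j', (S.Hits i j' ∨ S.Hits j' i) → j' ≠ j → col j' ≠ col j := by
  classical
  have hlayer := fun k => exists_conflictFree_coloring
    (ι := {i // S.Serves k i}) (fun i v => S.Hits i v ∨ S.Hits v i) 12
    (Finset.univ.filter fun v => S.lev v = k) fun U hU => by
      obtain ⟨E, hE, h⟩ := S.exists_sparse_pairs (U := U) (k := k)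
        fun u hu => (Finset.mem_filter.1 (hU hu)).2
      exact ⟨E, hE, fun i => h i i.2⟩
  choose c hc hcf using hlayer
  set M := ⌊98 * Real.log (Fintype.card V)⌋₊
  have hlog : 0 ≤ 98 * Real.log (Fintype.card V) :=
    mul_nonneg (by norm_num) (Real.log_natCast_nonneg _)
  have hM : ∀ v, c (S.lev v) v ≤ M := fun v => by
    refine Nat.le_floor ((hc (S.lev v) v (by simp)).trans ?_)
    have hpos : 0 < (Finset.univ.filter fun w => S.lev w = S.lev v).card :=
      Finset.card_pos.2 ⟨v, by simp⟩
    have := Real.log_le_log (by exact_mod_cast hpos)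
      (Nat.cast_le (α := ℝ).2 (Finset.card_le_univ (Finset.univ.filter fun w => S.lev w = S.lev v)))
    norm_num
    linarith
  refine ⟨fun v => Nat.pair (S.lev v) (c (S.lev v) v), ?_, ?_⟩
  · have h1 : (Finset.univ.image fun v => Nat.pair (S.lev v) (c (S.lev v) v)) ⊆
        (Finset.range (K + 1) ×ˢ Finset.range (M + 1)).image fun p => Nat.pair p.1 p.2 := by
      intro x hx
      obtain ⟨v, -, rfl⟩ := Finset.mem_image.1 hx
      refine Finset.mem_image.2 ⟨(S.lev v, c (S.lev v) v), ?_, rfl⟩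
      simp [Nat.lt_succ_of_le (hK v), Nat.lt_succ_of_le (hM v)]
    have h2 := (Finset.card_le_card h1).trans Finset.card_image_le
    rw [Finset.card_product, Finset.card_range, Finset.card_range] at h2
    have h3 : (M : ℝ) ≤ 98 * Real.log (Fintype.card V) := Nat.floor_le hlog
    calc _ ≤ (((K + 1) * (M + 1) : ℕ) : ℝ) := by exact_mod_cast h2
      _ ≤ _ := by
        push_cast
        exact mul_le_mul_of_nonneg_left (by linarith) (by positivity)
  · intro i hi
    obtain ⟨k, hk⟩ := S.exists_serves i hi
    obtain ⟨v, hv, hvk⟩ := hk.2.2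
    obtain ⟨j, hj, hij, huniq⟩ := hcf k ⟨i, hk⟩ ⟨v, by simpa using hvk, hv⟩
    have hjk : S.lev j = k := (Finset.mem_filter.1 hj).2
    refine ⟨j, hij, fun j' hij' hne h => ?_⟩
    obtain ⟨h1, h2⟩ := Nat.pair_eq_pair.1 h
    rw [hjk] at h1
    rw [h1, hjk] at h2
    exact huniq j' (by simpa using h1) hij' hne h2

/-- The largest `k ≤ K` such that `[p, q]` contains a multiple of `2 ^ k`. -/
def intervalLevel (K p q : ℕ) : ℕ :=
  Nat.findGreatest (fun k => 1 + (p - 1) / 2 ^ k ≤ q / 2 ^ k) K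

theorem exists_mul_two_pow_iff {k p q : ℕ} (hp : 1 ≤ p) :
    1 + (p - 1) / 2 ^ k ≤ q / 2 ^ k ↔ ∃ t, p ≤ t * 2 ^ k ∧ t * 2 ^ k ≤ q := by
  have h2 : 0 < 2 ^ k := by positivity
  constructor
  · intro h
    refine ⟨q / 2 ^ k, ?_, Nat.div_mul_le_self _ _⟩
    have := (Nat.div_lt_iff_lt_mul h2).1 (show (p - 1) / 2 ^ k < q / 2 ^ k by omega)
    omega
  · rintro ⟨t, h1, h3⟩
    have := (Nat.le_div_iff_mul_le h2).2 h3
    have := (Nat.div_lt_iff_lt_mul h2).2 (show p - 1 < t * 2 ^ k by omega)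
    omega

theorem le_intervalLevel {K p q k t : ℕ} (hp : 1 ≤ p) (hk : k ≤ K) (h1 : p ≤ t * 2 ^ k)
    (h2 : t * 2 ^ k ≤ q) : k ≤ intervalLevel K p q :=
  Nat.le_findGreatest hk ((exists_mul_two_pow_iff hp).2 ⟨t, h1, h2⟩)

theorem exists_mul_two_pow_intervalLevel {K p q : ℕ} (hp : 1 ≤ p) (hpq : p ≤ q) :
    ∃ t, p ≤ t * 2 ^ intervalLevel K p q ∧ t * 2 ^ intervalLevel K p q ≤ q :=
  (exists_mul_two_pow_iff hp).1 (Nat.findGreatest_spec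
    (P := fun k => 1 + (p - 1) / 2 ^ k ≤ q / 2 ^ k) (m := 0) (Nat.zero_le K)
    ((exists_mul_two_pow_iff hp).2 ⟨p, by simp, by simpa using hpq⟩))

/-- The system given by integer positions and reaches in `[1, n]`, with dyadic levels. -/
theorem exists_groundedSystem {V D : Type*} [LinearOrder D] (n : ℕ) (pos reach : V → ℕ)
    (depth : V → D) (hpos : Function.Injective pos) (hdepth : Function.Injective depth)
    (h1 : ∀ i, 1 ≤ pos i) (hle : ∀ i, pos i ≤ reach i) (hn : ∀ i, reach i ≤ n) :
    ∃ S : GroundedSystem V D, S.pos = pos ∧ S.reach = reach ∧ S.depth = depth ∧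
      ∀ i, S.lev i ≤ Nat.log 2 n := by
  set lev : V → ℕ := fun i => intervalLevel (Nat.log 2 n) (pos i) (reach i)
  choose t ht1 ht2 using fun i =>
    exists_mul_two_pow_intervalLevel (K := Nat.log 2 n) (h1 i) (hle i)
  have hlev : ∀ i, lev i ≤ Nat.log 2 n := fun i => Nat.findGreatest_le _
  refine ⟨⟨pos, reach, depth, lev, fun i => t i * 2 ^ lev i, hpos, hdepth, ht1, ht2, ?_, ?_⟩,
    rfl, rfl, rfl, hlev⟩
  · intro i j hp hr
    exact le_intervalLevel (h1 j) (hlev i) (hp.trans (ht1 i)) ((ht2 i).trans hr)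
  · intro i j hij hlt
    rw [hij] at hlt
    have hpow : 0 < 2 ^ lev j := by positivity
    have htt : t i < t j := lt_of_mul_lt_mul_right hlt hpow.le
    obtain ⟨s, hs1, hs2⟩ : ∃ s, t i ≤ 2 * s ∧ 2 * s ≤ t j := ⟨(t i + 1) / 2, by omega, by omega⟩
    refine ⟨2 * s * 2 ^ lev j, by rw [hij]; exact Nat.mul_le_mul_right _ hs1,
      Nat.mul_le_mul_right _ hs2, fun v hv1 hv2 => ?_⟩
    have e : 2 * s * 2 ^ lev j = s * 2 ^ (lev j + 1) := by ring
    rw [e] at hv1 hv2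
    have hs0 : 0 < s := by
      rcases Nat.eq_zero_or_pos s with rfl | h
      · have := h1 v
        omega
      · exact h
    have hbound : lev j + 1 ≤ Nat.log 2 n := by
      refine Nat.le_log_of_pow_le (by norm_num) ?_
      exact (Nat.le_mul_of_pos_left _ hs0).trans (hv2.trans (hn v))
    rw [hij]
    exact le_intervalLevel (h1 v) hbound hv1 hv2

theorem mem_LShape {x y w h : ℝ} (hw : 0 < w) (hh : 0 < h) (p : Pt) :
    p ∈ LShape x y w h ↔
      (p.2 = y ∧ x ≤ p.1 ∧ p.1 ≤ x + w) ∨ (p.1 = x ∧ y ≤ p.2 ∧ p.2 ≤ y + h) := by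
  obtain ⟨a, b⟩ := p
  have e1 : segment ℝ (x, y) (x + w, y) = Icc x (x + w) ×ˢ {y} := by
    rw [← Prod.image_mk_segment_left, segment_eq_Icc (by linarith)]
    ext ⟨u, v⟩
    simp [eq_comm]
  have e2 : segment ℝ (x, y) (x, y + h) = {x} ×ˢ Icc y (y + h) := by
    rw [← Prod.image_mk_segment_right, segment_eq_Icc (by linarith)]
    ext ⟨u, v⟩
    simp [eq_comm, and_comm, and_assoc]
  rw [LShape, e1, e2]
  simp only [mem_union, mem_prod, mem_Icc, mem_singleton_iff]
  tauto

/-- Two grounded L-shapes intersect iff the left one reaches the right one and is not deeper. -/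
theorem LShape_inter_nonempty_iff {x y w h x' y' w' h' : ℝ} (hw : 0 < w) (hh : 0 < h)
    (hw' : 0 < w') (hh' : 0 < h') (htop : y + h = y' + h') (hx : x < x') :
    (LShape x y w h ∩ LShape x' y' w' h').Nonempty ↔ x' ≤ x + w ∧ h ≤ h' := by
  constructor
  · rintro ⟨p, hp, hp'⟩
    rw [mem_LShape hw hh] at hp
    rw [mem_LShape hw' hh'] at hp'
    rcases hp with hp | hp <;> rcases hp' with hp' | hp' <;> constructor <;> linarith
  · rintro ⟨h1, h2⟩
    refine ⟨(x', y), (mem_LShape hw hh _).2 (Or.inl ⟨rfl, hx.le, h1⟩),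
      (mem_LShape hw' hh' _).2 (Or.inr ⟨rfl, ?_, ?_⟩)⟩ <;> dsimp only <;> linarith

theorem ne_of_LShape_inter_subsingleton {x y w h x' y' w' h' : ℝ} (hw : 0 < w) (hh : 0 < h)
    (hw' : 0 < w') (hh' : 0 < h') (htop : y + h = y' + h')
    (hs : (LShape x y w h ∩ LShape x' y' w' h').Subsingleton) : x ≠ x' := by
  rintro rfl
  have hm : ∀ b, y ≤ b → y' ≤ b → b ≤ y + h → (x, b) ∈ LShape x y w h ∩ LShape x y' w' h' :=
    fun b h1 h2 h3 => ⟨(mem_LShape hw hh _).2 (Or.inr ⟨rfl, h1, h3⟩),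
      (mem_LShape hw' hh' _).2 (Or.inr ⟨rfl, h2, h3.trans_eq htop⟩)⟩
  have := hs (hm (y + h) (by linarith) (by linarith) le_rfl)
    (hm (max y y') (le_max_left _ _) (le_max_right _ _) (max_le (by linarith) (by linarith)))
  have := congrArg Prod.snd this
  rcases max_cases y y' with h1 | h1 <;> simp only at this <;> linarith

open Classical in
/-- The number of values of `x` that are at most `s`. -/
noncomputable def rankOf {n : ℕ} (x : Fin n → ℝ) (s : ℝ) : ℕ :=
  (Finset.univ.filter fun j => x j ≤ s).card

theorem rankOf_mono {n : ℕ} (x : Fin n → ℝ) : Monotone (rankOf x) := fun _ _ h =>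
  Finset.card_le_card (Finset.monotone_filter_right _ fun _ _ hj => le_trans hj h)

theorem rankOf_le_iff {n : ℕ} (x : Fin n → ℝ) (j : Fin n) (s : ℝ) :
    rankOf x (x j) ≤ rankOf x s ↔ x j ≤ s := by
  refine ⟨fun h => ?_, fun h => rankOf_mono x h⟩
  by_contra! hlt
  refine absurd h (not_le.2 (Finset.card_lt_card ?_))
  refine Finset.ssubset_iff_subset_ne.2
    ⟨Finset.monotone_filter_right _ fun _ _ hj => le_trans hj hlt.le, fun e => ?_⟩
  have := (Finset.ext_iff.1 e j).2 (by simp)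
  simp only [Finset.mem_filter, Finset.mem_univ, true_and] at this
  linarith

theorem one_le_rankOf {n : ℕ} (x : Fin n → ℝ) (j : Fin n) : 1 ≤ rankOf x (x j) :=
  Finset.card_pos.2 ⟨j, by simp⟩

theorem rankOf_le {n : ℕ} (x : Fin n → ℝ) (s : ℝ) : rankOf x s ≤ n :=
  (Finset.card_le_univ _).trans_eq (Fintype.card_fin n)

theorem stmt7 :
    ∃ A : ℝ, 0 < A ∧
      ∀ (n : ℕ), 2 ≤ n →
        ∀ x y w h : Fin n → ℝ,
          (∀ i, 0 < w i) → (∀ i, 0 < h i) →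
          -- the family is grounded: one horizontal line contains all top endpoints
          (∀ i j : Fin n, y i + h i = y j + h j) →
          -- no two members have overlapping segments, so any two of them intersect in
          -- at most one point
          (∀ i j : Fin n, i ≠ j →
            (LShape (x i) (y i) (w i) (h i) ∩ LShape (x j) (y j) (w j) (h j)).Subsingleton) →
          ∃ col : Fin n → ℕ,
            -- at most `A·(log n)²` colors are used
            ((Finset.univ.image col).card : ℝ) ≤ A * (Real.log n) ^ 2 ∧
            -- the coloring is conflict-free: every L-shape with a nonempty neighborhood
            -- has a uniquely colored L-shape among the L-shapes intersecting it
            ∀ i : Fin n,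
              (∃ j : Fin n, j ≠ i ∧
                (LShape (x j) (y j) (w j) (h j) ∩ LShape (x i) (y i) (w i) (h i)).Nonempty) →
              ∃ j : Fin n, j ≠ i ∧
                (LShape (x j) (y j) (w j) (h j) ∩ LShape (x i) (y i) (w i) (h i)).Nonempty ∧
                ∀ j' : Fin n, j' ≠ i →
                  (LShape (x j') (y j') (w j') (h j') ∩
                    LShape (x i) (y i) (w i) (h i)).Nonempty →
                  j' ≠ j → col j' ≠ col j := by
  refine ⟨800, by norm_num, fun n hn x y w h hw hh htop hsub => ?_⟩
  have hxinj : Function.Injective x := fun i j hij => by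
    by_contra hne
    exact ne_of_LShape_inter_subsingleton (hw i) (hh i) (hw j) (hh j) (htop i j)
      (hsub i j hne) hij
  obtain ⟨S, hSp, hSr, hSd, hK⟩ := exists_groundedSystem n (fun i => rankOf x (x i))
    (fun i => rankOf x (x i + w i)) (fun i => toLex (h i, x i))
    (fun i j hij => hxinj (le_antisymm ((rankOf_le_iff x i _).1 (le_of_eq hij))
      ((rankOf_le_iff x j _).1 (ge_of_eq hij))))
    (fun i j hij => hxinj (congrArg (fun p => (ofLex p).2) hij))
    (one_le_rankOf x) (fun i => rankOf_mono x (by linarith [hw i])) fun i => rankOf_le x _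
  have hhits : ∀ i j, S.Hits i j ↔ x i < x j ∧
      (LShape (x i) (y i) (w i) (h i) ∩ LShape (x j) (y j) (w j) (h j)).Nonempty := by
    intro i j
    rw [GroundedSystem.Hits, hSp, hSr, hSd]
    dsimp only
    rw [← not_le, rankOf_le_iff, rankOf_le_iff, not_le, Prod.Lex.toLex_lt_toLex]
    refine and_congr_right fun hx => ?_
    rw [LShape_inter_nonempty_iff (hw i) (hh i) (hw j) (hh j) (htop i j) hx,
      le_iff_lt_or_eq (b := h j)]
    simp [hx]
  have hadj : ∀ i j, (S.Hits i j ∨ S.Hits j i) ↔ j ≠ i ∧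
      (LShape (x j) (y j) (w j) (h j) ∩ LShape (x i) (y i) (w i) (h i)).Nonempty := by
    intro i j
    rw [hhits, hhits, inter_comm (LShape (x i) _ _ _), ← or_and_right, ← ne_iff_lt_or_gt,
      hxinj.ne_iff, ne_comm]
  obtain ⟨col, hcol, hcf⟩ := S.exists_coloring _ hK
  refine ⟨col, hcol.trans ?_, fun i hi => ?_⟩
  · rw [Fintype.card_fin]
    have hn' : (2 : ℝ) ≤ n := by exact_mod_cast hn
    have hl2 := Real.log_two_gt_d9
    have hln : Real.log 2 ≤ Real.log n := Real.log_le_log (by norm_num) hn'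
    have h1 : (Nat.log 2 n : ℝ) * Real.log 2 ≤ Real.log n := by
      rw [← Real.log_pow]
      exact Real.log_le_log (by positivity) (by exact_mod_cast Nat.pow_log_le_self 2 (by omega))
    have h2 : (Nat.log 2 n : ℝ) ≤ 2 * Real.log n := by
      nlinarith [Nat.cast_nonneg (α := ℝ) (Nat.log 2 n)]
    have h3 : (1 : ℝ) ≤ 2 * Real.log n := by linarith
    nlinarith
  · obtain ⟨j₀, hj₀⟩ := hi
    obtain ⟨j, hj, huniq⟩ := hcf i ⟨j₀, (hadj i j₀).2 hj₀⟩
    obtain ⟨hne, hint⟩ := (hadj i j).1 hj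
    exact ⟨j, hne, hint, fun j' hne' hint' => huniq j' ((hadj i j').2 ⟨hne', hint'⟩)⟩
end

section
/- Let n ≥ 1 and let a_1, …, a_n and b_1, …, b_n be two sequences (over arbitrary alphabets) such that there is no index j with 1 ≤ j ≤ n − 1 for which both a_j = a_{j+1} and b_j = b_{j+1}. Then at least one of the two sequences contains a subsequence of length at least ⌈(n+1)/2⌉ in which every element is different from the element preceding it in the subsequence. -/
/-- `f 0, …, f k` has a subsequence of length `l + 1`, ending with the value `f k`, in which every
element differs from its predecessor. -/
def HasAlternatingSubseq {α : Type*} (f : ℕ → α) (k l : ℕ) : Prop :=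
  ∃ i : ℕ → ℕ, (∀ t < l, i t < i (t + 1) ∧ f (i t) ≠ f (i (t + 1))) ∧ i l ≤ k ∧ f (i l) = f k

namespace HasAlternatingSubseq

variable {α β : Type*}

lemma succ_of_eq {f : ℕ → α} {k l : ℕ} (h : HasAlternatingSubseq f k l)
    (hf : f k = f (k + 1)) : HasAlternatingSubseq f (k + 1) l := by
  obtain ⟨i, hi, hle, hlast⟩ := h
  exact ⟨i, hi, by omega, hlast.trans hf⟩

lemma succ_of_ne {f : ℕ → α} {k l : ℕ} (h : HasAlternatingSubseq f k l)
    (hf : f k ≠ f (k + 1)) : HasAlternatingSubseq f (k + 1) (l + 1) := by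
  obtain ⟨i, hi, hle, hlast⟩ := h
  refine ⟨fun t => if t ≤ l then i t else k + 1, fun t ht => ?_, by simp, by simp⟩
  rcases Nat.lt_succ_iff_lt_or_eq.mp ht with ht | rfl
  · simpa [ht.le, Nat.succ_le_of_lt ht] using hi t ht
  · simpa [hlast, hf] using Nat.lt_succ_of_le hle

lemma exists_add_ge (f : ℕ → α) (g : ℕ → β) (k : ℕ)
    (h : ∀ j < k, ¬ (f j = f (j + 1) ∧ g j = g (j + 1))) :
    ∃ l m, k ≤ l + m ∧ HasAlternatingSubseq f k l ∧ HasAlternatingSubseq g k m := by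
  induction k with
  | zero => exact ⟨0, 0, le_rfl, ⟨id, by simp⟩, ⟨id, by simp⟩⟩
  | succ k ih =>
    obtain ⟨l, m, hk, hl, hm⟩ := ih fun j hj => h j (by omega)
    by_cases hf : f k = f (k + 1)
    · have hg : g k ≠ g (k + 1) := fun hg => h k (by omega) ⟨hf, hg⟩
      exact ⟨l, m + 1, by omega, hl.succ_of_eq hf, hm.succ_of_ne hg⟩
    · by_cases hg : g k = g (k + 1)
      · exact ⟨l + 1, m, by omega, hl.succ_of_ne hf, hm.succ_of_eq hg⟩
      · exact ⟨l + 1, m + 1, by omega, hl.succ_of_ne hf, hm.succ_of_ne hg⟩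

lemma exists_strictMono {k l : ℕ} {a : Fin (k + 1) → α}
    (h : HasAlternatingSubseq (fun i => a (Fin.ofNat (k + 1) i)) k l) :
    ∃ ι : Fin (l + 1) → Fin (k + 1), StrictMono ι ∧
      ∀ (t : ℕ) (ht : t + 1 < l + 1),
        a (ι ⟨t, Nat.lt_of_succ_lt ht⟩) ≠ a (ι ⟨t + 1, ht⟩) := by
  obtain ⟨i, hi, hle, -⟩ := h
  have hmono : StrictMono fun t : Fin (l + 1) => i t :=
    Fin.strictMono_iff_lt_succ.mpr fun t => (hi t t.isLt).1
  have hlt (t : Fin (l + 1)) : i t < k + 1 :=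
    Nat.lt_succ_of_le ((hmono.monotone (Fin.le_last t)).trans hle)
  refine ⟨fun t => Fin.ofNat (k + 1) (i t), fun s t hst => ?_, fun t ht => (hi t (by omega)).2⟩
  simpa [Fin.lt_def, Nat.mod_eq_of_lt, hlt] using hmono hst

end HasAlternatingSubseq


theorem stmt8 {α β : Type*} (n : ℕ) (hn : 1 ≤ n) (a : Fin n → α) (b : Fin n → β)
    -- there is no index `j` for which both `a j = a (j+1)` and `b j = b (j+1)`
    (h : ∀ (j : ℕ) (hj : j + 1 < n),
      ¬ (a ⟨j, Nat.lt_of_succ_lt hj⟩ = a ⟨j + 1, hj⟩ ∧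
         b ⟨j, Nat.lt_of_succ_lt hj⟩ = b ⟨j + 1, hj⟩)) :
    -- one of the sequences has a subsequence of length at least `⌈(n+1)/2⌉` in which
    -- every element is different from its preceding element
    (∃ (m : ℕ) (ι : Fin m → Fin n), StrictMono ι ∧ (n + 2) / 2 ≤ m ∧
      ∀ (t : ℕ) (ht : t + 1 < m),
        a (ι ⟨t, Nat.lt_of_succ_lt ht⟩) ≠ a (ι ⟨t + 1, ht⟩)) ∨
    (∃ (m : ℕ) (ι : Fin m → Fin n), StrictMono ι ∧ (n + 2) / 2 ≤ m ∧
      ∀ (t : ℕ) (ht : t + 1 < m),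
        b (ι ⟨t, Nat.lt_of_succ_lt ht⟩) ≠ b (ι ⟨t + 1, ht⟩)) := by
  obtain ⟨k, rfl⟩ : ∃ k, n = k + 1 := ⟨n - 1, by omega⟩
  obtain ⟨l, m, hk, hl, hm⟩ := HasAlternatingSubseq.exists_add_ge
    (fun i => a (Fin.ofNat (k + 1) i)) (fun i => b (Fin.ofNat (k + 1) i)) k fun j hj => by
      have hj' : j < k + 1 := by omega
      simpa [Fin.ofNat, Nat.mod_eq_of_lt, hj, hj'] using h j (by omega)
  obtain ⟨ι, hι, ha⟩ := hl.exists_strictMono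
  obtain ⟨κ, hκ, hb⟩ := hm.exists_strictMono
  rcases le_total l m with hlm | hlm
  · exact Or.inr ⟨m + 1, κ, hκ, by omega, hb⟩
  · exact Or.inl ⟨l + 1, ι, hι, by omega, ha⟩
end

section
/- Let H = (V, E) be a hypergraph on n vertices and suppose there exists a constant c ≥ 0 such that for every V' ⊆ V the Delaunay graph of the sub-hypergraph of H induced by V' has at most c|V'| edges. Let d ≥ 1 be the VC-dimension of H. Then there exists a constant A depending only on c such that for every integer k ≥ 2 the number of hyperedges of H of size at most k is at most A·k^{d−1}·n. -/
/-- The number of edges of the Delaunay graph of the sub-hypergraph of `(V, E)` induced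
by `V'`: the number of distinct nonempty sets `h ∩ V'` (for `h ∈ E`) of size two. -/
def delaunayEdgeCount {V : Type*} [DecidableEq V] (E : Finset (Finset V))
    (V' : Finset V) : ℕ :=
  ((E.image (· ∩ V')).filter (fun h => h.card = 2)).card

/-- `V'` is shattered: for every `V'' ⊆ V'` there is a hyperedge `h ∈ E` with
`h ∩ V' = V''`. -/
def Shattered {V : Type*} [DecidableEq V] (E : Finset (Finset V)) (V' : Finset V) : Prop :=
  ∀ V'' ⊆ V', ∃ h ∈ E, h ∩ V' = V''

open Finset

/-- The Bernoulli weight `p ^ |t| * (1 - p) ^ |W \ t|` summed over all `t ⊆ W` that contain `A`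
and avoid `B`. -/
theorem sum_bernoulli_weight {V : Type*} [DecidableEq V] (p : ℝ) {W A B : Finset V}
    (hA : A ⊆ W) (hB : B ⊆ W) (hAB : Disjoint A B) :
    ∑ t ∈ W.powerset with A ⊆ t ∧ Disjoint t B, p ^ #t * (1 - p) ^ #(W \ t)
      = p ^ #A * (1 - p) ^ #B := by
  have key := prod_add (fun i => if i ∈ B then 0 else p) (fun i => if i ∈ A then 0 else 1 - p) W
  have hprod : ∏ i ∈ W, ((if i ∈ B then 0 else p) + (if i ∈ A then 0 else 1 - p))
      = p ^ #A * (1 - p) ^ #B := by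
    have h : ∀ i ∈ W, ((if i ∈ B then 0 else p) + (if i ∈ A then 0 else 1 - p))
        = (if i ∈ A then p else 1) * (if i ∈ B then 1 - p else 1) := by
      intro i _
      have : i ∈ A → i ∉ B := fun h => Finset.disjoint_left.mp hAB h
      by_cases h1 : i ∈ A <;> by_cases h2 : i ∈ B <;> simp_all
    rw [prod_congr rfl h, prod_mul_distrib, prod_ite_mem, prod_ite_mem,
      inter_eq_right.mpr hA, inter_eq_right.mpr hB, prod_const, prod_const]
  rw [← hprod, key, sum_filter]
  refine sum_congr rfl fun t ht => ?_
  have htW := mem_powerset.mp ht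
  split_ifs with h
  · congr 1
    · rw [← prod_const]
      exact prod_congr rfl fun i hi => (if_neg (Finset.disjoint_left.mp h.2 hi)).symm
    · rw [← prod_const]
      exact prod_congr rfl fun i hi =>
        (if_neg fun hiA => (mem_sdiff.mp hi).2 (h.1 hiA)).symm
  · rw [eq_comm, mul_eq_zero]
    by_cases hAt : A ⊆ t
    · left
      obtain ⟨i, hit, hiB⟩ := Finset.not_disjoint_iff.mp fun hd => h ⟨hAt, hd⟩
      exact prod_eq_zero hit (if_pos hiB)
    · right
      obtain ⟨i, hiA, hit⟩ := Finset.not_subset.mp hAt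
      exact prod_eq_zero (mem_sdiff.mpr ⟨hA hiA, hit⟩) (if_pos hiA)

theorem sum_bernoulli_weight_mul_card {V : Type*} [DecidableEq V] (p : ℝ) (W : Finset V) :
    ∑ t ∈ W.powerset, p ^ #t * (1 - p) ^ #(W \ t) * #t = p * #W := by
  calc ∑ t ∈ W.powerset, p ^ #t * (1 - p) ^ #(W \ t) * #t
      = ∑ t ∈ W.powerset, ∑ v ∈ W, if v ∈ t then p ^ #t * (1 - p) ^ #(W \ t) else 0 := by
        refine sum_congr rfl fun t ht => ?_
        rw [sum_ite_mem, inter_eq_right.mpr (mem_powerset.mp ht), sum_const, nsmul_eq_mul,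
          mul_comm]
    _ = ∑ v ∈ W, p := by
        rw [sum_comm]
        refine sum_congr rfl fun v hv => ?_
        have := sum_bernoulli_weight p (singleton_subset_iff.mpr hv) (empty_subset W)
          (disjoint_empty_right _)
        simpa [sum_filter] using this
    _ = p * #W := by rw [sum_const, nsmul_eq_mul, mul_comm]

theorem delaunayEdgeCount_mono {V : Type*} [DecidableEq V] {E F : Finset (Finset V)}
    (h : F ⊆ E) (W : Finset V) : delaunayEdgeCount F W ≤ delaunayEdgeCount E W :=
  card_le_card (filter_subset_filter _ (image_subset_image h))

open Classical in
/-- A Clarkson–Shor bound: if all hyperedges have size at most `k`, then linearly sized Delaunay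
graphs force few pairs to be covered by hyperedges. -/
theorem card_covered_pairs_le {V : Type*} [DecidableEq V] {F : Finset (Finset V)} {c : ℝ}
    {k : ℕ} (hk : 1 ≤ k) (hF : ∀ h ∈ F, #h ≤ k)
    (hdel : ∀ W : Finset V, (delaunayEdgeCount F W : ℝ) ≤ c * #W) (W : Finset V) :
    (#{e ∈ W.powersetCard 2 | ∃ h ∈ F, e ⊆ h} : ℝ) ≤ 4 * c * k * #W := by
  set P := {e ∈ W.powersetCard 2 | ∃ h ∈ F, e ⊆ h} with hP
  have hk0 : (1 : ℝ) ≤ k := by exact_mod_cast hk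
  obtain ⟨p, hp⟩ : ∃ p : ℝ, p = 1 / (2 * k) := ⟨_, rfl⟩
  have hp0 : 0 < p := by rw [hp]; positivity
  have hpk : k * p = 1 / 2 := by rw [hp]; field_simp
  have hp1 : p ≤ 1 / 2 := by nlinarith
  let w : Finset V → ℝ := fun t => p ^ #t * (1 - p) ^ #(W \ t)
  have hw : ∀ t, 0 ≤ w t := fun t =>
    mul_nonneg (pow_nonneg hp0.le _) (pow_nonneg (by linarith) _)
  have hupper : ∑ t ∈ W.powerset, w t * delaunayEdgeCount F t ≤ c * (p * #W) := by
    rw [← sum_bernoulli_weight_mul_card, mul_sum]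
    refine sum_le_sum fun t _ => ?_
    calc w t * delaunayEdgeCount F t ≤ w t * (c * #t) :=
          mul_le_mul_of_nonneg_left (hdel t) (hw t)
      _ = c * (p ^ #t * (1 - p) ^ #(W \ t) * #t) := by ring
  have hlower : #P * (p ^ 2 * (1 / 2)) ≤ ∑ t ∈ W.powerset, w t * delaunayEdgeCount F t := by
    calc #P * (p ^ 2 * (1 / 2)) = ∑ e ∈ P, p ^ 2 * (1 / 2) := by
          rw [sum_const, nsmul_eq_mul]
      _ ≤ ∑ e ∈ P, ∑ t ∈ W.powerset, if ∃ h ∈ F, h ∩ t = e then w t else 0 := by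
          refine sum_le_sum fun e he => ?_
          obtain ⟨heW, h, hhF, heh⟩ := mem_filter.mp he
          obtain ⟨heW, he2⟩ := mem_powersetCard.mp heW
          have hsum := sum_bernoulli_weight p (B := (h \ e) ∩ W) heW inter_subset_right
            (disjoint_of_subset_right inter_subset_left disjoint_sdiff)
          have hB : #((h \ e) ∩ W) ≤ k :=
            (card_le_card (inter_subset_left.trans sdiff_subset)).trans (hF h hhF)
          have hbern : 1 / 2 ≤ (1 - p) ^ #((h \ e) ∩ W) := by
            refine le_trans ?_ (pow_le_pow_of_le_one (by linarith) (by linarith) hB)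
            have := one_add_mul_le_pow (a := -p) (by linarith) k
            rw [← sub_eq_add_neg] at this
            linarith
          calc p ^ 2 * (1 / 2) ≤ p ^ #e * (1 - p) ^ #((h \ e) ∩ W) := by
                rw [he2]; gcongr
            _ = _ := hsum.symm
            _ ≤ _ := by
                rw [sum_filter]
                refine sum_le_sum fun t ht => ?_
                split_ifs with h1 h2
                · exact le_rfl
                · refine absurd ⟨h, hhF, ?_⟩ h2
                  ext x
                  have h3 : x ∈ t → x ∉ (h \ e) ∩ W := fun hx => Finset.disjoint_left.mp h1.2 hx
                  have h4 := @heh x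
                  have h5 := @h1.1 x
                  have h6 : x ∈ t → x ∈ W := fun hx => mem_powerset.mp ht hx
                  simp only [mem_inter, mem_sdiff] at *
                  tauto
                · exact hw t
                · exact le_rfl
      _ = ∑ t ∈ W.powerset, w t * #{e ∈ P | ∃ h ∈ F, h ∩ t = e} := by
          rw [sum_comm]
          refine sum_congr rfl fun t _ => ?_
          rw [← sum_filter, sum_const, nsmul_eq_mul, mul_comm]
      _ ≤ _ := by
          refine sum_le_sum fun t _ => mul_le_mul_of_nonneg_left ?_ (hw t)
          refine Nat.cast_le.mpr (card_le_card fun e he => ?_)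
          obtain ⟨heP, h, hhF, hht⟩ := mem_filter.mp he
          exact mem_filter.mpr ⟨mem_image.mpr ⟨h, hhF, hht⟩,
            (mem_powersetCard.mp (mem_filter.mp heP).1).2⟩
  have h := hlower.trans hupper
  have h1 : p * (#P * p) ≤ p * (2 * c * #W) := by linarith
  have h2 := le_of_mul_le_mul_left h1 hp0
  have h3 : 2 * k * (#P * p) ≤ 2 * k * (2 * c * #W) :=
    mul_le_mul_of_nonneg_left h2 (by positivity)
  calc (#P : ℝ) = 2 * k * (#P * p) := by linear_combination (-2 * (#P : ℝ)) * hpk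
    _ ≤ _ := h3
    _ = _ := by ring

/-- The graph joining two vertices when some hyperedge contains both. -/
def coverGraph {V : Type*} (F : Finset (Finset V)) : SimpleGraph V where
  Adj x y := x ≠ y ∧ ∃ h ∈ F, x ∈ h ∧ y ∈ h
  symm := ⟨fun _ _ ⟨hne, h, hF, hx, hy⟩ => ⟨hne.symm, h, hF, hy, hx⟩⟩
  loopless := ⟨fun _ h => h.1 rfl⟩

open Classical in
theorem exists_coverGraph_degree_le {V : Type*} [DecidableEq V] {F : Finset (Finset V)} {c : ℝ}
    {k : ℕ} (hk : 1 ≤ k) (hF : ∀ h ∈ F, #h ≤ k)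
    (hdel : ∀ W : Finset V, (delaunayEdgeCount F W : ℝ) ≤ c * #W) {W : Finset V}
    (hW : W.Nonempty) : ∃ v ∈ W, (#{u ∈ W | (coverGraph F).Adj v u} : ℝ) ≤ 8 * c * k := by
  by_contra! hlt
  set P := {e ∈ W.powersetCard 2 | ∃ h ∈ F, e ⊆ h} with hP
  have hdeg : ∀ v ∈ W, #{u ∈ W | (coverGraph F).Adj v u} ≤ #{e ∈ P | v ∈ e} := by
    intro v hv
    refine card_le_card_of_injOn (fun u => {v, u}) (fun u hu => ?_) fun u hu u' hu' he => ?_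
    · obtain ⟨huW, hne, h, hhF, hvh, huh⟩ := mem_filter.mp hu
      simp only [hP, coe_filter, Set.mem_ofPred_eq, mem_filter, mem_powersetCard]
      refine ⟨⟨⟨?_, card_pair hne⟩, h, hhF, ?_⟩, mem_insert_self _ _⟩ <;>
        simp [insert_subset_iff, *]
    · have hne := (mem_filter.mp hu).2.1
      have h1 : u ∈ ({v, u'} : Finset V) := by
        rw [← show ({v, u} : Finset V) = {v, u'} from he]; simp
      rcases mem_insert.mp h1 with h2 | h2
      · exact absurd h2.symm hne
      · exact mem_singleton.mp h2
  have hcount : ∑ v ∈ W, #{e ∈ P | v ∈ e} = #P * 2 := by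
    have h := sum_card_bipartiteAbove_eq_sum_card_bipartiteBelow (s := W) (t := P)
      (fun v e => v ∈ e)
    simp only [bipartiteAbove, bipartiteBelow] at h
    rw [h, ← smul_eq_mul, ← sum_const]
    refine sum_congr rfl fun e he => ?_
    obtain ⟨heW, he2⟩ := mem_powersetCard.mp (mem_filter.mp he).1
    rw [filter_mem_eq_inter, inter_eq_right.mpr heW, he2]
  have h1 : ∑ v ∈ W, 8 * c * k < ∑ v ∈ W, (#{e ∈ P | v ∈ e} : ℝ) :=
    sum_lt_sum_of_nonempty hW fun v hv =>
      (hlt v hv).trans_le (Nat.cast_le.mpr (hdeg v hv))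
  rw [sum_const, nsmul_eq_mul, ← Nat.cast_sum, hcount] at h1
  have h2 : (#P : ℝ) ≤ _ := card_covered_pairs_le hk hF hdel W
  push_cast at h1
  linarith

open Classical in
/-- A graph in which every vertex set induces a vertex of degree at most `D` has at most `D ^ j`
cliques of size `j + 1` per vertex. -/
theorem card_cliques_le_of_degenerate {V : Type*} [DecidableEq V] (G : SimpleGraph V) {D : ℝ}
    (hG : ∀ W : Finset V, W.Nonempty → ∃ v ∈ W, (#{u ∈ W | G.Adj v u} : ℝ) ≤ D) (j : ℕ)
    (W : Finset V) :
    (#((W.powersetCard (j + 1)).filter fun S : Finset V => G.IsClique (S : Set V)) : ℝ) ≤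
      D ^ j * #W := by
  induction W using Finset.strongInduction with
  | H W ih =>
    rcases W.eq_empty_or_nonempty with rfl | hW
    · simp
    obtain ⟨v, hv, hdeg⟩ := hG W hW
    have hsub : ((W.powersetCard (j + 1)).filter fun S : Finset V => G.IsClique (S : Set V)) ⊆
        (((W.erase v).powersetCard (j + 1)).filter fun S : Finset V => G.IsClique (S : Set V)) ∪
          (powersetCard j {u ∈ W | G.Adj v u}).image (insert v) := by
      intro S hS
      obtain ⟨hS, hcl⟩ := mem_filter.mp hS
      obtain ⟨hSW, hcard⟩ := mem_powersetCard.mp hS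
      rw [mem_union]
      by_cases hvS : v ∈ S
      · right
        refine mem_image.mpr ⟨S.erase v, mem_powersetCard.mpr ⟨fun u hu => ?_, ?_⟩,
          insert_erase hvS⟩
        · obtain ⟨hne, huS⟩ := mem_erase.mp hu
          exact mem_filter.mpr ⟨hSW huS, hcl hvS huS hne.symm⟩
        · rw [card_erase_of_mem hvS, hcard, Nat.add_sub_cancel]
      · left
        exact mem_filter.mpr ⟨mem_powersetCard.mpr ⟨subset_erase.mpr ⟨hSW, hvS⟩, hcard⟩, hcl⟩
    have hN : #((powersetCard j {u ∈ W | G.Adj v u}).image (insert v))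
        ≤ #{u ∈ W | G.Adj v u} ^ j := by
      refine card_image_le.trans ?_
      rw [card_powersetCard]
      exact Nat.choose_le_pow _ _
    have hle := (card_le_card hsub).trans ((card_union_le _ _).trans (Nat.add_le_add_left hN _))
    have hpow : ((#{u ∈ W | G.Adj v u} : ℕ) : ℝ) ^ j ≤ D ^ j := by gcongr
    have hcard : (#W : ℝ) = #(W.erase v) + 1 := by
      exact_mod_cast (card_erase_add_one hv).symm
    have hih := ih (W.erase v) (erase_ssubset hv)
    have hle' := (Nat.cast_le (α := ℝ)).mpr hle
    push_cast at hle'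
    rw [hcard, mul_add, mul_one]
    linarith

theorem isClique_coverGraph_of_shatters {V : Type*} [DecidableEq V] {F : Finset (Finset V)}
    {S : Finset V} (hS : F.Shatters S) : (coverGraph F).IsClique (S : Set V) := by
  intro x hx y hy hne
  obtain ⟨h, hh, hSh⟩ := hS.exists_superset
  exact ⟨hne, h, hh, hSh hx, hSh hy⟩

theorem card_le_of_shattered {V : Type*} [DecidableEq V] {E : Finset (Finset V)} {c : ℝ}
    {S : Finset V} (hdel : (delaunayEdgeCount E S : ℝ) ≤ c * #S) (hS : Shattered E S)
    (hS0 : S.Nonempty) : (#S : ℝ) ≤ 2 * c + 1 := by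
  have h : #(S.powersetCard 2) ≤ delaunayEdgeCount E S := by
    refine card_le_card fun e he => ?_
    obtain ⟨heS, he2⟩ := mem_powersetCard.mp he
    exact mem_filter.mpr ⟨mem_image.mpr (hS e heS), he2⟩
  have h' := (Nat.cast_le (α := ℝ)).mpr h
  rw [card_powersetCard, Nat.cast_choose_two] at h'
  have hpos : (0 : ℝ) < #S := by exact_mod_cast hS0.card_pos
  have : (#S : ℝ) * (#S - 1) ≤ #S * (2 * c) := by linarith
  linarith [le_of_mul_le_mul_left this hpos]

theorem stmt11 (c : ℝ) (hc : 0 ≤ c) :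
    -- there is a constant `A` depending only on `c` such that
    ∃ A : ℝ, 0 < A ∧
      ∀ (V : Type) [Fintype V] [DecidableEq V] (E : Finset (Finset V)),
        -- `(V, E)` is a hypergraph: every hyperedge is nonempty
        (∀ h ∈ E, h.Nonempty) →
        -- for every `V' ⊆ V` the Delaunay graph of the induced sub-hypergraph has at
        -- most `c|V'|` edges
        (∀ V' : Finset V, (delaunayEdgeCount E V' : ℝ) ≤ c * V'.card) →
        -- `d ≥ 1` is the VC-dimension of `H`
        ∀ d : ℕ, 1 ≤ d →
        (∃ V' : Finset V, V'.card = d ∧ Shattered E V') →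
        (∀ V' : Finset V, Shattered E V' → V'.card ≤ d) →
        -- the number of hyperedges of size at most `k` is at most `A·k^(d-1)·n`
        ∀ k : ℕ, 2 ≤ k →
          ((E.filter (fun h => h.card ≤ k)).card : ℝ) ≤ A * k ^ (d - 1) * Fintype.card V := by
  classical
  refine ⟨(2 * c + 2) * (8 * c + 1) ^ ⌈2 * c⌉₊, by positivity, ?_⟩
  intro V _ _ E hne hdel d hd ⟨S₀, hS₀, hshat⟩ hVC k hk
  set F := E.filter (fun h => h.card ≤ k) with hFdef
  rcases isEmpty_or_nonempty V with hV | hV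
  · have hF0 : F = ∅ := filter_eq_empty_iff.mpr fun h hh =>
      absurd (hne h hh) (by simp [eq_empty_of_isEmpty])
    simp [hF0]
  have hk1 : 1 ≤ k := by omega
  have hdegen := fun W : Finset V => exists_coverGraph_degree_le (W := W) hk1
    (fun h hh => (mem_filter.mp hh).2)
    (fun W => (Nat.cast_le.mpr (delaunayEdgeCount_mono (filter_subset _ E) W)).trans (hdel W))
  have hcliques := fun j => card_cliques_le_of_degenerate (coverGraph F) hdegen j univ
  have hsub : F.shatterer ⊆ {∅} ∪ (range d).biUnion fun j =>
      (univ.powersetCard (j + 1)).filter fun S : Finset V =>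
        (coverGraph F).IsClique (S : Set V) := by
    intro S hS
    rw [mem_shatterer] at hS
    have hSd : S.card ≤ d := hVC S fun T hT => by
      obtain ⟨h, hh, hT⟩ := hS hT
      exact ⟨h, (mem_filter.mp hh).1, by rw [inter_comm, hT]⟩
    rw [mem_union, mem_singleton, mem_biUnion]
    rcases S.eq_empty_or_nonempty with rfl | hS0
    · exact Or.inl rfl
    · have := hS0.card_pos
      refine Or.inr ⟨S.card - 1, mem_range.mpr (by omega), mem_filter.mpr
        ⟨mem_powersetCard.mpr ⟨subset_univ _, by omega⟩, isClique_coverGraph_of_shatters hS⟩⟩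
  have hcard := (card_le_card_shatterer F).trans ((card_le_card hsub).trans
    ((card_union_le _ _).trans (Nat.add_le_add_left card_biUnion_le _)))
  have hcard' := (Nat.cast_le (α := ℝ)).mpr hcard
  rw [card_singleton] at hcard'
  push_cast at hcard'
  have hn : (1 : ℝ) ≤ Fintype.card V := by exact_mod_cast Fintype.card_pos
  have hkR : (1 : ℝ) ≤ k := by exact_mod_cast hk1
  have hdc : (d : ℝ) ≤ 2 * c + 1 := by
    rw [← hS₀]
    exact card_le_of_shattered (hdel S₀) hshat (card_pos.mp (by omega))
  have hd1 : d - 1 ≤ ⌈2 * c⌉₊ := by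
    have : (d : ℝ) ≤ ⌈2 * c⌉₊ + 1 := hdc.trans (by gcongr; exact Nat.le_ceil _)
    have : d ≤ ⌈2 * c⌉₊ + 1 := by exact_mod_cast this
    omega
  obtain ⟨M, hM⟩ : ∃ M : ℝ, M = ((8 * c + 1) * k) ^ (d - 1) := ⟨_, rfl⟩
  have hbase : 1 ≤ (8 * c + 1) * k := by nlinarith
  have hM1 : 1 ≤ M := hM ▸ one_le_pow₀ hbase
  have hsum : ∑ j ∈ range d,
      (#((univ.powersetCard (j + 1)).filter fun S : Finset V =>
        (coverGraph F).IsClique (S : Set V)) : ℝ)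
        ≤ d * (M * Fintype.card V) := by
    calc _ ≤ ∑ j ∈ range d, M * (Fintype.card V : ℝ) := by
          refine sum_le_sum fun j hj => (hcliques j).trans ?_
          rw [card_univ, hM]
          gcongr
          calc (8 * c * k) ^ j ≤ ((8 * c + 1) * k) ^ j := by gcongr; linarith
            _ ≤ _ := pow_le_pow_right₀ hbase (Nat.le_sub_one_of_lt (mem_range.mp hj))
      _ = _ := by rw [sum_const, card_range, nsmul_eq_mul]
  calc (F.card : ℝ) ≤ 1 + d * (M * Fintype.card V) := hcard'.trans (by gcongr)
    _ ≤ M * Fintype.card V + (2 * c + 1) * (M * Fintype.card V) := by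
        gcongr
        exact one_le_mul_of_one_le_of_one_le hM1 hn
    _ = (2 * c + 2) * ((8 * c + 1) ^ (d - 1) * k ^ (d - 1)) * Fintype.card V := by
        rw [hM, mul_pow]; ring
    _ ≤ (2 * c + 2) * ((8 * c + 1) ^ ⌈2 * c⌉₊ * k ^ (d - 1)) * Fintype.card V := by
        gcongr
        linarith
    _ = _ := by ring
end

section
/- Let c > 0 be a constant and let H = (V, E) be a c-linear hypergraph on n vertices. Then for every integer k ≥ 2 the number of k-good pairs of vertices of H is at most n·e·c·k, where e is Euler's number. -/
/-- Under the `p`-biased product measure on subsets of `V`, the trace on `h` of a random set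
equals a given `P ⊆ h` with probability `p ^ #P * (1 - p) ^ #(h \ P)`. -/
theorem sum_biased_weight_inter_eq {V : Type*} [Fintype V] [DecidableEq V] (p : ℝ)
    {P h : Finset V} (hP : P ⊆ h) :
    ∑ S : Finset V, (if h ∩ S = P then p ^ S.card * (1 - p) ^ (Finset.univ \ S).card else 0)
      = p ^ P.card * (1 - p) ^ (h \ P).card := by
  have key := Finset.prod_add (fun i => if i ∈ h \ P then 0 else p)
    (fun i => if i ∈ P then 0 else 1 - p) (Finset.univ : Finset V)
  rw [Finset.powerset_univ] at key
  have hterm : ∀ S : Finset V,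
      (if h ∩ S = P then p ^ S.card * (1 - p) ^ (Finset.univ \ S).card else 0)
        = (∏ i ∈ S, if i ∈ h \ P then 0 else p) *
          ∏ i ∈ Finset.univ \ S, if i ∈ P then 0 else 1 - p := by
    intro S
    split_ifs with hS
    · rw [Finset.prod_congr (s₁ := S) rfl (g := fun _ => p),
        Finset.prod_congr (s₁ := Finset.univ \ S) rfl (g := fun _ => 1 - p),
        Finset.prod_const, Finset.prod_const]
      · intro i hi
        grind
      · intro i hi
        grind
    · by_cases hPS : P ⊆ S
      · obtain ⟨i, hi, hiP⟩ : ∃ i ∈ h ∩ S, i ∉ P := by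
          by_contra! hcon
          exact hS (Finset.Subset.antisymm hcon (Finset.subset_inter hP hPS))
        rw [Finset.mem_inter] at hi
        rw [Finset.prod_eq_zero hi.2 (by simp [hi.1, hiP]), zero_mul]
      · obtain ⟨i, hi, hiS⟩ := Finset.not_subset.1 hPS
        rw [Finset.prod_eq_zero (s := Finset.univ \ S) (i := i) (by simp [hiS]) (by simp [hi]),
          mul_zero]
  rw [Finset.sum_congr rfl fun S _ => hterm S, ← key]
  have hfac : ∀ i : V, ((if i ∈ h \ P then 0 else p) + if i ∈ P then 0 else 1 - p)
      = (if i ∈ P then p else 1) * if i ∈ h \ P then 1 - p else 1 := by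
    intro i
    by_cases h1 : i ∈ P <;> by_cases h2 : i ∈ h <;> simp [h1, h2]
  rw [Finset.prod_congr rfl fun i _ => hfac i, Finset.prod_mul_distrib]
  simp only [Finset.prod_ite_mem, Finset.univ_inter, Finset.prod_const]

/-- The expected size of a `p`-random subset of `V` is `p * #V`. -/
theorem sum_biased_weight_mul_card {V : Type*} [Fintype V] [DecidableEq V] (p : ℝ) :
    ∑ S : Finset V, p ^ S.card * (1 - p) ^ (Finset.univ \ S).card * S.card
      = p * Fintype.card V := by
  have hterm : ∀ S : Finset V, p ^ S.card * (1 - p) ^ (Finset.univ \ S).card * S.card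
      = ∑ i : V, if {i} ∩ S = {i} then p ^ S.card * (1 - p) ^ (Finset.univ \ S).card else 0 := by
    intro S
    simp [Finset.inter_eq_left, mul_comm]
  rw [Finset.sum_congr rfl fun S _ => hterm S, Finset.sum_comm,
    Finset.sum_congr rfl fun i _ => sum_biased_weight_inter_eq p (Finset.Subset.refl {i})]
  simp [mul_comm]

/-- A family of pairs, each contained in a hyperedge of size at most `k`, has a number of members
controlled by the expected number of Delaunay edges on a `p`-random vertex set. -/
theorem card_mul_le_sum_biased_weight {V : Type*} [Fintype V] [DecidableEq V]
    (E G : Finset (Finset V)) (k : ℕ)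
    (hG : ∀ P ∈ G, P.card = 2 ∧ ∃ h ∈ E, h.card ≤ k ∧ P ⊆ h)
    {p : ℝ} (hp0 : 0 ≤ p) (hp1 : p ≤ 1) :
    G.card * (p ^ 2 * (1 - p) ^ (k - 2))
      ≤ ∑ S : Finset V, p ^ S.card * (1 - p) ^ (Finset.univ \ S).card
          * delaunayEdgeCount E S := by
  have hq : 0 ≤ 1 - p := by linarith
  choose! f hf using fun P hP => (hG P hP).2
  calc (G.card : ℝ) * (p ^ 2 * (1 - p) ^ (k - 2))
      = ∑ P ∈ G, p ^ 2 * (1 - p) ^ (k - 2) := by rw [Finset.sum_const, nsmul_eq_mul]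
    _ ≤ ∑ P ∈ G, ∑ S : Finset V,
          if f P ∩ S = P then p ^ S.card * (1 - p) ^ (Finset.univ \ S).card else 0 := by
        refine Finset.sum_le_sum fun P hP => ?_
        obtain ⟨-, hcard, hsub⟩ := hf P hP
        rw [sum_biased_weight_inter_eq p hsub, (hG P hP).1]
        refine mul_le_mul_of_nonneg_left (pow_le_pow_of_le_one hq (by linarith) ?_) (by positivity)
        rw [Finset.card_sdiff_of_subset hsub, (hG P hP).1]
        omega
    _ = ∑ S : Finset V, p ^ S.card * (1 - p) ^ (Finset.univ \ S).card
          * (G.filter fun P => f P ∩ S = P).card := by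
        rw [Finset.sum_comm]
        refine Finset.sum_congr rfl fun S _ => ?_
        rw [← Finset.sum_filter, Finset.sum_const, nsmul_eq_mul, mul_comm]
    _ ≤ _ := by
        refine Finset.sum_le_sum fun S _ => mul_le_mul_of_nonneg_left ?_ (by positivity)
        refine Nat.cast_le.2 (Finset.card_le_card fun P hP => ?_)
        rw [Finset.mem_filter] at hP ⊢
        exact ⟨Finset.mem_image.2 ⟨f P, (hf P hP.1).1, hP.2⟩, (hG P hP.1).1⟩

theorem one_le_exp_one_mul_one_sub_inv_pow {k : ℕ} (hk : 2 ≤ k) :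
    1 ≤ Real.exp 1 * (1 - (k : ℝ)⁻¹) ^ (k - 2) := by
  obtain ⟨m, rfl⟩ := Nat.exists_eq_add_of_le hk
  have hm : (0 : ℝ) ≤ m := m.cast_nonneg
  have hinv : (1 - ((2 + m : ℕ) : ℝ)⁻¹) * (1 + ((m : ℝ) + 1)⁻¹) = 1 := by
    push_cast
    field_simp
    ring
  have hpos : 0 ≤ 1 - ((2 + m : ℕ) : ℝ)⁻¹ :=
    sub_nonneg.2 (inv_le_one_of_one_le₀ (by push_cast; linarith))
  have hexp : (1 + ((m : ℝ) + 1)⁻¹) ^ m ≤ Real.exp 1 := by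
    calc (1 + ((m : ℝ) + 1)⁻¹) ^ m ≤ Real.exp ((m : ℝ) + 1)⁻¹ ^ m := by
          gcongr
          linarith [Real.add_one_le_exp ((m : ℝ) + 1)⁻¹]
      _ = Real.exp (m * ((m : ℝ) + 1)⁻¹) := (Real.exp_nat_mul _ _).symm
      _ ≤ Real.exp 1 := by
          refine Real.exp_le_exp.2 ?_
          rw [← div_eq_mul_inv, div_le_one (by positivity)]
          linarith
  rw [Nat.add_sub_cancel_left]
  calc (1 : ℝ) = (1 + ((m : ℝ) + 1)⁻¹) ^ m * (1 - ((2 + m : ℕ) : ℝ)⁻¹) ^ m := by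
        rw [← mul_pow, mul_comm, hinv, one_pow]
    _ ≤ _ := mul_le_mul_of_nonneg_right hexp (pow_nonneg hpos m)

theorem stmt12 {V : Type*} [Fintype V] [DecidableEq V] (E : Finset (Finset V))
    -- `(V, E)` is a hypergraph: every hyperedge is nonempty
    (hne : ∀ h ∈ E, h.Nonempty)
    (c : ℝ) (hc : 0 < c)
    -- `H` is `c`-linear: every induced sub-hypergraph on a vertex set `V'` has at most
    -- `c|V'|` hyperedges of size exactly two
    (hlin : ∀ V' : Finset V, (delaunayEdgeCount E V' : ℝ) ≤ c * V'.card)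
    (k : ℕ) (hk : 2 ≤ k) :
    -- the number of `k`-good pairs of vertices is at most `n·e·c·k`
    (((Finset.univ : Finset (Finset V)).filter (fun P =>
        P.card = 2 ∧ ∃ h ∈ E, h.card ≤ k ∧ P ⊆ h)).card : ℝ)
      ≤ (Fintype.card V) * Real.exp 1 * c * k := by
  set G := (Finset.univ : Finset (Finset V)).filter (fun P =>
    P.card = 2 ∧ ∃ h ∈ E, h.card ≤ k ∧ P ⊆ h)
  have hk0 : (0 : ℝ) < k := by exact_mod_cast (by omega : 0 < k)
  have hp0 : (0 : ℝ) < (k : ℝ)⁻¹ := inv_pos.2 hk0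
  have hp1 : (k : ℝ)⁻¹ ≤ 1 := inv_le_one_of_one_le₀ (by exact_mod_cast (by omega : 1 ≤ k))
  have hq : 0 ≤ 1 - (k : ℝ)⁻¹ := sub_nonneg.2 hp1
  have hlower := card_mul_le_sum_biased_weight E G k (fun P hP => (Finset.mem_filter.1 hP).2)
    hp0.le hp1
  have hupper : ∑ S : Finset V, (k : ℝ)⁻¹ ^ S.card * (1 - (k : ℝ)⁻¹) ^ (Finset.univ \ S).card
      * delaunayEdgeCount E S ≤ c * ((k : ℝ)⁻¹ * Fintype.card V) := by
    rw [← sum_biased_weight_mul_card, Finset.mul_sum]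
    refine Finset.sum_le_sum fun S _ => ?_
    rw [mul_left_comm]
    exact mul_le_mul_of_nonneg_left (hlin S) (by positivity)
  have hG : (G.card : ℝ) * (1 - (k : ℝ)⁻¹) ^ (k - 2) ≤ c * k * Fintype.card V := by
    have h := mul_le_mul_of_nonneg_left (hlower.trans hupper) (sq_nonneg (k : ℝ))
    calc (G.card : ℝ) * (1 - (k : ℝ)⁻¹) ^ (k - 2)
        = (k : ℝ) ^ 2 * (G.card * ((k : ℝ)⁻¹ ^ 2 * (1 - (k : ℝ)⁻¹) ^ (k - 2))) := by
          rw [mul_left_comm, ← mul_assoc ((k : ℝ) ^ 2), ← mul_pow, mul_inv_cancel₀ hk0.ne',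
            one_pow, one_mul]
      _ ≤ (k : ℝ) ^ 2 * (c * ((k : ℝ)⁻¹ * Fintype.card V)) := h
      _ = c * k * Fintype.card V := by field_simp
  calc (G.card : ℝ) = G.card * 1 := (mul_one _).symm
    _ ≤ G.card * (Real.exp 1 * (1 - (k : ℝ)⁻¹) ^ (k - 2)) :=
        mul_le_mul_of_nonneg_left (one_le_exp_one_mul_one_sub_inv_pow hk) (Nat.cast_nonneg _)
    _ = Real.exp 1 * (G.card * (1 - (k : ℝ)⁻¹) ^ (k - 2)) := by ring
    _ ≤ Real.exp 1 * (c * k * Fintype.card V) :=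
        mul_le_mul_of_nonneg_left hG (Real.exp_pos 1).le
    _ = _ := by ring
end

section
/- Let c > 0 be a constant and let H = (V, E) be a c-linear hypergraph on n vertices. Then for every integer k ≥ 2 the number of hyperedges of H of size at most k is at most b_{c,k}·n, where b_{c,k} = 1 + ∑_{h=2}^{k} (2eck)^{h−1}/h! and e is Euler's number. -/
open Finset in
/-- If every finite set `W` of vertices spans at most `d * #W / 2` edges, then it spans at most
`d ^ h / (h + 1)! * #W` cliques of size `h + 1`. -/
theorem card_isNClique_le_of_sum_card_adj_le {V : Type*} [DecidableEq V]
    (G : SimpleGraph V) [DecidableRel G.Adj] (d : ℝ) (hd : 0 ≤ d)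
    (hG : ∀ W : Finset V, (∑ v ∈ W, (#{u ∈ W | G.Adj v u} : ℝ)) ≤ d * #W)
    (h : ℕ) (W : Finset V) :
    (#{s ∈ W.powerset | G.IsNClique (h + 1) s} : ℝ) ≤ d ^ h / (h + 1).factorial * #W := by
  induction h generalizing W with
  | zero =>
    have hsub : {s ∈ W.powerset | G.IsNClique (0 + 1) s} ⊆ W.powersetCard 1 := by
      intro s hs
      rw [mem_filter, mem_powerset] at hs
      exact mem_powersetCard.2 ⟨hs.1, hs.2.card_eq⟩
    have hcard := card_le_card hsub
    rw [card_powersetCard, Nat.choose_one_right] at hcard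
    simpa using hcard
  | succ h ih =>
    set C := {s ∈ W.powerset | G.IsNClique (h + 1 + 1) s} with hC
    have hcount : (h + 2) * #C = ∑ v ∈ W, #{s ∈ C | v ∈ s} := by
      have hdouble := sum_card_bipartiteAbove_eq_sum_card_bipartiteBelow
        (s := W) (t := C) (fun v s => v ∈ s)
      simp only [bipartiteAbove, bipartiteBelow] at hdouble
      rw [hdouble, sum_const_nat (m := h + 2), mul_comm]
      intro s hs
      rw [hC, mem_filter, mem_powerset] at hs
      rw [filter_mem_eq_inter, inter_eq_right.2 hs.1, hs.2.card_eq]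
    have hlink : ∀ v ∈ W, #{s ∈ C | v ∈ s} ≤
        #{s ∈ ({u ∈ W | G.Adj v u} : Finset V).powerset | G.IsNClique (h + 1) s} := by
      intro v _
      refine card_le_card_of_injOn (fun s => s.erase v) ?_ ?_
      · intro s hs
        simp only [hC, coe_filter, mem_filter, mem_powerset, Set.mem_ofPred_eq] at hs ⊢
        obtain ⟨⟨hsW, hs⟩, hv⟩ := hs
        refine ⟨fun u hu => ?_, hs.erase_of_mem hv⟩
        rw [mem_erase] at hu
        exact mem_filter.2 ⟨hsW hu.2, hs.isClique hv hu.2 hu.1.symm⟩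
      · intro s hs t ht hst
        simp only [coe_filter, Set.mem_ofPred_eq] at hs ht
        rw [← insert_erase hs.2, ← insert_erase ht.2]
        exact congrArg (insert v) hst
    have hcountR : ((h : ℝ) + 2) * #C ≤ d ^ h / (h + 1).factorial * (d * #W) := by
      calc ((h : ℝ) + 2) * #C = ∑ v ∈ W, (#{s ∈ C | v ∈ s} : ℝ) := by exact_mod_cast hcount
        _ ≤ ∑ v ∈ W, d ^ h / (h + 1).factorial * (#{u ∈ W | G.Adj v u} : ℝ) :=
          sum_le_sum fun v hv => (Nat.cast_le.2 (hlink v hv)).trans (ih _)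
        _ ≤ _ := by
          rw [← mul_sum]
          exact mul_le_mul_of_nonneg_left (hG W) (by positivity)
    rw [Nat.factorial_succ (h + 1)]
    have hpos : (0 : ℝ) < (h : ℝ) + 2 := by positivity
    rw [← mul_le_mul_iff_right₀ hpos]
    refine hcountR.trans_eq ?_
    push_cast
    field_simp
    ring

open Finset in
/-- In a random subset of `W` containing each element independently with probability `p`, the
trace on `B ⊆ W` equals `A ⊆ B` with probability `p ^ #A * (1 - p) ^ #(B \ A)`. -/
theorem sum_powerset_filter_inter_eq {V : Type*} [DecidableEq V] (p : ℝ) {A B W : Finset V}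
    (hAB : A ⊆ B) (hBW : B ⊆ W) :
    ∑ S ∈ W.powerset with B ∩ S = A, p ^ #S * (1 - p) ^ #(W \ S) =
      p ^ #A * (1 - p) ^ #(B \ A) := by
  have key := prod_add (fun i => if i ∈ B \ A then 0 else p)
    (fun i => if i ∈ A then 0 else 1 - p) W
  have hterm : ∀ S ∈ W.powerset,
      (∏ i ∈ S, (if i ∈ B \ A then 0 else p)) * ∏ i ∈ W \ S, (if i ∈ A then 0 else 1 - p) =
      if B ∩ S = A then p ^ #S * (1 - p) ^ #(W \ S) else 0 := by
    intro S hS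
    split_ifs with hBS
    · rw [prod_congr (s₁ := S) rfl (g := fun _ => p),
        prod_congr (s₁ := W \ S) rfl (g := fun _ => 1 - p), prod_const, prod_const]
      · intro i hi
        rw [if_neg]
        intro hiA
        rw [← hBS] at hiA
        exact (mem_sdiff.1 hi).2 (mem_inter.1 hiA).2
      · intro i hi
        rw [if_neg]
        intro hiA
        rw [← hBS] at hiA
        simp [hi] at hiA
    · by_cases hA : A ⊆ S
      · have hex : ∃ i ∈ B ∩ S, i ∉ A := by
          by_contra! hcon
          exact hBS (Subset.antisymm hcon (subset_inter hAB hA))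
        obtain ⟨i, hi, hiA⟩ := hex
        rw [mem_inter] at hi
        have hiBA : i ∈ B \ A := mem_sdiff.2 ⟨hi.1, hiA⟩
        rw [prod_eq_zero hi.2 (by rw [if_pos hiBA]), zero_mul]
      · obtain ⟨i, hiA, hiS⟩ := not_subset.1 hA
        have hiWS : i ∈ W \ S := mem_sdiff.2 ⟨hBW (hAB hiA), hiS⟩
        rw [prod_eq_zero hiWS (by rw [if_pos hiA]), mul_zero]
  rw [sum_filter, ← sum_congr rfl hterm, ← key, ← prod_sdiff hBW, ← prod_sdiff hAB,
    prod_eq_one (s := W \ B), prod_congr rfl (s₁ := B \ A) (g := fun _ => 1 - p),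
    prod_congr rfl (s₁ := A) (g := fun _ => p), prod_const, prod_const, one_mul, mul_comm]
  · intro i hi
    simp [hi]
  · intro i hi
    have hiA := (mem_sdiff.1 hi).2
    simp [hiA, (mem_sdiff.1 hi).1]
  · intro i hi
    have hiB := (mem_sdiff.1 hi).2
    have hiA : i ∉ A := fun hiA => hiB (hAB hiA)
    simp [hiB, hiA]

open Finset in
/-- The expected size of a random subset of `W` containing each element independently with
probability `p`. -/
theorem sum_powerset_mul_card {V : Type*} [DecidableEq V] (p : ℝ) (W : Finset V) :
    ∑ S ∈ W.powerset, p ^ #S * (1 - p) ^ #(W \ S) * #S = p * #W := by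
  have hcard : ∀ S ∈ W.powerset, p ^ #S * (1 - p) ^ #(W \ S) * (#S : ℝ) =
      ∑ v ∈ W, if {v} ∩ S = {v} then p ^ #S * (1 - p) ^ #(W \ S) else 0 := by
    intro S hS
    rw [← sum_filter, sum_const, nsmul_eq_mul, mul_comm]
    congr 3
    ext v
    have := mem_powerset.1 hS
    simp only [mem_filter, inter_eq_left, singleton_subset_iff]
    exact ⟨fun hv => ⟨this hv, hv⟩, fun hv => hv.2⟩
  rw [sum_congr rfl hcard, sum_comm, sum_congr rfl (g := fun _ => p)]
  · simp [mul_comm]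
  · intro v hv
    rw [← sum_filter, sum_powerset_filter_inter_eq p Subset.rfl (singleton_subset_iff.2 hv)]
    simp

theorem exp_neg_one_le_one_sub_inv_pow {k : ℕ} (hk : 2 ≤ k) :
    Real.exp (-1) ≤ (1 - (k : ℝ)⁻¹) ^ (k - 2) := by
  obtain ⟨m, rfl⟩ := Nat.exists_eq_add_of_le' hk
  have hbase : Real.exp (-(1 / ((m : ℝ) + 1))) ≤ 1 - ((m + 2 : ℕ) : ℝ)⁻¹ := by
    rw [Real.exp_neg]
    have hexp := Real.add_one_le_exp (1 / ((m : ℝ) + 1))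
    refine (inv_anti₀ (by positivity) hexp).trans_eq ?_
    push_cast
    field_simp
    ring
  calc Real.exp (-1) ≤ Real.exp (m * -(1 / ((m : ℝ) + 1))) := by
        rw [Real.exp_le_exp, mul_neg, neg_le_neg_iff, mul_one_div, div_le_one (by positivity)]
        linarith
    _ = Real.exp (-(1 / ((m : ℝ) + 1))) ^ m := Real.exp_nat_mul _ _
    _ ≤ _ := pow_le_pow_left₀ (Real.exp_pos _).le hbase _

/-- The graph joining two vertices when some hyperedge of size at most `k` contains both. -/
def smallEdgeGraph {V : Type*} (E : Finset (Finset V)) (k : ℕ) : SimpleGraph V where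
  Adj u v := u ≠ v ∧ ∃ h ∈ E, h.card ≤ k ∧ u ∈ h ∧ v ∈ h
  symm := ⟨fun _ _ huv => ⟨huv.1.symm, huv.2.imp fun _ hh => ⟨hh.1, hh.2.1, hh.2.2.2, hh.2.2.1⟩⟩⟩
  loopless := ⟨fun _ hu => hu.1 rfl⟩

open Finset in
theorem card_le_two_mul_delaunayEdgeCount {V : Type*} [DecidableEq V] (E : Finset (Finset V))
    (S : Finset V) (P : Finset (V × V))
    (hP : ∀ q ∈ P, q.1 ≠ q.2 ∧ ∃ h ∈ E, h ∩ S = {q.1, q.2}) :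
    #P ≤ 2 * delaunayEdgeCount E S := by
  have hsub : P ⊆ ((E.image (· ∩ S)).filter (fun h => h.card = 2)).biUnion offDiag := by
    intro q hq
    obtain ⟨hne, h, hE, hS⟩ := hP q hq
    refine mem_biUnion.2 ⟨{q.1, q.2}, mem_filter.2 ⟨mem_image.2 ⟨h, hE, hS⟩, card_pair hne⟩, ?_⟩
    simp [mem_offDiag, hne]
  refine (card_le_card hsub).trans (card_biUnion_le.trans_eq ?_)
  rw [sum_const_nat (m := 2), mul_comm, delaunayEdgeCount]
  intro h hh
  rw [offDiag_card, (mem_filter.1 hh).2]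

open Finset in
theorem sum_card_smallEdgeGraph_adj_le {V : Type*} [DecidableEq V]
    (E : Finset (Finset V)) (c : ℝ)
    (hlin : ∀ V' : Finset V, (delaunayEdgeCount E V' : ℝ) ≤ c * V'.card)
    {k : ℕ} (hk : 2 ≤ k) [DecidableRel (smallEdgeGraph E k).Adj] (W : Finset V) :
    (∑ v ∈ W, (#{u ∈ W | (smallEdgeGraph E k).Adj v u} : ℝ)) ≤
      2 * Real.exp 1 * c * k * #W := by
  set P : Finset (V × V) := {q ∈ W ×ˢ W | (smallEdgeGraph E k).Adj q.1 q.2} with hP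
  have hPcard : (∑ v ∈ W, (#{u ∈ W | (smallEdgeGraph E k).Adj v u} : ℝ)) = #P := by
    simp only [hP, card_filter]
    rw [sum_product]
    push_cast
    rfl
  have hwit : ∀ q : V × V, ∃ h, q ∈ P → h ∈ E ∧ #h ≤ k ∧ q.1 ∈ h ∧ q.2 ∈ h := by
    intro q
    by_cases hq : q ∈ P
    · obtain ⟨h, hh⟩ := (mem_filter.1 hq).2.2
      exact ⟨h, fun _ => hh⟩
    · exact ⟨∅, fun h => absurd h hq⟩
  choose g hg using hwit
  have hk0 : (0 : ℝ) < k := by positivity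
  set p : ℝ := (k : ℝ)⁻¹ with hp
  have hp0 : 0 < p := by positivity
  have hp1 : 0 ≤ 1 - p := sub_nonneg.2 (inv_le_one_of_one_le₀ (by exact_mod_cast (by omega)))
  have hlower : ∀ q ∈ P, p ^ 2 * Real.exp (-1) ≤
      ∑ S ∈ W.powerset with (g q ∩ W) ∩ S = {q.1, q.2}, p ^ #S * (1 - p) ^ #(W \ S) := by
    intro q hq
    obtain ⟨-, hqk, hq1, hq2⟩ := hg q hq
    have hqP := mem_filter.1 hq
    have hqW := mem_product.1 hqP.1
    have hsub : ({q.1, q.2} : Finset V) ⊆ g q ∩ W := by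
      simp [insert_subset_iff, hq1, hq2, hqW.1, hqW.2]
    rw [sum_powerset_filter_inter_eq p hsub inter_subset_right, card_sdiff_of_subset hsub,
      card_pair hqP.2.1]
    refine mul_le_mul_of_nonneg_left ((exp_neg_one_le_one_sub_inv_pow hk).trans ?_) (by positivity)
    refine pow_le_pow_of_le_one hp1 (by linarith) ?_
    have := card_le_card (inter_subset_left : g q ∩ W ⊆ g q)
    omega
  have hupper : ∀ S ∈ W.powerset,
      (#{q ∈ P | (g q ∩ W) ∩ S = {q.1, q.2}} : ℝ) ≤ 2 * (c * #S) := by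
    intro S hS
    have hcount := card_le_two_mul_delaunayEdgeCount E S
      {q ∈ P | (g q ∩ W) ∩ S = {q.1, q.2}} (by
        intro q hq
        rw [mem_filter] at hq
        refine ⟨(mem_filter.1 hq.1).2.1, g q, (hg q hq.1).1, ?_⟩
        rw [← hq.2, inter_assoc, inter_eq_right.2 (mem_powerset.1 hS)])
    calc (#{q ∈ P | (g q ∩ W) ∩ S = {q.1, q.2}} : ℝ) ≤ 2 * delaunayEdgeCount E S := by
          exact_mod_cast hcount
      _ ≤ _ := by linarith [hlin S]
  have hmain : #P * (p ^ 2 * Real.exp (-1)) ≤ 2 * c * (p * #W) := by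
    calc #P * (p ^ 2 * Real.exp (-1)) = ∑ q ∈ P, p ^ 2 * Real.exp (-1) := by simp
      _ ≤ ∑ q ∈ P, ∑ S ∈ W.powerset with (g q ∩ W) ∩ S = {q.1, q.2},
          p ^ #S * (1 - p) ^ #(W \ S) := sum_le_sum hlower
      _ = ∑ S ∈ W.powerset, p ^ #S * (1 - p) ^ #(W \ S) *
          #{q ∈ P | (g q ∩ W) ∩ S = {q.1, q.2}} := by
        simp only [sum_filter]
        rw [sum_comm]
        refine sum_congr rfl fun S _ => ?_
        rw [← sum_filter, sum_const, nsmul_eq_mul, mul_comm]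
      _ ≤ ∑ S ∈ W.powerset, p ^ #S * (1 - p) ^ #(W \ S) * (2 * (c * #S)) :=
        sum_le_sum fun S hS => mul_le_mul_of_nonneg_left (hupper S hS) (by positivity)
      _ = 2 * c * (p * #W) := by
        rw [← sum_powerset_mul_card p W, mul_sum]
        exact sum_congr rfl fun S _ => by ring
  rw [hPcard]
  rw [Real.exp_neg, hp] at hmain
  have hscaled := mul_le_mul_of_nonneg_right hmain
    (by positivity : 0 ≤ (k : ℝ) ^ 2 * Real.exp 1)
  calc (#P : ℝ) = #P * ((k : ℝ)⁻¹ ^ 2 * (Real.exp 1)⁻¹) * ((k : ℝ) ^ 2 * Real.exp 1) := by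
        field_simp
    _ ≤ _ := hscaled
    _ = _ := by field_simp

theorem stmt13 {V : Type*} [Fintype V] [DecidableEq V] (E : Finset (Finset V))
    -- `(V, E)` is a hypergraph: every hyperedge is nonempty
    (hne : ∀ h ∈ E, h.Nonempty)
    (c : ℝ) (hc : 0 < c)
    -- `H` is `c`-linear: every induced sub-hypergraph on a vertex set `V'` has at most
    -- `c|V'|` hyperedges of size exactly two
    (hlin : ∀ V' : Finset V, (delaunayEdgeCount E V' : ℝ) ≤ c * V'.card)
    (k : ℕ) (hk : 2 ≤ k) :
    -- the number of hyperedges of size at most `k` is at most `b_{c,k}·n` where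
    -- `b_{c,k} = 1 + ∑_{h=2}^{k} (2eck)^{h-1}/h!`
    ((E.filter (fun h => h.card ≤ k)).card : ℝ) ≤
      (1 + ∑ h ∈ Finset.Icc 2 k,
        (2 * Real.exp 1 * c * k) ^ (h - 1) / (Nat.factorial h : ℝ)) * Fintype.card V := by
  classical
  have hd : 0 ≤ 2 * Real.exp 1 * c * k := by positivity
  have hclique : ∀ j, ((E.filter (fun h => h.card ≤ k ∧ h.card = j + 1)).card : ℝ) ≤
      (2 * Real.exp 1 * c * k) ^ j / (j + 1).factorial * Fintype.card V := by
    intro j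
    refine le_trans ?_ (card_isNClique_le_of_sum_card_adj_le (smallEdgeGraph E k) _ hd
      (sum_card_smallEdgeGraph_adj_le E c hlin hk) j Finset.univ)
    refine Nat.cast_le.2 (Finset.card_le_card fun h hh => ?_)
    obtain ⟨hE, hhk, hj⟩ := Finset.mem_filter.1 hh
    refine Finset.mem_filter.2 ⟨by simp, ⟨fun u hu v hv huv => ?_, hj⟩⟩
    exact ⟨huv, h, hE, hhk, hu, hv⟩
  have hfiber : (E.filter (fun h => h.card ≤ k)).card =
      ∑ j ∈ Finset.Icc 1 k, (E.filter (fun h => h.card ≤ k ∧ h.card = j)).card := by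
    rw [Finset.card_eq_sum_card_fiberwise (f := Finset.card) (t := Finset.Icc 1 k)]
    · simp only [Finset.filter_filter]
    · intro h hh
      obtain ⟨hE, hhk⟩ := Finset.mem_filter.1 hh
      exact Finset.mem_coe.2 (Finset.mem_Icc.2 ⟨(hne h hE).card_pos, hhk⟩)
  rw [hfiber, Nat.cast_sum, ← Finset.add_sum_Ioc_eq_sum_Icc (by omega), add_mul, Finset.sum_mul]
  refine add_le_add (by simpa using hclique 0) ?_
  refine Finset.sum_le_sum fun j hj => ?_
  have hj2 : 2 ≤ j := (Finset.mem_Icc.1 hj).1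
  have hbound := hclique (j - 1)
  rwa [Nat.sub_add_cancel (by omega)] at hbound
end
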